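/- arXiv:1104.3960 — 2 statements merged into one kernel-verified Lean document; each statement's English description precedes it below -/
import Mathlib

section
/- For each γ > 0 there exists a constant C > 0 such that C^{-1}|1−⟨z,v⟩| ≤ |1−⟨z,u⟩| ≤ C|1−⟨z,v⟩| for all z in the closed unit ball of ℂ^n and all u, v ∈ 𝔹_n with β(u,v) < γ. -/
open MeasureTheory Filter Topology
open scoped Classical ENNReal

noncomputable section

/-- `ℂⁿ` with the Euclidean norm. -/
abbrev En (n : ℕ) := EuclideanSpace ℂ (Fin n)

instance (n : ℕ) : MeasurableSpace (En n) := borel _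
instance (n : ℕ) : BorelSpace (En n) := ⟨rfl⟩

/-- The Lebesgue volume measure on `ℂⁿ`. -/
def vol (n : ℕ) : Measure (En n) := Measure.addHaar

/-- The open unit ball `𝔹ₙ` of `ℂⁿ`. -/
def uball (n : ℕ) : Set (En n) := Metric.ball 0 1

/-- The Hermitian pairing `⟨z,w⟩ = ∑ⱼ zⱼ * conj wⱼ`. -/
def herm {n : ℕ} (z w : En n) : ℂ := ∑ j, z j * (starRingEnd ℂ) (w j)

/-- The orthogonal projection `P_z w` onto the line spanned by `z`. -/
def prj {n : ℕ} (z w : En n) : En n :=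
  if z = 0 then 0 else (herm w z / herm z z) • z

/-- The Möbius automorphism `φ_z` of the unit ball. -/
def mobius {n : ℕ} (z w : En n) : En n :=
  ((1 : ℂ) / (1 - herm w z)) •
    (z - prj z w - ((Real.sqrt (1 - ‖z‖ ^ 2) : ℝ) : ℂ) • (w - prj z w))

/-- The Bergman metric `β(z,w)`. -/
def bmet {n : ℕ} (z w : En n) : ℝ :=
  (1 / 2) * Real.log ((1 + ‖mobius z w‖) / (1 - ‖mobius z w‖))

/-- The Bergman metric ball `D(z,γ)`. -/
def Dball {n : ℕ} (z : En n) (γ : ℝ) : Set (En n) :=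
  {w | w ∈ uball n ∧ bmet z w < γ}

/-- The normalizing constant `c_α`. -/
def cnorm (n : ℕ) (α : ℝ) : ℝ :=
  if -1 < α then Real.Gamma (n + α + 1) / (n.factorial * Real.Gamma (α + 1)) else 1

/-- The weighted measure `dv_α = c_α (1-|z|²)^α dv` on the unit ball. -/
def measA (n : ℕ) (α : ℝ) : Measure (En n) :=
  ((vol n).restrict (uball n)).withDensity
    (fun z => ENNReal.ofReal (cnorm n α * (1 - ‖z‖ ^ 2) ^ α))

/-- The invariant measure `dτ = (1-|z|²)^{-(n+1)} dv` on the unit ball. -/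
def measTau (n : ℕ) : Measure (En n) :=
  ((vol n).restrict (uball n)).withDensity
    (fun z => ENNReal.ofReal ((1 - ‖z‖ ^ 2) ^ (-((n : ℝ) + 1))))

/-- The Bergman space (quasi-)norm `‖f‖_{p,α}`, valued in `ℝ≥0∞`. -/
def apnorm (n : ℕ) (p α : ℝ) (f : En n → ℂ) : ℝ≥0∞ :=
  (∫⁻ z, ENNReal.ofReal (‖f z‖ ^ p) ∂measA n α) ^ (1 / p)

/-- The radial derivative `Rf(z) = ∑ z_k ∂f/∂z_k = Df(z)[z]`. -/
def radD {n : ℕ} (f : En n → ℂ) (z : En n) : ℂ := fderiv ℂ f z z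

/-- Iterated radial derivative `R^k f`. -/
def radIter {n : ℕ} : ℕ → (En n → ℂ) → En n → ℂ
  | 0, f => f
  | (k + 1), f => radD (radIter k f)

/-- The pseudo-metric `ϱ` on the unit ball. -/
def rho {n : ℕ} (z w : En n) : ℝ :=
  if z ≠ 0 ∧ w ≠ 0 then
    |‖z‖ - ‖w‖| + ‖1 - herm z w / ((‖z‖ : ℂ) * (‖w‖ : ℂ))‖
  else ‖z‖ + ‖w‖

lemma herm_eq {n : ℕ} (z w : En n) : herm z w = inner ℂ w z := by
  simp [herm, PiLp.inner_apply]

lemma norm_comb {n : ℕ} (u v : En n) (a : ℂ) (s : ℝ) :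
    ‖a • u - (s : ℂ) • v‖ ^ 2 =
      (a.re ^ 2 + a.im ^ 2) * ‖u‖ ^ 2
        - 2 * s * (a.re * (herm v u).re + a.im * (herm v u).im) + s ^ 2 * ‖v‖ ^ 2 := by
  rw [@norm_sub_sq ℂ, inner_smul_left, inner_smul_right, ← herm_eq, norm_smul, norm_smul,
    mul_pow, mul_pow, Complex.sq_norm, Complex.sq_norm, Complex.normSq_apply, Complex.normSq_apply]
  simp
  ring

lemma herm_self {n : ℕ} (u : En n) : herm u u = ((‖u‖ ^ 2 : ℝ) : ℂ) := by
  rw [herm_eq, inner_self_eq_norm_sq_to_K]; simp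

lemma num_sq {n : ℕ} (u v : En n) (hu : ‖u‖ < 1) :
    ‖u - prj u v - ((Real.sqrt (1 - ‖u‖ ^ 2) : ℝ) : ℂ) • (v - prj u v)‖ ^ 2
      = ‖1 - herm v u‖ ^ 2 - (1 - ‖u‖ ^ 2) * (1 - ‖v‖ ^ 2) := by
  by_cases h0 : u = 0
  · subst h0
    simp [prj, herm]
  have hN : ‖u‖ ^ 2 ≠ 0 := by simpa using h0
  have hs : Real.sqrt (1 - ‖u‖ ^ 2) ^ 2 = 1 - ‖u‖ ^ 2 :=
    Real.sq_sqrt (by nlinarith [norm_nonneg u])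
  set s := Real.sqrt (1 - ‖u‖ ^ 2) with hsdef
  have e : u - prj u v - (s : ℂ) • (v - prj u v)
      = (1 - (1 - (s : ℂ)) * (herm v u / ((‖u‖ ^ 2 : ℝ) : ℂ))) • u - (s : ℂ) • v := by
    rw [prj, if_neg h0, herm_self]
    module
  rw [e, norm_comb, Complex.sq_norm, Complex.normSq_apply]
  have e1 : (1 - (1 - (s : ℂ)) * (herm v u / ((‖u‖ ^ 2 : ℝ) : ℂ)))
      = ((1 - (1 - s) * ((herm v u).re / ‖u‖ ^ 2) : ℝ) : ℂ)
        + ((-((1 - s) * ((herm v u).im / ‖u‖ ^ 2)) : ℝ) : ℂ) * Complex.I := by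
    conv_lhs => rw [← Complex.re_add_im (herm v u)]
    push_cast
    ring
  have hre : ∀ x y : ℝ, ((x : ℂ) + (y : ℂ) * Complex.I).re = x := by intro x y; simp
  have him : ∀ x y : ℝ, ((x : ℂ) + (y : ℂ) * Complex.I).im = y := by intro x y; simp
  rw [e1, hre, him, Complex.sub_re, Complex.sub_im, Complex.one_re, Complex.one_im]
  generalize (herm v u).re = x
  generalize (herm v u).im = y
  generalize ‖v‖ ^ 2 = M
  clear_value s
  generalize ‖u‖ ^ 2 = N at *
  have hN' : N = 1 - s ^ 2 := by linarith
  field_simp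
  subst hN'
  ring

lemma key {n : ℕ} (z u v : En n) (hz : ‖z‖ ≤ 1) (hu : ‖u‖ < 1) (hv : ‖v‖ < 1) (E : ℝ)
    (hE : 0 < E) (h : ‖1 - herm v u‖ ^ 2 ≤ E * ((1 - ‖u‖ ^ 2) * (1 - ‖v‖ ^ 2))) :
    ‖1 - herm z u‖ ≤ (4 + 8 * E) * ‖1 - herm z v‖ := by
  have id1 : 1 - herm z u = (1 - herm z v) - inner ℂ (u - v) (z - v) + (1 - herm v u)
      - ((1 - ‖v‖ ^ 2 : ℝ) : ℂ) := by
    have := herm_self v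
    rw [herm_eq] at this
    simp only [herm_eq, inner_sub_left, inner_sub_right, this]
    push_cast
    ring
  have hre : ∀ x y : En n, ‖x‖ ≤ 1 → ‖y‖ ≤ 1 → ‖y - x‖ ^ 2 ≤ 2 * ‖1 - herm x y‖ := by
    intro x y hx hy
    rw [@norm_sub_sq ℂ, ← herm_eq]
    have := Complex.re_le_norm (1 - herm x y)
    simp at this ⊢
    nlinarith [norm_nonneg x, norm_nonneg y]
  have hlow : ∀ x y : En n, ‖x‖ ≤ 1 → ‖y‖ ≤ 1 → 1 - ‖y‖ ^ 2 ≤ 2 * ‖1 - herm x y‖ := by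
    intro x y hx hy
    have h1 : ‖herm x y‖ ≤ ‖y‖ * ‖x‖ := by rw [herm_eq]; exact norm_inner_le_norm y x
    have h2 : (1 : ℝ) - ‖herm x y‖ ≤ ‖1 - herm x y‖ := by
      simpa using norm_sub_norm_le (1 : ℂ) (herm x y)
    nlinarith [norm_nonneg x, norm_nonneg y]
  have a1 := hre z v hz hv.le
  have a2 := hre v u hv.le hu.le
  have a3 := hlow z v hz hv.le
  have a4 := hlow v u hv.le hu.le
  have cs : ‖inner ℂ (u - v) (z - v)‖ ≤ ‖u - v‖ * ‖z - v‖ := norm_inner_le_norm _ _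
  rw [norm_sub_rev v z] at a1
  set a := ‖1 - herm z v‖
  set b := ‖1 - herm v u‖
  have hu2 : 0 < 1 - ‖u‖ ^ 2 := by nlinarith [norm_nonneg u]
  have hv2 : 0 < 1 - ‖v‖ ^ 2 := by nlinarith [norm_nonneg v]
  have hb : 0 < b := by linarith
  have b1 : b ≤ 2 * E * (1 - ‖v‖ ^ 2) := by
    have h1 : E * ((1 - ‖u‖ ^ 2) * (1 - ‖v‖ ^ 2)) ≤ E * ((2 * b) * (1 - ‖v‖ ^ 2)) := by gcongr
    have : b * b ≤ b * (2 * E * (1 - ‖v‖ ^ 2)) := by nlinarith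
    exact le_of_mul_le_mul_left this hb
  have b2 : b ≤ 4 * E * a := by
    calc b ≤ 2 * E * (1 - ‖v‖ ^ 2) := b1
      _ ≤ 2 * E * (2 * a) := by gcongr
      _ = _ := by ring
  have n1 : ‖1 - herm z u‖ ≤ a + ‖inner ℂ (u - v) (z - v)‖ + b + (1 - ‖v‖ ^ 2) := by
    rw [id1]
    refine (norm_sub_le _ _).trans ?_
    rw [Complex.norm_real, Real.norm_of_nonneg hv2.le]
    gcongr
    refine (norm_add_le _ _).trans ?_
    gcongr
    exact norm_sub_le _ _
  nlinarith [sq_nonneg (‖u - v‖ - ‖z - v‖)]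

lemma herm_symm_norm {n : ℕ} (u v : En n) : ‖1 - herm u v‖ = ‖1 - herm v u‖ := by
  rw [← Complex.norm_conj]
  congr 1
  simp [herm_eq]

lemma bm {n : ℕ} (u v : En n) (hu : ‖u‖ < 1) (hv : ‖v‖ < 1) (γ : ℝ) (h : bmet u v < γ) :
    ‖1 - herm v u‖ ^ 2 ≤ Real.exp (2 * γ) * ((1 - ‖u‖ ^ 2) * (1 - ‖v‖ ^ 2)) := by
  have hu2 : 0 < 1 - ‖u‖ ^ 2 := by nlinarith [norm_nonneg u]
  have hv2 : 0 < 1 - ‖v‖ ^ 2 := by nlinarith [norm_nonneg v]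
  have hp := mul_pos hu2 hv2
  have hD : 0 < ‖1 - herm v u‖ := by
    have h1 : ‖herm v u‖ ≤ ‖u‖ * ‖v‖ := by rw [herm_eq]; exact norm_inner_le_norm u v
    have h2 : (1 : ℝ) - ‖herm v u‖ ≤ ‖1 - herm v u‖ := by
      simpa using norm_sub_norm_le (1 : ℂ) (herm v u)
    nlinarith [norm_nonneg u, norm_nonneg v]
  have hm : ‖1 - herm v u‖ ^ 2 * ‖mobius u v‖ ^ 2
      = ‖1 - herm v u‖ ^ 2 - (1 - ‖u‖ ^ 2) * (1 - ‖v‖ ^ 2) := by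
    rw [← num_sq u v hu, mobius, norm_smul, mul_pow, norm_div, norm_one]
    field_simp
  unfold bmet at h
  set r := ‖mobius u v‖
  have hr : 0 ≤ r := norm_nonneg _
  set D := ‖1 - herm v u‖ ^ 2
  have hD2 : 0 < D := by positivity
  have hr1 : r < 1 := by
    by_contra hc
    have : 1 ≤ r ^ 2 := by nlinarith
    nlinarith
  have hlt : (1 + r) / (1 - r) < Real.exp (2 * γ) := by
    rw [← Real.log_lt_iff_lt_exp (div_pos (by linarith) (by linarith))]
    linarith
  rw [div_lt_iff₀ (by linarith)] at hlt
  have hE := Real.exp_pos (2 * γ)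
  have h1 : 1 ≤ Real.exp (2 * γ) * (1 - r ^ 2) := by
    have : 0 ≤ Real.exp (2 * γ) * (1 - r) * r := by
      have : 0 < 1 - r := by linarith
      positivity
    nlinarith
  have : (1 - ‖u‖ ^ 2) * (1 - ‖v‖ ^ 2) = D * (1 - r ^ 2) := by linarith
  rw [this]
  nlinarith

/-- For each `γ > 0` there is `C > 0` such that
`|1-⟨z,u⟩| ≈ |1-⟨z,v⟩|` for all `z` in the closed unit ball and `u, v ∈ 𝔹ₙ` with
`β(u,v) < γ`. -/
theorem stmt2 (n : ℕ) (hn : 1 ≤ n) (γ : ℝ) (hγ : 0 < γ) :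
    ∃ C : ℝ, 0 < C ∧ ∀ z : En n, ‖z‖ ≤ 1 → ∀ u ∈ uball n, ∀ v ∈ uball n, bmet u v < γ →
      C⁻¹ * ‖1 - herm z v‖ ≤ ‖1 - herm z u‖ ∧ ‖1 - herm z u‖ ≤ C * ‖1 - herm z v‖ := by
  have hE := Real.exp_pos (2 * γ)
  refine ⟨4 + 8 * Real.exp (2 * γ), by positivity, ?_⟩
  intro z hz u hu v hv h
  have hu' : ‖u‖ < 1 := by simpa [uball] using hu
  have hv' : ‖v‖ < 1 := by simpa [uball] using hv
  have hb := bm u v hu' hv' γ h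
  refine ⟨?_, key z u v hz hu' hv' _ hE hb⟩
  rw [inv_mul_le_iff₀ (by positivity)]
  refine key z v u hz hv' hu' _ hE ?_
  rw [herm_symm_norm, mul_comm (1 - ‖v‖ ^ 2)]
  exact hb
end
end

section
/- Suppose p > 0, α > −1, and b > n·max{1, 1/p} + (α+1)/p. Then there exists a sequence {a_k} in 𝔹_n such that a holomorphic function f on 𝔹_n belongs to A^p_α if and only if there exists a sequence (c_k) ∈ ℓ^p of complex numbers with f(z) = Σ_{k=1}^∞ c_k (1−|a_k|²)^{(pb−n−1−α)/p}/(1−⟨z,a_k⟩)^b for all z ∈ 𝔹_n, the series converging in the (quasi-)norm topology of A^p_α; moreover there is a constant C > 0 with C^{-1} inf{Σ_k |c_k|^p} ≤ ∫_{𝔹_n} |f|^p dv_α ≤ C inf{Σ_k |c_k|^p}, where the infimum runs over all such representations of f. -/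
open MeasureTheory Filter Topology
open scoped Classical ENNReal

noncomputable section

/-- The Coifman–Rochberg "atom" `(1-|a_k|²)^{(pb-n-1-α)/p} / (1-⟨z,a_k⟩)^b`. -/
def crAtom {n : ℕ} (p α b : ℝ) (a : ℕ → En n) (k : ℕ) (z : En n) : ℂ :=
  (((1 - ‖a k‖ ^ 2) ^ ((p * b - n - 1 - α) / p) : ℝ) : ℂ) / (1 - herm z (a k)) ^ ((b : ℝ) : ℂ)

/-- `c` represents `f` as `f(z) = ∑ₖ cₖ ⋅ (atom k)(z)`, pointwise on `𝔹ₙ` and with the series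
converging to `f` in the (quasi-)norm topology of `A^p_α`. -/
def crRep (n : ℕ) (p α b : ℝ) (a : ℕ → En n) (f : En n → ℂ) (c : ℕ → ℂ) : Prop :=
  (∀ z ∈ uball n,
    Tendsto (fun N => ∑ k ∈ Finset.range N, c k * crAtom p α b a k z) atTop (𝓝 (f z))) ∧
  Tendsto (fun N => ∫⁻ z,
      ENNReal.ofReal (‖f z - ∑ k ∈ Finset.range N, c k * crAtom p α b a k z‖ ^ p) ∂measA n α)
    atTop (𝓝 0)

/-- The set of quantities `∑ₖ |cₖ|^p` over all representations of `f`. -/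
def crRepSums (n : ℕ) (p α b : ℝ) (a : ℕ → En n) (f : En n → ℂ) : Set ℝ≥0∞ :=
  {t | ∃ c : ℕ → ℂ, crRep n p α b a f c ∧ t = ∑' k, ENNReal.ofReal (‖c k‖ ^ p)}

set_option linter.all false
set_option linter.unusedSectionVars false

namespace CR

section alg
variable {E : Type*} [NormedAddCommGroup E] [InnerProductSpace ℂ E]

def kk (z w : E) : ℂ := 1 - inner ℂ w z
def dl (z : E) : ℝ := 1 - ‖z‖ ^ 2
def ss (a : E) : ℝ := Real.sqrt (dl a)
def MM (a w : E) : E := (ss a : ℂ) • w + (inner ℂ a w / (1 + (ss a : ℂ))) • a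
def mob (a w : E) : E := (kk w a)⁻¹ • (a - MM a w)

lemma mem_ball {a : E} : a ∈ Metric.ball (0 : E) 1 ↔ ‖a‖ < 1 := by simp

lemma dl_pos {a : E} (ha : ‖a‖ < 1) : 0 < dl a := by
  unfold dl; nlinarith [norm_nonneg a]

lemma dl_le_one (a : E) : dl a ≤ 1 := by
  unfold dl; nlinarith [norm_nonneg a]

lemma norm_lt_of_dl_pos {a : E} (ha : 0 < dl a) : ‖a‖ < 1 := by
  unfold dl at ha; nlinarith [norm_nonneg a]

lemma ss_nonneg (a : E) : 0 ≤ ss a := Real.sqrt_nonneg _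

lemma ss_sq {a : E} (ha : ‖a‖ < 1) : ss a ^ 2 = dl a := Real.sq_sqrt (dl_pos ha).le

lemma ss_pos {a : E} (ha : ‖a‖ < 1) : 0 < ss a := Real.sqrt_pos.2 (dl_pos ha)

lemma ss_sqC {a : E} (ha : ‖a‖ < 1) : (ss a : ℂ) ^ 2 = 1 - inner ℂ a a := by
  rw [inner_self_eq_norm_sq_to_K]
  have := ss_sq ha
  unfold dl at this
  simp only [Complex.coe_algebraMap]
  exact_mod_cast this

lemma one_add_ss_ne (a : E) : (1 + (ss a : ℂ)) ≠ 0 := by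
  have := ss_nonneg a
  intro h
  have h2 := congrArg Complex.re h
  simp at h2
  linarith

lemma norm_inner_le (z w : E) (hw : ‖w‖ < 1) : ‖inner ℂ w z‖ ≤ ‖z‖ :=
  (norm_inner_le_norm w z).trans (by nlinarith [norm_nonneg z])

lemma kk_re_ge (z w : E) (hw : ‖w‖ < 1) : 1 - ‖z‖ ≤ (kk z w).re := by
  have h1 := norm_inner_le z w hw
  have h2 := (Complex.abs_re_le_norm (inner ℂ w z))
  have h3 := le_abs_self (inner ℂ w z).re
  simp [kk]
  linarith

lemma kk_re_pos {z w : E} (hz : ‖z‖ < 1) (hw : ‖w‖ < 1) : 0 < (kk z w).re := by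
  linarith [kk_re_ge z w hw]

lemma kk_ne {z w : E} (hz : ‖z‖ < 1) (hw : ‖w‖ < 1) : kk z w ≠ 0 := by
  intro h
  have := kk_re_pos hz hw
  simp [h] at this

lemma kk_norm_pos {z w : E} (hz : ‖z‖ < 1) (hw : ‖w‖ < 1) : 0 < ‖kk z w‖ :=
  norm_pos_iff.2 (kk_ne hz hw)

lemma kk_norm_ge (z w : E) (hw : ‖w‖ < 1) : 1 - ‖z‖ ≤ ‖kk z w‖ :=
  (kk_re_ge z w hw).trans (Complex.re_le_norm _)

lemma kk_norm_ge_dl {z w : E} (hz : ‖z‖ < 1) (hw : ‖w‖ < 1) : dl z / 2 ≤ ‖kk z w‖ := by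
  refine le_trans ?_ (kk_norm_ge z w hw)
  unfold dl; nlinarith [norm_nonneg z]

lemma kk_norm_le {z w : E} (hz : ‖z‖ < 1) (hw : ‖w‖ < 1) : ‖kk z w‖ ≤ 2 := by
  unfold kk
  refine (norm_sub_le _ _).trans ?_
  have := norm_inner_le z w hw
  simp; linarith

lemma kk_conj (z w : E) : (starRingEnd ℂ) (kk z w) = kk w z := by
  simp [kk]

lemma kk_norm_symm (z w : E) : ‖kk z w‖ = ‖kk w z‖ := by
  rw [← kk_conj, RCLike.norm_conj]

lemma kk_self (z : E) : kk z z = (dl z : ℂ) := by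
  unfold kk dl
  rw [inner_self_eq_norm_sq_to_K]
  simp

lemma kk_self_norm {z : E} (hz : ‖z‖ < 1) : ‖kk z z‖ = dl z := by
  rw [kk_self, Complex.norm_real, Real.norm_of_nonneg (dl_pos hz).le]

lemma MM_self {a : E} (ha : ‖a‖ < 1) : MM a a = a := by
  have h1 := ss_sqC ha
  have h2 := one_add_ss_ne a
  unfold MM
  rw [← add_smul]
  have : (ss a : ℂ) + inner ℂ a a / (1 + (ss a : ℂ)) = 1 := by
    field_simp
    linear_combination h1
  rw [this, one_smul]

lemma inner_MM_left (a u v : E) : inner ℂ (MM a u) v = inner ℂ u (MM a v) := by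
  have h2 := one_add_ss_ne a
  unfold MM
  simp only [inner_add_left, inner_add_right, inner_smul_left, inner_smul_right, map_div₀,
    inner_conj_symm, map_add, map_one, Complex.conj_ofReal]
  field_simp

lemma MM_MM {a : E} (ha : ‖a‖ < 1) (w : E) :
    MM a (MM a w) = (dl a : ℂ) • w + inner ℂ a w • a := by
  have h1 := ss_sqC ha
  have h2 := one_add_ss_ne a
  have h3 : ((dl a : ℝ) : ℂ) = (ss a : ℂ) ^ 2 := by rw [← ss_sq ha]; push_cast; rfl
  have : inner ℂ a (MM a w) = inner ℂ a w := by
    rw [← inner_MM_left, MM_self ha]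
  unfold MM at this ⊢
  rw [this, h3, smul_add, smul_smul, smul_smul, add_assoc, ← add_smul]
  congr 2
  · ring
  · field_simp
    ring

lemma inner_a_MM {a : E} (ha : ‖a‖ < 1) (w : E) : inner ℂ a (MM a w) = inner ℂ a w := by
  rw [← inner_MM_left, MM_self ha]

lemma inner_MM_a {a : E} (ha : ‖a‖ < 1) (w : E) : inner ℂ (MM a w) a = inner ℂ w a := by
  rw [inner_MM_left, MM_self ha]

lemma kk_mob {a u v : E} (ha : ‖a‖ < 1) (hu : ‖u‖ < 1) (hv : ‖v‖ < 1) :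
    kk (mob a v) (mob a u) = dl a * kk v u / (kk v a * kk a u) := by
  have h1 := kk_ne hv ha
  have h2 := kk_ne ha hu
  have h3 := ss_sqC ha
  have h4 : ((dl a : ℝ) : ℂ) = 1 - inner ℂ a a := by
    rw [← h3, ← ss_sq ha]; push_cast; rfl
  have key : inner ℂ (a - MM a u) (a - MM a v) =
      inner ℂ a a - inner ℂ a v - inner ℂ u a
        + (dl a * inner ℂ u v + inner ℂ u a * inner ℂ a v) := by
    rw [inner_sub_left, inner_sub_right, inner_sub_right, inner_a_MM ha, inner_MM_a ha,
      inner_MM_left, MM_MM ha, inner_add_right, inner_smul_right, inner_smul_right]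
    ring
  unfold mob
  rw [eq_div_iff (mul_ne_zero h1 h2)]
  rw [show kk ((kk v a)⁻¹ • (a - MM a v)) ((kk u a)⁻¹ • (a - MM a u)) =
    1 - (kk a u)⁻¹ * ((kk v a)⁻¹ * inner ℂ (a - MM a u) (a - MM a v)) by
      conv_lhs => unfold kk
      rw [inner_smul_left, inner_smul_right, map_inv₀]
      congr 3
      exact kk_conj u a]
  rw [key]
  field_simp
  rw [h4]
  unfold kk
  ring

lemma dl_mob {a v : E} (ha : ‖a‖ < 1) (hv : ‖v‖ < 1) :
    dl (mob a v) = dl a * dl v / ‖kk v a‖ ^ 2 := by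
  have := kk_mob ha hv hv
  rw [kk_self, kk_self, ← kk_conj v a, Complex.mul_conj, Complex.normSq_eq_norm_sq] at this
  exact_mod_cast this

lemma mob_mem {a v : E} (ha : ‖a‖ < 1) (hv : ‖v‖ < 1) : ‖mob a v‖ < 1 := by
  apply norm_lt_of_dl_pos
  rw [dl_mob ha hv]
  have := dl_pos ha
  have := dl_pos hv
  have := kk_norm_pos hv ha
  positivity

lemma mob_zero (a : E) : mob a 0 = a := by
  simp [mob, MM, kk]

lemma kk_mob_a {a v : E} (ha : ‖a‖ < 1) (hv : ‖v‖ < 1) :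
    kk (mob a v) a = dl a / kk v a := by
  have := kk_mob ha (show ‖(0 : E)‖ < 1 by simp) hv
  rw [mob_zero] at this
  rw [this]
  simp [kk]

lemma mob_mob {a w : E} (ha : ‖a‖ < 1) (hw : ‖w‖ < 1) : mob a (mob a w) = w := by
  have h1 := kk_ne hw ha
  have h0 : (dl a : ℂ) ≠ 0 := by exact_mod_cast (dl_pos ha).ne'
  conv_lhs => unfold mob
  have h2 : kk ((kk w a)⁻¹ • (a - MM a w)) a = dl a / kk w a := kk_mob_a ha hw
  rw [h2]
  have h3 : MM a ((kk w a)⁻¹ • (a - MM a w)) = (kk w a)⁻¹ • (MM a a - MM a (MM a w)) := by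
    simp only [MM, inner_smul_right, inner_sub_right, inner_add_right, smul_sub, smul_add,
      smul_smul]
    module
  rw [h3, MM_self ha, MM_MM ha]
  have h4 : a - (kk w a)⁻¹ • (a - ((dl a : ℂ) • w + inner ℂ a w • a)) =
      (dl a / kk w a : ℂ) • w := by
    have : inner ℂ a w = 1 - kk w a := by simp [kk]
    rw [this]
    have h5 : a = ((kk w a)⁻¹ * kk w a) • a := by rw [inv_mul_cancel₀ h1, one_smul]
    nth_rewrite 1 [h5]
    module
  rw [h4, smul_smul, inv_mul_cancel₀, one_smul]
  exact div_ne_zero h0 h1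

lemma norm_mob_symm {a w : E} (ha : ‖a‖ < 1) (hw : ‖w‖ < 1) : ‖mob a w‖ = ‖mob w a‖ := by
  have h1 := dl_mob ha hw
  have h2 := dl_mob hw ha
  rw [kk_norm_symm, mul_comm, ← h2] at h1
  unfold dl at h1
  have h3 : ‖mob a w‖ ^ 2 = ‖mob w a‖ ^ 2 := by linarith
  exact (sq_eq_sq₀ (norm_nonneg _) (norm_nonneg _)).1 h3

lemma ratio {a w z : E} {r : ℝ} (ha : ‖a‖ < 1) (hw : ‖w‖ < 1) (hz : ‖z‖ < 1) (hr : r < 1)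
    (h : ‖mob a w‖ ≤ r) : ‖kk z w / kk z a - 1‖ ≤ 2 * r / (1 - r) := by
  set u := mob a w with hu
  set v := mob a z with hv
  have hu1 : ‖u‖ < 1 := mob_mem ha hw
  have hv1 : ‖v‖ < 1 := mob_mem ha hz
  have e1 : z = mob a v := (mob_mob ha hz).symm
  have e2 : w = mob a u := (mob_mob ha hw).symm
  have h0 : (dl a : ℂ) ≠ 0 := by exact_mod_cast (dl_pos ha).ne'
  have hva := kk_ne hv1 ha
  have hau := kk_ne ha hu1
  have : kk z w / kk z a - 1 = inner ℂ u (a - v) / kk a u := by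
    rw [e1, e2, kk_mob ha hu1 hv1, kk_mob_a ha hv1]
    field_simp
    unfold kk
    rw [inner_sub_right]; ring
  rw [this, norm_div]
  have hr0 : 0 ≤ r := (norm_nonneg _).trans h
  have n1 : ‖inner ℂ u (a - v)‖ ≤ 2 * r := by
    refine (norm_inner_le_norm _ _).trans ?_
    have := norm_sub_le a v
    have : ‖a - v‖ ≤ 2 := by linarith
    nlinarith [norm_nonneg u, norm_nonneg (a - v)]
  have n2 : 1 - r ≤ ‖kk a u‖ := by
    rw [kk_norm_symm]
    have := kk_norm_ge u a ha
    linarith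
  gcongr

end alg

end CR

namespace CR

section tau
variable {E : Type*} [NormedAddCommGroup E] [InnerProductSpace ℂ E] [FiniteDimensional ℂ E]
  [MeasurableSpace E] [BorelSpace E] (μ : Measure E) [μ.IsAddHaarMeasure]

abbrev nn (E : Type*) [NormedAddCommGroup E] [InnerProductSpace ℂ E] : ℕ := Module.finrank ℂ E
abbrev BB (E : Type*) [NormedAddCommGroup E] : Set E := Metric.ball (0 : E) 1

def tau : Measure E :=
  (μ.restrict (BB E)).withDensity (fun z => ENNReal.ofReal ((dl z) ^ (-((nn E : ℝ) + 1))))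

lemma continuous_dl : Continuous (dl : E → ℝ) := by unfold dl; fun_prop

lemma continuous_kk : Continuous (fun p : E × E => kk p.1 p.2) := by
  unfold kk
  exact continuous_const.sub (Continuous.inner continuous_snd continuous_fst)

lemma continuous_kk_left (w : E) : Continuous (fun z : E => kk z w) := by
  unfold kk
  exact continuous_const.sub (Continuous.inner continuous_const continuous_id)

lemma continuous_kk_right (z : E) : Continuous (fun w : E => kk z w) := by
  unfold kk
  exact continuous_const.sub (Continuous.inner continuous_id continuous_const)

lemma measurable_dl_rpow (t : ℝ) : Measurable (fun z : E => ENNReal.ofReal ((dl z) ^ t)) :=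
  ((continuous_dl.measurable).pow_const t).ennreal_ofReal

lemma continuous_MM (a : E) : Continuous (MM a) := by
  unfold MM
  exact (continuous_const.smul continuous_id).add
    (((Continuous.inner continuous_const continuous_id).div_const _).smul continuous_const)

lemma measurable_mob (a : E) : Measurable (mob a) := by
  unfold mob
  exact ((continuous_kk_left a).measurable.inv).smul
    ((continuous_const.sub (continuous_MM a)).measurable)

/-- the derivative of mob -/
def Dmob (a w : E) : E →L[ℂ] E :=
  (kk w a)⁻¹ • (-((ss a : ℂ) • ContinuousLinearMap.id ℂ E +
      (1 + (ss a : ℂ))⁻¹ • (innerSL ℂ a).smulRight a)) +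
    (((kk w a)⁻¹ ^ 2) • innerSL ℂ a).smulRight (a - MM a w)

lemma hasFDerivAt_MM (a w : E) : HasFDerivAt (MM a) ((ss a : ℂ) • ContinuousLinearMap.id ℂ E +
      (1 + (ss a : ℂ))⁻¹ • (innerSL ℂ a).smulRight a) w := by
  have : MM a = fun w => ((ss a : ℂ) • ContinuousLinearMap.id ℂ E +
      (1 + (ss a : ℂ))⁻¹ • (innerSL ℂ a).smulRight a) w := by
    ext1 x
    simp only [MM, ContinuousLinearMap.add_apply, ContinuousLinearMap.smul_apply,
      ContinuousLinearMap.id_apply, ContinuousLinearMap.smulRight_apply, innerSL_apply_apply, smul_smul,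
      div_eq_inv_mul]
  rw [this]
  exact ContinuousLinearMap.hasFDerivAt _

lemma hasFDerivAt_kk (a w : E) : HasFDerivAt (fun w => kk w a) (-(innerSL ℂ a)) w := by
  unfold kk
  have : HasFDerivAt (fun w => innerSL ℂ a w) (innerSL ℂ a) w :=
    ContinuousLinearMap.hasFDerivAt _
  simpa using this.const_sub 1

lemma hasFDerivAt_mob {a w : E} (ha : ‖a‖ < 1) (hw : ‖w‖ < 1) :
    HasFDerivAt (mob a) (Dmob a w) w := by
  have h1 := hasFDerivAt_kk a w
  have h2 := hasFDerivAt_MM a w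
  have h3 : HasFDerivAt (fun w => (kk w a)⁻¹) (((kk w a)⁻¹ ^ 2) • innerSL ℂ a) w := by
    have := (hasDerivAt_inv (kk_ne hw ha)).comp_hasFDerivAt w h1
    have e : ((kk w a)⁻¹ ^ 2) • innerSL ℂ a = -(kk w a ^ 2)⁻¹ • -(innerSL ℂ) a := by
      refine ContinuousLinearMap.ext fun h => ?_
      simp
    rw [e]
    exact this
  exact h3.smul (h2.const_sub a)

lemma det_Dmob {a w : E} (ha : ‖a‖ < 1) (hw : ‖w‖ < 1) :
    LinearMap.det (Dmob a w : E →ₗ[ℂ] E) =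
      (-1) ^ (nn E) * ((ss a : ℂ) / kk w a) ^ (nn E + 1) := by
  have hk := kk_ne hw ha
  have hs : (ss a : ℂ) ≠ 0 := by exact_mod_cast (ss_pos ha).ne'
  have hs1 := one_add_ss_ne a
  have e : (Dmob a w : E →ₗ[ℂ] E) = (-(kk w a)⁻¹ * (ss a : ℂ)) •
      ((LinearMap.transvection ((innerSL ℂ a : E →L[ℂ] ℂ) : E →ₗ[ℂ] ℂ)
          (((ss a : ℂ) * (1 + ss a))⁻¹ • a)) ∘ₗ
        (LinearMap.transvection ((innerSL ℂ a : E →L[ℂ] ℂ) : E →ₗ[ℂ] ℂ)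
          (-(kk w a)⁻¹ • (a - w)))) := by
    ext h
    have e1 : MM a ((kk w a)⁻¹ • (a - w)) = (kk w a)⁻¹ • (a - MM a w) := by
      have : MM a ((kk w a)⁻¹ • (a - w)) = (kk w a)⁻¹ • (MM a a - MM a w) := by
        simp only [MM, inner_smul_right, inner_sub_right, inner_add_right, smul_sub, smul_add,
          smul_smul]
        module
      rw [this, MM_self ha]
    have e2 : (kk w a)⁻¹ • (a - MM a w) = (ss a : ℂ) • ((kk w a)⁻¹ • (a - w)) +
        ((1 + (ss a : ℂ))⁻¹ * inner ℂ a ((kk w a)⁻¹ • (a - w))) • a := by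
      rw [← e1]
      simp only [MM, div_eq_inv_mul]
    simp only [Dmob, ContinuousLinearMap.coe_coe, LinearMap.smul_apply, LinearMap.comp_apply,
      LinearMap.transvection.apply, ContinuousLinearMap.add_apply, ContinuousLinearMap.smul_apply,
      ContinuousLinearMap.id_apply, ContinuousLinearMap.smulRight_apply, innerSL_apply_apply,
      ContinuousLinearMap.neg_apply]
    rw [show ((kk w a)⁻¹ ^ 2 • inner ℂ a h) • (a - MM a w) =
      ((kk w a)⁻¹ * inner ℂ a h) • ((kk w a)⁻¹ • (a - MM a w)) by
        rw [smul_smul, smul_eq_mul]; ring_nf, e2]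
    simp only [inner_add_right, inner_smul_right]
    match_scalars <;> field_simp <;> ring
  rw [e, LinearMap.det_smul, LinearMap.det_comp, LinearMap.transvection.det,
    LinearMap.transvection.det]
  simp only [ContinuousLinearMap.coe_coe, innerSL_apply_apply, inner_smul_right, inner_sub_right]
  have h3 := ss_sqC ha
  have h4 : inner ℂ a w = 1 - kk w a := by simp [kk]
  have h5 : inner ℂ a a = 1 - (ss a : ℂ) ^ 2 := by rw [h3]; ring
  rw [h4, h5]
  rw [show (1 + ((ss a : ℂ) * (1 + ss a))⁻¹ * (1 - (ss a : ℂ) ^ 2)) = 1 / ss a by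
    field_simp; ring]
  rw [show 1 + -(kk w a)⁻¹ * (1 - (ss a : ℂ) ^ 2 - (1 - kk w a)) = (ss a : ℂ) ^ 2 / kk w a by
    field_simp; ring]
  rw [show -(kk w a)⁻¹ * (ss a : ℂ) = (-1) * ((ss a : ℂ) / kk w a) by ring, mul_pow, pow_succ (ss a / kk w a : ℂ)]
  field_simp

lemma absdet_Dmob {a w : E} (ha : ‖a‖ < 1) (hw : ‖w‖ < 1) :
    |((Dmob a w).restrictScalars ℝ).det| = (dl a / ‖kk w a‖ ^ 2) ^ (nn E + 1) := by
  have : ((Dmob a w).restrictScalars ℝ).det =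
      LinearMap.det (((Dmob a w : E →ₗ[ℂ] E)).restrictScalars ℝ) := rfl
  rw [this, LinearMap.det_restrictScalars, Algebra.norm_complex_apply, det_Dmob ha hw,
    Complex.normSq_eq_norm_sq, norm_mul, norm_pow, norm_pow, norm_neg, norm_one, one_pow, one_mul,
    norm_div, Complex.norm_real, Real.norm_of_nonneg (ss_nonneg a), abs_of_nonneg (by positivity),
    ← ss_sq ha, ← div_pow, ← pow_mul, ← pow_mul, mul_comm]

lemma image_mob {a : E} (ha : ‖a‖ < 1) : mob a '' (BB E) = BB E := by
  ext w
  simp only [Set.mem_image, mem_ball]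
  constructor
  · rintro ⟨x, hx, rfl⟩
    exact mob_mem ha hx
  · intro hw
    exact ⟨mob a w, mob_mem ha hw, mob_mob ha hw⟩

lemma injOn_mob {a : E} (ha : ‖a‖ < 1) : Set.InjOn (mob a) (BB E) := by
  intro x hx y hy h
  rw [mem_ball] at hx hy
  rw [← mob_mob ha hx, h, mob_mob ha hy]

lemma lintegral_tau (g : E → ℝ≥0∞) :
    ∫⁻ z, g z ∂(tau μ) = ∫⁻ z in BB E, ENNReal.ofReal ((dl z) ^ (-((nn E : ℝ) + 1))) * g z ∂μ := by
  unfold tau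
  rw [lintegral_withDensity_eq_lintegral_mul_non_measurable _ (measurable_dl_rpow _)]
  · rfl
  · exact Eventually.of_forall (fun x => ENNReal.ofReal_lt_top)

lemma lintegral_mob {a : E} (ha : ‖a‖ < 1) (g : E → ℝ≥0∞) :
    ∫⁻ w, g (mob a w) ∂(tau μ) = ∫⁻ w, g w ∂(tau μ) := by
  rw [lintegral_tau, lintegral_tau]
  conv_rhs => rw [← image_mob ha]
  rw [lintegral_image_eq_lintegral_abs_det_fderiv_mul μ measurableSet_ball
    (fun x hx => ((hasFDerivAt_mob ha (mem_ball.1 hx)).restrictScalars ℝ).hasFDerivWithinAt)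
    (injOn_mob ha)]
  refine setLIntegral_congr_fun measurableSet_ball (fun w hw => ?_)
  rw [mem_ball] at hw
  rw [absdet_Dmob ha hw, ← mul_assoc, ← ENNReal.ofReal_mul]
  · congr 2
    rw [dl_mob ha hw]
    have h1 := dl_pos ha
    have h2 := dl_pos hw
    have h3 := kk_norm_pos hw ha
    rw [← Real.rpow_natCast, show dl a * dl w / ‖kk w a‖ ^ 2 = (dl a / ‖kk w a‖ ^ 2) * dl w by ring,
      Real.mul_rpow (by positivity) h2.le, ← mul_assoc, ← Real.rpow_add (by positivity)]
    push_cast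
    rw [add_neg_cancel, Real.rpow_zero, one_mul]
  · have := (dl_pos ha).le
    positivity

lemma mp_mob {a : E} (ha : ‖a‖ < 1) : MeasurePreserving (mob a) (tau μ) (tau μ) := by
  refine ⟨measurable_mob a, ?_⟩
  ext s hs
  rw [Measure.map_apply (measurable_mob a) hs, ← lintegral_indicator_one hs,
    ← lintegral_indicator_one ((measurable_mob a) hs)]
  exact lintegral_mob μ ha (s.indicator 1)

lemma ae_tau : ∀ᵐ z ∂(tau μ), ‖z‖ < 1 := by
  unfold tau
  refine (withDensity_absolutelyContinuous _ _).ae_le ?_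
  filter_upwards [ae_restrict_mem measurableSet_ball] with z hz
  exact mem_ball.1 hz

end tau

end CR

namespace CR

section mv
variable {E : Type*} [NormedAddCommGroup E] [InnerProductSpace ℂ E] [FiniteDimensional ℂ E]
  [MeasurableSpace E] [BorelSpace E] (μ : Measure E) [μ.IsAddHaarMeasure]

def RotInv (ν : Measure E) : Prop :=
  ∀ l : ℂ, ‖l‖ = 1 → MeasurePreserving (fun w : E => l • w) ν ν

lemma rotInv_haar : RotInv μ := by
  intro l hl
  refine ⟨(continuous_const_smul l).measurable, ?_⟩
  set f : E →ₗ[ℝ] E := (l • (LinearMap.id : E →ₗ[ℂ] E)).restrictScalars ℝ with hf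
  have hdet : |LinearMap.det f| = 1 := by
    rw [hf, LinearMap.det_restrictScalars, Algebra.norm_complex_apply, LinearMap.det_smul,
      LinearMap.det_id, Complex.normSq_eq_norm_sq]
    simp [hl]
  have h0 : LinearMap.det f ≠ 0 := by
    intro h; rw [h] at hdet; simp at hdet
  have := Measure.map_linearMap_addHaar_eq_smul_addHaar μ h0
  rw [abs_inv, hdet] at this
  simp only [inv_one, ENNReal.ofReal_one, one_smul] at this
  exact this

lemma RotInv.restrict {ν : Measure E} (h : RotInv ν) (r : ℝ) :
    RotInv (ν.restrict (Metric.ball 0 r)) := by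
  intro l hl
  have := (h l hl).restrict_preimage (s := Metric.ball (0 : E) r) measurableSet_ball
  have e : (fun w : E => l • w) ⁻¹' (Metric.ball (0 : E) r) = Metric.ball 0 r := by
    ext x; simp [norm_smul, hl]
  rwa [e] at this

lemma RotInv.withDensity {ν : Measure E} (h : RotInv ν) {g : E → ℝ≥0∞} (hg : Measurable g)
    (hg2 : ∀ l : ℂ, ‖l‖ = 1 → ∀ w, g (l • w) = g w) : RotInv (ν.withDensity g) := by
  intro l hl
  refine ⟨(continuous_const_smul l).measurable, ?_⟩
  ext s hs
  have hm : Measurable (fun w : E => l • w) := (continuous_const_smul l).measurable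
  rw [Measure.map_apply hm hs, withDensity_apply _ (hm hs), withDensity_apply _ hs,
    ← (h l hl).setLIntegral_comp_preimage hs hg]
  simp_rw [hg2 l hl]

lemma dl_rot (l : ℂ) (hl : ‖l‖ = 1) (w : E) : dl (l • w) = dl w := by
  simp [dl, norm_smul, hl]

lemma rotInv_tau : RotInv (tau μ) :=
  ((rotInv_haar μ).restrict 1).withDensity (measurable_dl_rpow _)
    (fun l hl w => by rw [dl_rot l hl])

/-- the measure `dl^t tau` -/
def tb (t : ℝ) : Measure E := (tau μ).withDensity (fun z => ENNReal.ofReal ((dl z) ^ t))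

lemma rotInv_tb (t : ℝ) : RotInv (tb μ t) :=
  (rotInv_tau μ).withDensity (measurable_dl_rpow _) (fun l hl w => by rw [dl_rot l hl])

lemma lintegral_tb (t : ℝ) (g : E → ℝ≥0∞) :
    ∫⁻ z, g z ∂(tb μ t) = ∫⁻ z, ENNReal.ofReal ((dl z) ^ t) * g z ∂(tau μ) := by
  unfold tb
  rw [lintegral_withDensity_eq_lintegral_mul_non_measurable _ (measurable_dl_rpow _)]
  · rfl
  · exact Eventually.of_forall (fun x => ENNReal.ofReal_lt_top)

lemma ae_tb (t : ℝ) : ∀ᵐ z ∂(tb μ t), ‖z‖ < 1 :=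
  (withDensity_absolutelyContinuous _ _).ae_le (ae_tau μ)

lemma circle_mv {h : E → ℂ} (hh : DifferentiableOn ℂ h (BB E)) {w : E} (hw : ‖w‖ < 1) :
    ∫ θ in (0 : ℝ)..(2 * Real.pi), h (circleMap 0 1 θ • w) = (2 * Real.pi : ℝ) • h 0 := by
  have hd : DiffContOnCl ℂ (fun l : ℂ => h (l • w)) (Metric.ball 0 |1|) := by
    apply DifferentiableOn.diffContOnCl
    rw [abs_one, closure_ball (0 : ℂ) one_ne_zero]
    refine hh.comp (differentiable_id.smul_const w).differentiableOn ?_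
    intro l hl
    simp only [mem_closedBall_zero_iff] at hl
    rw [mem_ball]
    simp only [id, norm_smul]
    nlinarith [norm_nonneg w, norm_nonneg l]
  have := hd.circleAverage
  rw [Real.circleAverage_def] at this
  simp only [zero_smul] at this
  rw [← this, smul_smul, mul_inv_cancel₀ (by positivity), one_smul]

lemma indicator_meas {h : E → ℂ} (hh : ContinuousOn h (BB E)) :
    Measurable ((BB E).indicator h) := by
  have := hh.measurable_piecewise (continuousOn_const (c := (0 : ℂ)) (s := (BB E)ᶜ))
    measurableSet_ball
  convert this using 1
  exact (Set.piecewise_eq_indicator).symm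

lemma mean_value {ν : Measure E} [IsFiniteMeasure ν] (hν : RotInv ν) (hB : ∀ᵐ z ∂ν, ‖z‖ < 1)
    {h : E → ℂ} (hh : DifferentiableOn ℂ h (BB E)) (hi : Integrable h ν) :
    ∫ z, h z ∂ν = (ν.real Set.univ) • h 0 := by
  set g : E → ℂ := (BB E).indicator h with hg
  have gm : Measurable g := indicator_meas hh.continuousOn
  have ge : ∀ᵐ z ∂ν, g z = h z := by
    filter_upwards [hB] with z hz
    rw [hg, Set.indicator_of_mem (mem_ball.2 hz)]
  have gi : Integrable g ν := hi.congr (ge.mono fun z hz => hz.symm)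
  set ϑ : Measure ℝ := volume.restrict (Set.Ioc 0 (2 * Real.pi)) with hϑ
  have hc : ∀ θ : ℝ, ‖circleMap 0 1 θ‖ = 1 := fun θ => by simp
  have Fm : Measurable (fun q : E × ℝ => g (circleMap 0 1 q.2 • q.1)) := by
    apply gm.comp
    apply Continuous.measurable
    exact ((continuous_circleMap 0 1).comp continuous_snd).smul continuous_fst
  have hθ : ∀ θ : ℝ, Integrable (fun w => g (circleMap 0 1 θ • w)) ν := fun θ =>
    ((hν _ (hc θ)).integrable_comp gi.aestronglyMeasurable).2 gi
  have Fi : Integrable (fun q : E × ℝ => g (circleMap 0 1 q.2 • q.1)) (ν.prod ϑ) := by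
    rw [integrable_prod_iff' Fm.aestronglyMeasurable]
    refine ⟨Eventually.of_forall hθ, ?_⟩
    have : (fun θ : ℝ => ∫ w, ‖g (circleMap 0 1 θ • w)‖ ∂ν) = fun θ => ∫ w, ‖g w‖ ∂ν := by
      ext θ
      have h1 := integral_map (μ := ν) ((hν _ (hc θ)).measurable.aemeasurable)
        (f := fun w => ‖g w‖) (gm.norm.aestronglyMeasurable)
      rw [(hν _ (hc θ)).map_eq] at h1
      exact h1.symm
    simp only [this]
    exact integrable_const _
  have e1 := integral_prod _ Fi
  have e2 := integral_prod_symm _ Fi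
  rw [e1] at e2
  have e3 : ∫ w, ∫ θ, g (circleMap 0 1 θ • w) ∂ϑ ∂ν = ∫ w, (2 * Real.pi : ℝ) • h 0 ∂ν := by
    refine integral_congr_ae ?_
    filter_upwards [hB] with w hw
    rw [← circle_mv hh hw, intervalIntegral.integral_of_le (by positivity)]
    refine integral_congr_ae (Eventually.of_forall fun θ => ?_)
    simp only [hg]
    rw [Set.indicator_of_mem]
    rw [mem_ball, norm_smul, hc θ, one_mul]; exact hw
  have e4 : ∫ θ, ∫ w, g (circleMap 0 1 θ • w) ∂ν ∂ϑ = ∫ θ, (∫ w, g w ∂ν) ∂ϑ := by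
    refine integral_congr_ae (Eventually.of_forall fun θ => ?_)
    have h1 := integral_map (μ := ν) ((hν _ (hc θ)).measurable.aemeasurable)
        (f := g) (gm.aestronglyMeasurable)
    rw [(hν _ (hc θ)).map_eq] at h1
    exact h1.symm
  simp only at e2
  rw [e3, e4, integral_const, integral_const] at e2
  have e5 : ϑ.real Set.univ = 2 * Real.pi := by
    rw [hϑ, measureReal_restrict_apply MeasurableSet.univ, Set.univ_inter,
      Real.volume_real_Ioc_of_le (by positivity)]
    ring
  rw [e5, smul_comm, integral_congr_ae ge] at e2
  have hpi : (2 * Real.pi : ℝ) ≠ 0 := by positivity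
  exact (smul_right_injective ℂ hpi e2).symm

lemma mean_value_le {ν : Measure E} [IsFiniteMeasure ν] (hν : RotInv ν) (hB : ∀ᵐ z ∂ν, ‖z‖ < 1)
    {h : E → ℂ} (hh : DifferentiableOn ℂ h (BB E)) :
    ν Set.univ * ‖h 0‖ₑ ≤ ∫⁻ z, ‖h z‖ₑ ∂ν := by
  by_cases hi : Integrable h ν
  · have := mean_value hν hB hh hi
    calc ν Set.univ * ‖h 0‖ₑ = ‖ν.real Set.univ • h 0‖ₑ := by
          rw [enorm_smul, Real.enorm_eq_ofReal (measureReal_nonneg), measureReal_def,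
            ENNReal.ofReal_toReal (measure_ne_top _ _)]
      _ = ‖∫ z, h z ∂ν‖ₑ := by rw [this]
      _ ≤ _ := enorm_integral_le_lintegral_enorm _
  · have hm : AEStronglyMeasurable h ν := by
      have gm : Measurable ((BB E).indicator h) := indicator_meas hh.continuousOn
      refine ⟨_, gm.stronglyMeasurable, ?_⟩
      filter_upwards [hB] with z hz
      rw [Set.indicator_of_mem (mem_ball.2 hz)]
    have : ∫⁻ z, ‖h z‖ₑ ∂ν = ∞ := by
      by_contra hne
      exact hi ⟨hm, lt_top_iff_ne_top.2 hne⟩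
    rw [this]; exact le_top

lemma lintegral_dl_lt [Nontrivial E] {t : ℝ} (ht : (nn E : ℝ) < t) :
    ∫⁻ z, ENNReal.ofReal ((dl z) ^ t) ∂(tau μ) < ∞ := by
  rw [lintegral_tau]
  have h1 : IntegrableOn (fun x : E => (fun y : ℝ => (1 - y ^ 2) ^ (t - nn E - 1)) ‖x‖)
      (Metric.ball 0 1) μ := by
    refine (integrableOn_fun_norm_addHaar μ (f := fun y : ℝ => (1 - y ^ 2) ^ (t - nn E - 1)) (r := 1)).2 ?_
    set s : ℝ := t - nn E - 1
    set m := Module.finrank ℝ E - 1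
    have hs : -1 < s := by simp only [s]; linarith
    have i1 : IntervalIntegrable (fun y : ℝ => y ^ s) volume 0 1 :=
      intervalIntegral.intervalIntegrable_rpow' hs
    have i2 : IntervalIntegrable (fun y : ℝ => (1 - y) ^ s) volume 0 1 := by
      have := (i1.comp_sub_left 1).symm
      simpa using this
    have i3 := i2.continuousOn_mul (g := fun y : ℝ => y ^ m * (1 + y) ^ s) (by
      refine (continuousOn_pow m).mul ?_
      refine ContinuousOn.rpow_const (by fun_prop) ?_
      intro x hx
      rw [Set.uIcc_of_le zero_le_one] at hx
      left; linarith [hx.1])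
    rw [intervalIntegrable_iff_integrableOn_Ioo_of_le zero_le_one] at i3
    refine i3.congr_fun ?_ measurableSet_Ioo
    intro y hy
    simp only [smul_eq_mul]
    rw [mul_assoc, ← Real.mul_rpow (by linarith [hy.1]) (by linarith [hy.2])]
    ring_nf
  have h2 := h1.2
  refine lt_of_le_of_lt (le_of_eq ?_) h2
  refine setLIntegral_congr_fun measurableSet_ball (fun z hz => ?_)
  rw [mem_ball] at hz
  have hd := dl_pos hz
  change _ = ‖(dl z) ^ (t - nn E - 1)‖ₑ
  rw [← ENNReal.ofReal_mul (by positivity), ← Real.rpow_add hd,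
    Real.enorm_eq_ofReal (by positivity)]
  ring_nf

lemma isFinite_tb [Nontrivial E] {t : ℝ} (ht : (nn E : ℝ) < t) : IsFiniteMeasure (tb μ t) := by
  constructor
  have := lintegral_tb μ t (fun _ => 1)
  simp only [lintegral_const, one_mul, mul_one] at this
  rw [this]
  exact lintegral_dl_lt μ ht

end mv

end CR


namespace CR
section fr
variable {E : Type*} [NormedAddCommGroup E] [InnerProductSpace ℂ E] [FiniteDimensional ℂ E]
  [MeasurableSpace E] [BorelSpace E] (μ : Measure E) [μ.IsAddHaarMeasure]

def LL (t c : ℝ) (z : E) : ℝ≥0∞ := ∫⁻ w, ENNReal.ofReal (dl w ^ t * ‖kk z w‖ ^ (-c)) ∂(tau μ)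

lemma measurable_ker (t c : ℝ) (z : E) :
    Measurable (fun w : E => ENNReal.ofReal (dl w ^ t * ‖kk z w‖ ^ (-c))) :=
  ((continuous_dl.measurable.pow_const t).mul
    ((continuous_kk_right z).norm.measurable.pow_const _)).ennreal_ofReal

lemma measurable_ker2 (t c : ℝ) :
    Measurable (fun q : E × E => ENNReal.ofReal (dl q.2 ^ t * ‖kk q.1 q.2‖ ^ (-c))) :=
  (((continuous_dl.comp continuous_snd).measurable.pow_const t).mul
    ((continuous_kk).norm.measurable.pow_const _)).ennreal_ofReal

lemma LL_exact (t : ℝ) {z : E} (hz : ‖z‖ < 1) :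
    LL μ t (2 * t) z = ENNReal.ofReal (dl z ^ (-t)) * ∫⁻ w, ENNReal.ofReal (dl w ^ t) ∂(tau μ) := by
  unfold LL
  rw [← lintegral_mob μ hz, ← lintegral_const_mul _ (measurable_dl_rpow t)]
  refine lintegral_congr_ae ?_
  filter_upwards [ae_tau μ] with u hu
  have d1 := dl_pos hz
  have d2 := dl_pos hu
  have d3 := kk_norm_pos hu hz
  rw [← ENNReal.ofReal_mul (by positivity)]
  congr 1
  rw [dl_mob hz hu, kk_norm_symm z (mob z u), kk_mob_a hz hu, norm_div, Complex.norm_real,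
    Real.norm_of_nonneg d1.le, Real.div_rpow (by positivity) (by positivity),
    Real.div_rpow (by positivity) (by positivity), Real.mul_rpow d1.le d2.le,
    ← Real.rpow_natCast, ← Real.rpow_mul d3.le]
  have e1 : ‖kk u z‖ ^ (-(2 * t)) = (‖kk u z‖ ^ (((2 : ℕ) : ℝ) * t))⁻¹ := by
    rw [← Real.rpow_neg d3.le]; push_cast; ring_nf
  have e2 : dl z ^ (-(2 * t)) = dl z ^ (-t) * (dl z ^ t)⁻¹ := by
    rw [← Real.rpow_neg d1.le, ← Real.rpow_add d1]; ring_nf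
  rw [e1, e2]
  have : 0 < ‖kk u z‖ ^ (((2 : ℕ) : ℝ) * t) := by positivity
  have : 0 < dl z ^ t := by positivity
  field_simp

lemma LL_big [Nontrivial E] {t c : ℝ} (ht : (nn E : ℝ) < t) (hc : 2 * t ≤ c) :
    ∃ C : ℝ, 0 < C ∧ ∀ z : E, ‖z‖ < 1 → LL μ t c z ≤ ENNReal.ofReal (C * dl z ^ (t - c)) := by
  set K := ∫⁻ w, ENNReal.ofReal (dl w ^ t) ∂(tau μ) with hK
  have hKt : K < ∞ := lintegral_dl_lt μ ht
  refine ⟨(1/2 : ℝ) ^ (-(c - 2 * t)) * (K.toReal + 1), by positivity, fun z hz => ?_⟩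
  have d1 := dl_pos hz
  have h1 : LL μ t c z ≤ ENNReal.ofReal ((dl z / 2) ^ (-(c - 2 * t))) * LL μ t (2 * t) z := by
    unfold LL
    rw [← lintegral_const_mul _ (measurable_ker _ _ _)]
    refine lintegral_mono_ae ?_
    filter_upwards [ae_tau μ] with w hw
    have d2 := dl_pos hw
    have d3 := kk_norm_pos hz hw
    rw [← ENNReal.ofReal_mul (by positivity)]
    apply ENNReal.ofReal_le_ofReal
    have e1 : ‖kk z w‖ ^ (-c) = ‖kk z w‖ ^ (-(c - 2 * t)) * ‖kk z w‖ ^ (-(2 * t)) := by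
      rw [← Real.rpow_add d3]; ring_nf
    have e2 : ‖kk z w‖ ^ (-(c - 2 * t)) ≤ (dl z / 2) ^ (-(c - 2 * t)) :=
      Real.rpow_le_rpow_of_nonpos (by positivity) (kk_norm_ge_dl hz hw) (by linarith)
    rw [e1]
    calc dl w ^ t * (‖kk z w‖ ^ (-(c - 2 * t)) * ‖kk z w‖ ^ (-(2 * t)))
        = ‖kk z w‖ ^ (-(c - 2 * t)) * (dl w ^ t * ‖kk z w‖ ^ (-(2 * t))) := by ring
      _ ≤ _ := by gcongr
  refine h1.trans ?_
  have hKe : (∫⁻ w, ENNReal.ofReal (dl w ^ t) ∂(tau μ)) = ENNReal.ofReal K.toReal :=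
    (ENNReal.ofReal_toReal hKt.ne).symm
  rw [LL_exact μ t hz, hKe, ← ENNReal.ofReal_mul (by positivity),
    ← ENNReal.ofReal_mul (by positivity)]
  apply ENNReal.ofReal_le_ofReal
  have e3 : dl z ^ (t - c) = dl z ^ (-(c - 2 * t)) * dl z ^ (-t) := by
    rw [← Real.rpow_add d1]; ring_nf
  rw [e3, div_eq_mul_one_div, Real.mul_rpow d1.le (by norm_num)]
  have : 0 ≤ K.toReal := ENNReal.toReal_nonneg
  calc _ = (1/2 : ℝ) ^ (-(c - 2 * t)) * (K.toReal) * (dl z ^ (-(c - 2 * t)) * dl z ^ (-t)) := by ring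
    _ ≤ _ := by gcongr; linarith

lemma kk_smul_le {z w : E} (hz : ‖z‖ < 1) (hw : ‖w‖ < 1) {y : ℝ} (hy : 0 ≤ y) :
    ‖kk (((1 - y : ℝ) : ℂ) • z) w‖ ≤ ‖kk z w‖ + y := by
  have : kk (((1 - y : ℝ) : ℂ) • z) w = kk z w + y * inner ℂ w z := by
    unfold kk; rw [inner_smul_right]; push_cast; ring
  rw [this]
  refine (norm_add_le _ _).trans ?_
  rw [norm_mul, Complex.norm_real, Real.norm_of_nonneg hy]
  have := norm_inner_le z w hw
  gcongr
  nlinarith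

lemma dl_smul_ge {z : E} (hz : ‖z‖ < 1) {y : ℝ} (hy : 0 ≤ y) (hy1 : y ≤ 1) :
    (y + dl z) / 2 ≤ dl (((1 - y : ℝ) : ℂ) • z) := by
  have d1 := dl_pos hz
  have d2 := dl_le_one z
  have : ‖((1 - y : ℝ) : ℂ) • z‖ ^ 2 = (1 - y) ^ 2 * (1 - dl z) := by
    rw [norm_smul, Complex.norm_real, Real.norm_of_nonneg (by linarith)]; unfold dl; ring
  have e : dl (((1 - y : ℝ) : ℂ) • z) = 1 - (1 - y) ^ 2 * (1 - dl z) := by rw [← this]; rfl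
  rw [e]
  have : (1 - y) ^ 2 ≤ (1 - y) := by nlinarith
  nlinarith [mul_nonneg (sub_nonneg.2 this) (sub_nonneg.2 d2), mul_nonneg hy d1.le,
    mul_nonneg hy (sub_nonneg.2 d2), mul_nonneg d1.le (sub_nonneg.2 hy1)]

lemma ker_avg (t c : ℝ) (ht : 0 ≤ t) (hc : 0 < c) : ∃ C : ℝ, 0 < C ∧
    ∀ z w : E, ‖z‖ < 1 → ‖w‖ < 1 → ENNReal.ofReal (‖kk z w‖ ^ (-c)) ≤
      ENNReal.ofReal C * ∫⁻ y in Set.Ioo (0:ℝ) 1, ENNReal.ofReal ((y + dl z) ^ (2 * t) *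
        ‖kk (((1 - y : ℝ) : ℂ) • z) w‖ ^ (-(2 * t + c + 1))) := by
  set A : ℝ := (1/4) ^ (2 * t) * (3/2) ^ (-(2 * t + c + 1)) * (1/4) with hA
  have hA0 : 0 < A := by positivity
  refine ⟨A⁻¹, by positivity, fun z w hz hw => ?_⟩
  have d1 := dl_pos hz
  have d3 := kk_norm_pos hz hw
  have d4 := kk_norm_le hz hw
  set D := ‖kk z w‖ with hD
  have key : ENNReal.ofReal (A * D ^ (-c)) ≤ ∫⁻ y in Set.Ioo (0:ℝ) 1, ENNReal.ofReal ((y + dl z) ^ (2 * t) *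
        ‖kk (((1 - y : ℝ) : ℂ) • z) w‖ ^ (-(2 * t + c + 1))) := by
    have sub : Set.Ioo (D / 4) (D / 2) ⊆ Set.Ioo (0:ℝ) 1 :=
      Set.Ioo_subset_Ioo (by positivity) (by linarith)
    refine le_trans ?_ (lintegral_mono_set sub)
    have : ∫⁻ y in Set.Ioo (D / 4) (D / 2), ENNReal.ofReal ((D / 4) ^ (2 * t) * (3 * D / 2) ^ (-(2 * t + c + 1)))
        ≤ ∫⁻ y in Set.Ioo (D / 4) (D / 2), ENNReal.ofReal ((y + dl z) ^ (2 * t) *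
        ‖kk (((1 - y : ℝ) : ℂ) • z) w‖ ^ (-(2 * t + c + 1))) := by
      refine setLIntegral_mono' measurableSet_Ioo (fun y hy => ?_)
      apply ENNReal.ofReal_le_ofReal
      have hy0 : 0 ≤ y := le_trans (by positivity) hy.1.le
      have hzy : ‖((1 - y : ℝ) : ℂ) • z‖ < 1 := by
        rw [norm_smul, Complex.norm_real, Real.norm_of_nonneg (by linarith [hy.2])]
        nlinarith [norm_nonneg z]
      have h0 := kk_norm_pos hzy hw
      have h1 := kk_smul_le hz hw hy0
      have h2 : ‖kk (((1 - y : ℝ) : ℂ) • z) w‖ ≤ 3 * D / 2 := by linarith [hy.2]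
      have h3 := Real.rpow_le_rpow_of_nonpos h0 h2 (show -(2 * t + c + 1) ≤ 0 by linarith)
      have h4 : (D / 4) ^ (2 * t) ≤ (y + dl z) ^ (2 * t) :=
        Real.rpow_le_rpow (by positivity) (by linarith [hy.1]) (by linarith)
      gcongr
    refine le_trans (le_of_eq ?_) this
    rw [setLIntegral_const, Real.volume_Ioo, ← ENNReal.ofReal_mul (by positivity)]
    congr 1
    rw [hA, show D / 4 = (1/4) * D by ring, show 3 * D / 2 = (3/2) * D by ring,
      Real.mul_rpow (by norm_num) d3.le, Real.mul_rpow (by norm_num) d3.le]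
    have e : D ^ (-c) = D ^ (2 * t) * D ^ (-(2 * t + c + 1)) * D := by
      nth_rw 4 [← Real.rpow_one D]
      rw [← Real.rpow_add d3, ← Real.rpow_add d3]; ring_nf
    rw [e]; ring
  calc ENNReal.ofReal (D ^ (-c)) = ENNReal.ofReal A⁻¹ * ENNReal.ofReal (A * D ^ (-c)) := by
        rw [← ENNReal.ofReal_mul (by positivity)]; congr 1; field_simp
    _ ≤ _ := by gcongr

lemma int_y {δ r : ℝ} (hδ : 0 < δ) (hr : r < -1) :
    ∫⁻ y in Set.Ioo (0:ℝ) 1, ENNReal.ofReal ((y + δ) ^ r) ≤ ENNReal.ofReal (δ ^ (r + 1) / (-(r + 1))) := by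
  have hi : IntegrableOn (fun y : ℝ => (y + δ) ^ r) (Set.Icc 0 1) := by
    apply ContinuousOn.integrableOn_Icc
    exact ContinuousOn.rpow_const (by fun_prop) (fun x hx => Or.inl (by linarith [hx.1]))
  have hi2 := hi.mono_set Set.Ioo_subset_Icc_self
  rw [← ofReal_integral_eq_lintegral_ofReal hi2]
  · apply ENNReal.ofReal_le_ofReal
    rw [← integral_Ioc_eq_integral_Ioo, ← intervalIntegral.integral_of_le zero_le_one,
      intervalIntegral.integral_comp_add_right (fun y => y ^ r), integral_rpow]
    · have : 0 ≤ (1 + δ) ^ (r + 1) := by positivity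
      rw [zero_add, ← neg_div_neg_eq]
      apply div_le_div_of_nonneg_right _ (by linarith)
      linarith
    · right
      refine ⟨by linarith, ?_⟩
      rw [Set.uIcc_of_le (by linarith)]
      intro h; linarith [h.1]
  · filter_upwards [ae_restrict_mem measurableSet_Ioo] with y hy
    have := hy.1
    have : 0 < y + δ := by linarith
    positivity

lemma FR [Nontrivial E] {t c : ℝ} (ht : (nn E : ℝ) < t) (hc : t < c) :
    ∃ C : ℝ, 0 < C ∧ ∀ z : E, ‖z‖ < 1 → LL μ t c z ≤ ENNReal.ofReal (C * dl z ^ (t - c)) := by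
  have ht0 : 0 < t := lt_of_le_of_lt (Nat.cast_nonneg _) ht
  obtain ⟨C1, hC1, h1⟩ := ker_avg (E := E) t c ht0.le (ht0.trans hc)
  obtain ⟨C2, hC2, h2⟩ := LL_big μ ht (show 2 * t ≤ 2 * t + c + 1 by linarith)
  set c' := 2 * t + c + 1 with hc'
  refine ⟨C1 * (C2 * (1/2) ^ (t - c') * (c - t)⁻¹), by have := sub_pos.2 hc; positivity, fun z hz => ?_⟩
  have d1 := dl_pos hz
  have m0 : Measurable (fun q : E × ℝ => ENNReal.ofReal ((q.2 + dl z) ^ (2 * t) *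
        ‖kk (((1 - q.2 : ℝ) : ℂ) • z) q.1‖ ^ (-c'))) := by
    have hc2 : Continuous (fun q : E × ℝ => kk (((1 - q.2 : ℝ) : ℂ) • z) q.1) :=
      continuous_kk.comp (Continuous.prodMk (by fun_prop) continuous_fst)
    have hc1 : Continuous (fun q : E × ℝ => q.2 + dl z) := by fun_prop
    exact ((hc1.measurable.pow_const _).mul (hc2.norm.measurable.pow_const _)).ennreal_ofReal
  have m1 : Measurable (fun q : E × ℝ => ENNReal.ofReal (dl q.1 ^ t) *
      ENNReal.ofReal ((q.2 + dl z) ^ (2 * t) * ‖kk (((1 - q.2 : ℝ) : ℂ) • z) q.1‖ ^ (-c'))) :=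
    ((measurable_dl_rpow t).comp measurable_fst).mul m0
  haveI : SFinite (tau μ) := by unfold tau; infer_instance
  calc LL μ t c z ≤ ∫⁻ w, ENNReal.ofReal C1 * (∫⁻ y in Set.Ioo (0:ℝ) 1, ENNReal.ofReal (dl w ^ t) *
      ENNReal.ofReal ((y + dl z) ^ (2 * t) * ‖kk (((1 - y : ℝ) : ℂ) • z) w‖ ^ (-c'))) ∂(tau μ) := by
        refine lintegral_mono_ae ?_
        filter_upwards [ae_tau μ] with w hw
        have d2 := dl_pos hw
        rw [ENNReal.ofReal_mul (by positivity), lintegral_const_mul]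
        · calc _ ≤ _ := mul_le_mul_right (h1 z w hz hw) _
            _ = _ := by ring
        · exact m0.comp (measurable_const.prodMk measurable_id)
    _ = ENNReal.ofReal C1 * ∫⁻ y in Set.Ioo (0:ℝ) 1, ∫⁻ w, ENNReal.ofReal (dl w ^ t) *
      ENNReal.ofReal ((y + dl z) ^ (2 * t) * ‖kk (((1 - y : ℝ) : ℂ) • z) w‖ ^ (-c')) ∂(tau μ) := by
        rw [lintegral_const_mul]
        · rw [lintegral_lintegral_swap]
          exact m1.aemeasurable
        · exact Measurable.lintegral_prod_right' m1
    _ ≤ ENNReal.ofReal C1 * ∫⁻ y in Set.Ioo (0:ℝ) 1, ENNReal.ofReal (C2 * (1/2) ^ (t - c')) *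
          ENNReal.ofReal ((y + dl z) ^ (t - c - 1)) := by
        refine mul_le_mul_right ?_ _
        refine setLIntegral_mono' measurableSet_Ioo (fun y hy => ?_)
        have hy0 := hy.1
        have hy1 := hy.2
        have hzy : ‖((1 - y : ℝ) : ℂ) • z‖ < 1 := by
          rw [norm_smul, Complex.norm_real, Real.norm_of_nonneg (by linarith [hy.2])]
          nlinarith [norm_nonneg z]
        have hp : 0 < y + dl z := by linarith
        have e1 : ∫⁻ w, ENNReal.ofReal (dl w ^ t) *
            ENNReal.ofReal ((y + dl z) ^ (2 * t) * ‖kk (((1 - y : ℝ) : ℂ) • z) w‖ ^ (-c')) ∂(tau μ)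
            = ENNReal.ofReal ((y + dl z) ^ (2 * t)) * LL μ t c' (((1 - y : ℝ) : ℂ) • z) := by
          unfold LL
          rw [← lintegral_const_mul _ (measurable_ker _ _ _)]
          refine lintegral_congr_ae ?_
          filter_upwards [ae_tau μ] with w hw
          have d2 := dl_pos hw
          rw [← ENNReal.ofReal_mul (by positivity), ← ENNReal.ofReal_mul (by positivity)]
          congr 1; ring
        rw [e1]
        refine (mul_le_mul_right (h2 _ hzy) _).trans ?_
        rw [← ENNReal.ofReal_mul (by positivity), ← ENNReal.ofReal_mul (by positivity)]
        apply ENNReal.ofReal_le_ofReal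
        have e2 := Real.rpow_le_rpow_of_nonpos (by positivity) (dl_smul_ge hz hy0.le hy1.le)
          (show t - c' ≤ 0 by linarith)
        have e3 : (y + dl z) ^ (t - c - 1) = (y + dl z) ^ (2 * t) * (y + dl z) ^ (t - c') := by
          rw [← Real.rpow_add hp]; congr 1; rw [hc']; ring
        rw [div_eq_mul_one_div, Real.mul_rpow hp.le (by norm_num)] at e2
        rw [e3]
        calc _ ≤ (y + dl z) ^ (2 * t) * (C2 * ((y + dl z) ^ (t - c') * (1/2) ^ (t - c'))) := by gcongr
          _ = _ := by ring
    _ ≤ ENNReal.ofReal C1 * (ENNReal.ofReal (C2 * (1/2) ^ (t - c')) * 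
          ENNReal.ofReal (dl z ^ (t - c - 1 + 1) / (-(t - c - 1 + 1)))) := by
        rw [lintegral_const_mul]
        · gcongr
          exact int_y d1 (by linarith)
        · exact ((measurable_id.add_const _).pow_const _).ennreal_ofReal
    _ = _ := by
        rw [← ENNReal.ofReal_mul (by positivity), ← ENNReal.ofReal_mul (by positivity)]
        congr 1
        rw [show t - c - 1 + 1 = t - c by ring, show -(t - c) = c - t by ring]
        field_simp

end fr
end CR


namespace CR
section sm
variable {E : Type*} [NormedAddCommGroup E] [InnerProductSpace ℂ E] [FiniteDimensional ℂ E]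
  [MeasurableSpace E] [BorelSpace E] (μ : Measure E) [μ.IsAddHaarMeasure]

instance : SFinite (tau μ) := by unfold tau; infer_instance

lemma aem_tau {F : E → ℂ} (hF : ContinuousOn F (BB E)) : AEMeasurable F (tau μ) := by
  refine ⟨_, indicator_meas hF, ?_⟩
  filter_upwards [ae_tau μ] with z hz
  rw [Set.indicator_of_mem (mem_ball.2 hz)]

lemma kk_comp {a w z : E} (ha : ‖a‖ < 1) (hw : ‖w‖ < 1) (hz : ‖z‖ < 1) (h : ‖mob a w‖ ≤ 1/2) :
    ‖kk z w‖ ≤ 3 * ‖kk z a‖ := by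
  have h1 := ratio ha hw hz (by norm_num) h
  have h2 := kk_ne hz ha
  have h3 : ‖kk z w / kk z a‖ ≤ 3 := by
    calc ‖kk z w / kk z a‖ = ‖(kk z w / kk z a - 1) + 1‖ := by ring_nf
      _ ≤ ‖kk z w / kk z a - 1‖ + ‖(1:ℂ)‖ := norm_add_le _ _
      _ ≤ _ := by norm_num at h1 ⊢; linarith
  rw [norm_div, div_le_iff₀ (kk_norm_pos hz ha)] at h3
  exact h3

lemma kk_comp' {a w z : E} (ha : ‖a‖ < 1) (hw : ‖w‖ < 1) (hz : ‖z‖ < 1) (h : ‖mob a w‖ ≤ 1/2) :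
    ‖kk z a‖ ≤ 3 * ‖kk z w‖ :=
  kk_comp hw ha hz (by rwa [← norm_mob_symm ha hw])

lemma dl_comp {a w : E} (ha : ‖a‖ < 1) (hw : ‖w‖ < 1) (h : ‖mob a w‖ ≤ 1/2) :
    dl w ≤ 9 * dl a := by
  have h1 := kk_comp ha hw hw h
  have h2 := kk_comp ha hw ha h
  rw [kk_self_norm hw] at h1
  rw [kk_self_norm ha] at h2
  rw [kk_norm_symm] at h2
  linarith

lemma dl_comp' {a w : E} (ha : ‖a‖ < 1) (hw : ‖w‖ < 1) (h : ‖mob a w‖ ≤ 1/2) :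
    dl a ≤ 9 * dl w := dl_comp hw ha (by rwa [← norm_mob_symm ha hw])

lemma lintegral_affine {g : E → ℝ≥0∞} (hg : Measurable g) (w0 : E) {ρ : ℝ} (hρ : 0 < ρ) :
    ∫⁻ u, g (w0 + ρ • u) ∂μ = ENNReal.ofReal ((ρ ^ (Module.finrank ℝ E))⁻¹) * ∫⁻ u, g u ∂μ := by
  have h1 := Measure.map_addHaar_smul μ hρ.ne'
  have h2 : ∫⁻ u, g (w0 + u) ∂(Measure.map (fun u => ρ • u) μ) = ∫⁻ u, g (w0 + ρ • u) ∂μ :=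
    lintegral_map (hg.comp (measurable_const_add w0)) (measurable_const_smul ρ)
  rw [← h2]
  have h3 : (Measure.map (fun u => ρ • u) μ) = ENNReal.ofReal |(ρ ^ (Module.finrank ℝ E))⁻¹| • μ := h1
  rw [h3, lintegral_smul_measure, lintegral_add_left_eq_self, abs_of_pos (by positivity)]
  rfl

lemma SM {p : ℝ} (hp : 0 < p) (hp1 : p ≤ 1) : ∃ C : ℝ≥0∞, C ≠ ∞ ∧ ∀ G : E → ℂ,
    DifferentiableOn ℂ G (BB E) →
      ‖G 0‖ₑ ^ p ≤ C * ∫⁻ w in Metric.ball (0:E) (1/2), ‖G w‖ₑ ^ p ∂μ := by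
  set d := Module.finrank ℝ E with hd
  set s : ℝ := d / p with hs
  have hs0 : 0 ≤ s := by positivity
  have hsp : s * p = d := by rw [hs]; field_simp
  set V := μ (BB E) with hV
  have hV0 : V ≠ 0 := (Metric.measure_ball_pos μ 0 one_pos).ne'
  have hVt : V ≠ ∞ := measure_ball_lt_top.ne
  refine ⟨V⁻¹ * ENNReal.ofReal (4 ^ d * (2 ^ s) ^ (1 - p)), 
    ENNReal.mul_ne_top (ENNReal.inv_ne_top.2 hV0) ENNReal.ofReal_ne_top, fun G hG => ?_⟩
  set I := ∫⁻ w in Metric.ball (0:E) (1/2), ‖G w‖ₑ ^ p ∂μ with hI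
  have hsub : Metric.closedBall (0:E) (1/2) ⊆ BB E := Metric.closedBall_subset_ball (by norm_num)
  obtain ⟨w0, hw0, hmax⟩ := (isCompact_closedBall (0:E) (1/2)).exists_isMaxOn ⟨0, by simp⟩
    (f := fun w => ‖G w‖ * (1/2 - ‖w‖) ^ s)
    ((hG.continuousOn.mono hsub).norm.mul
      ((continuousOn_const.sub continuousOn_id.norm).rpow_const (fun _ _ => Or.inr hs0)))
  have hmax' : ∀ w : E, ‖w‖ ≤ 1/2 → ‖G w‖ * (1/2 - ‖w‖) ^ s ≤ ‖G w0‖ * (1/2 - ‖w0‖) ^ s :=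
    fun w hw => hmax (by simpa using hw)
  have hm0 := hmax' 0 (by simp)
  rw [norm_zero, sub_zero] at hm0
  by_cases hG0 : G 0 = 0
  · rw [hG0, enorm_zero, ENNReal.zero_rpow_of_pos hp]; exact zero_le
  have hd0 : 1 ≤ d ∨ d = 0 := by omega
  have hw0' : ‖w0‖ ≤ 1/2 := by simpa using hw0
  have hpos : 0 < ‖G w0‖ * (1/2 - ‖w0‖) ^ s := lt_of_lt_of_le (by positivity) hm0
  have hx : 0 < ‖G w0‖ := by
    rcases (norm_nonneg (G w0)).lt_or_eq with h | h
    · exact h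
    · rw [← h] at hpos; simp at hpos
  -- dimension zero is harmless
  have hw0'' : ‖w0‖ < 1/2 := by
    rcases hd0 with h | h
    · have hs1 : 0 < s := by positivity
      rcases hw0'.lt_or_eq with h' | h'
      · exact h'
      · rw [h', sub_self, Real.zero_rpow hs1.ne'] at hpos; simp at hpos
    · have : Subsingleton E := Module.finrank_zero_iff.1 h
      rw [Subsingleton.elim w0 0]; simp
  set x := ‖G w0‖ with hxd
  set ρ : ℝ := (1/2 - ‖w0‖) / 2 with hρ
  have hρ0 : 0 < ρ := by rw [hρ]; linarith
  have hρ1 : ρ ≤ 1/4 := by rw [hρ]; linarith [norm_nonneg w0]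
  have hball : ∀ u : E, ‖u‖ < 1 → ‖w0 + ρ • u‖ < 1/2 - ρ := by
    intro u hu
    have : ‖ρ • u‖ < ρ := by
      rw [norm_smul, Real.norm_of_nonneg hρ0.le]; nlinarith
    have h2 := norm_add_le w0 (ρ • u)
    have : 1/2 - ρ = ‖w0‖ + ρ := by rw [hρ]; ring
    linarith
  have hbd : ∀ u : E, ‖u‖ < 1 → ‖G (w0 + ρ • u)‖ ≤ 2 ^ s * x := by
    intro u hu
    have h1 := hball u hu
    have h2 := hmax' (w0 + ρ • u) (by linarith)
    have h3 : ρ ^ s ≤ (1/2 - ‖w0 + ρ • u‖) ^ s := Real.rpow_le_rpow hρ0.le (by linarith) hs0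
    have h4 : 1/2 - ‖w0‖ = 2 * ρ := by rw [hρ]; ring
    rw [h4, Real.mul_rpow (by norm_num) hρ0.le] at h2
    have h5 : 0 < ρ ^ s := by positivity
    have : ‖G (w0 + ρ • u)‖ * ρ ^ s ≤ (2 ^ s * x) * ρ ^ s := by
      calc _ ≤ ‖G (w0 + ρ • u)‖ * (1/2 - ‖w0 + ρ • u‖) ^ s := by gcongr
        _ ≤ _ := h2
        _ = _ := by ring
    exact le_of_mul_le_mul_right this h5
  have hh : DifferentiableOn ℂ (fun u : E => G (w0 + ρ • u)) (BB E) := by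
    refine hG.comp ?_ ?_
    · have : (fun u : E => w0 + ρ • u) = fun u : E => w0 + (ρ : ℂ) • u := by
        ext u; simp
      rw [this]
      fun_prop
    · intro u hu
      rw [mem_ball] at *
      linarith [hball u hu]
  haveI : IsFiniteMeasure (μ.restrict (BB E)) := ⟨by simpa using hVt.lt_top⟩
  have mv := mean_value_le (ν := μ.restrict (BB E)) ((rotInv_haar μ).restrict 1)
    (by filter_upwards [ae_restrict_mem measurableSet_ball] with z hz using mem_ball.1 hz) hh
  simp only [smul_zero, add_zero, Measure.restrict_apply_univ] at mv
  set g : E → ℝ≥0∞ := (Metric.ball (0:E) (1/2)).indicator (fun w => ‖(BB E).indicator G w‖ₑ ^ p) with hg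
  have gm : Measurable g :=
    ((indicator_meas hG.continuousOn).enorm.pow_const p).indicator measurableSet_ball
  have hgI : ∫⁻ w, g w ∂μ = I := by
    rw [hg, lintegral_indicator measurableSet_ball, hI]
    refine setLIntegral_congr_fun measurableSet_ball (fun w hw => ?_)
    have : w ∈ BB E := hsub (Metric.ball_subset_closedBall hw)
    simp only [Set.indicator_of_mem this]
  have step : ∫⁻ u in BB E, ‖G (w0 + ρ • u)‖ₑ ∂μ ≤
      ENNReal.ofReal ((2 ^ s * x) ^ (1 - p)) * ∫⁻ u, g (w0 + ρ • u) ∂μ := by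
    rw [← lintegral_const_mul]
    · rw [← lintegral_indicator measurableSet_ball]
      refine lintegral_mono (fun u => ?_)
      by_cases hu : u ∈ BB E
      · rw [Set.indicator_of_mem hu]
        rw [mem_ball] at hu
        have h1 := hball u hu
        have h2 : w0 + ρ • u ∈ Metric.ball (0:E) (1/2) := by
          rw [mem_ball_zero_iff]; linarith
        have h3 : w0 + ρ • u ∈ BB E := hsub (Metric.ball_subset_closedBall h2)
        rw [hg, Set.indicator_of_mem h2, Set.indicator_of_mem h3]
        have h4 := hbd u hu
        rw [← ofReal_norm_eq_enorm, ENNReal.ofReal_rpow_of_nonneg (norm_nonneg _) hp.le,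
          ← ENNReal.ofReal_mul (by positivity)]
        apply ENNReal.ofReal_le_ofReal
        calc ‖G (w0 + ρ • u)‖ = ‖G (w0 + ρ • u)‖ ^ (1 - p) * ‖G (w0 + ρ • u)‖ ^ p := by
              rw [← Real.rpow_add_of_nonneg (norm_nonneg _) (by linarith) hp.le]; simp
          _ ≤ _ := by
              gcongr
      · rw [Set.indicator_of_notMem hu]; exact zero_le
    · exact gm.comp ((measurable_const_smul ρ).const_add w0)
  rw [lintegral_affine μ gm w0 hρ0, hgI] at step
  have mv2 := mv.trans step
  rw [← hV, ← ofReal_norm_eq_enorm, ← hxd] at mv2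
  -- multiply
  have fin : V * ENNReal.ofReal (x ^ p * ρ ^ d) ≤ ENNReal.ofReal ((2 ^ s) ^ (1 - p)) * I := by
    calc V * ENNReal.ofReal (x ^ p * ρ ^ d)
        = ENNReal.ofReal (x ^ (p - 1) * ρ ^ d) * (V * ENNReal.ofReal x) := by
          have : x ^ p * ρ ^ d = (x ^ (p - 1) * ρ ^ d) * x := by
            rw [Real.rpow_sub_one hx.ne']; field_simp
          rw [this, ENNReal.ofReal_mul (by positivity)]; ring
      _ ≤ ENNReal.ofReal (x ^ (p - 1) * ρ ^ d) * (ENNReal.ofReal ((2 ^ s * x) ^ (1 - p)) *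
            (ENNReal.ofReal ((ρ ^ d)⁻¹) * I)) := mul_le_mul_right mv2 _
      _ = ENNReal.ofReal ((x ^ (p - 1) * ρ ^ d) * (2 ^ s * x) ^ (1 - p) * (ρ ^ d)⁻¹) * I := by
          rw [ENNReal.ofReal_mul (p := (x ^ (p - 1) * ρ ^ d) * (2 ^ s * x) ^ (1 - p)) (by positivity),
            ENNReal.ofReal_mul (p := x ^ (p - 1) * ρ ^ d) (by positivity)]; ring
      _ = _ := by
          congr 2
          rw [Real.mul_rpow (by positivity) hx.le]
          have : x ^ (p - 1) * x ^ (1 - p) = 1 := by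
            rw [← Real.rpow_add hx]; simp
          have h5 : ρ ^ d ≠ 0 := by positivity
          calc _ = (2 ^ s) ^ (1 - p) * (x ^ (p - 1) * x ^ (1 - p)) * (ρ ^ d * (ρ ^ d)⁻¹) := by ring
            _ = _ := by rw [this, mul_inv_cancel₀ h5]; ring
  have hG0x : ‖G 0‖ ^ p ≤ 4 ^ d * (x ^ p * ρ ^ d) := by
    have h4 : 1/2 - ‖w0‖ = (1/2) * (4 * ρ) := by rw [hρ]; ring
    rw [h4, Real.mul_rpow (by norm_num) (by positivity)] at hm0
    have h6 : ‖G 0‖ ≤ x * (4 * ρ) ^ s := by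
      have : 0 < (1/2 : ℝ) ^ s := by positivity
      refine le_of_mul_le_mul_right (hm0.trans (le_of_eq ?_)) this
      ring
    calc ‖G 0‖ ^ p ≤ (x * (4 * ρ) ^ s) ^ p := Real.rpow_le_rpow (norm_nonneg _) h6 hp.le
      _ = x ^ p * (4 * ρ) ^ (d : ℝ) := by
        rw [Real.mul_rpow hx.le (by positivity), ← Real.rpow_mul (by positivity), hsp]
      _ = _ := by rw [Real.rpow_natCast, mul_pow]; ring
  rw [← ofReal_norm_eq_enorm, ENNReal.ofReal_rpow_of_nonneg (norm_nonneg _) hp.le]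
  calc ENNReal.ofReal (‖G 0‖ ^ p) ≤ ENNReal.ofReal (4 ^ d * (x ^ p * ρ ^ d)) :=
        ENNReal.ofReal_le_ofReal hG0x
    _ = V⁻¹ * ENNReal.ofReal (4 ^ d) * (V * ENNReal.ofReal (x ^ p * ρ ^ d)) := by
        rw [ENNReal.ofReal_mul (by positivity)]
        calc _ = (V⁻¹ * V) * (ENNReal.ofReal (4 ^ d) * ENNReal.ofReal (x ^ p * ρ ^ d)) := by
              rw [ENNReal.inv_mul_cancel hV0 hVt, one_mul]
          _ = _ := by ring
    _ ≤ V⁻¹ * ENNReal.ofReal (4 ^ d) * (ENNReal.ofReal ((2 ^ s) ^ (1 - p)) * I) :=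
        mul_le_mul_right fin _
    _ = _ := by rw [ENNReal.ofReal_mul (by positivity)]; ring

lemma SMtau {p : ℝ} (hp : 0 < p) (hp1 : p ≤ 1) : ∃ C : ℝ≥0∞, C ≠ ∞ ∧ ∀ F : E → ℂ,
    DifferentiableOn ℂ F (BB E) → ∀ z : E, ‖z‖ < 1 → 
      ‖F z‖ₑ ^ p ≤ C * ∫⁻ w, (if ‖mob z w‖ < 1/2 then ‖F w‖ₑ ^ p else 0) ∂(tau μ) := by
  obtain ⟨C, hC, h⟩ := SM μ hp hp1
  refine ⟨C, hC, fun F hF z hz => ?_⟩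
  have hG : DifferentiableOn ℂ (fun w => F (mob z w)) (BB E) := by
    refine hF.comp (fun w hw => ?_) (fun w hw => ?_)
    · exact (hasFDerivAt_mob hz (mem_ball.1 hw)).differentiableAt.differentiableWithinAt
    · exact mem_ball.2 (mob_mem hz (mem_ball.1 hw))
  have h1 := h _ hG
  simp only [mob_zero] at h1
  refine h1.trans (mul_le_mul_right ?_ _)
  rw [← lintegral_mob μ hz, lintegral_tau, ← lintegral_indicator measurableSet_ball,
    ← lintegral_indicator measurableSet_ball]
  refine lintegral_mono (fun w => ?_)
  by_cases hw : w ∈ Metric.ball (0:E) (1/2)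
  · have hw1 : w ∈ BB E := Metric.ball_subset_ball (by norm_num) hw
    rw [Set.indicator_of_mem hw, Set.indicator_of_mem hw1]
    rw [mem_ball] at hw1
    rw [mob_mob hz hw1, if_pos (by simpa using hw)]
    have : (1:ℝ) ≤ dl w ^ (-((nn E : ℝ) + 1)) :=
      Real.one_le_rpow_of_pos_of_le_one_of_nonpos (dl_pos hw1) (dl_le_one w) (by linarith [Nat.cast_nonneg (α := ℝ) (nn E)])
    calc ‖F (mob z w)‖ₑ ^ p = ENNReal.ofReal 1 * ‖F (mob z w)‖ₑ ^ p := by simp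
      _ ≤ _ := by gcongr
  · rw [Set.indicator_of_notMem hw]; exact zero_le

lemma EL {p b : ℝ} (hp : 0 < p) (hp1 : p ≤ 1) (hb : 0 ≤ b) : ∃ C : ℝ≥0∞, C ≠ ∞ ∧ ∀ F : E → ℂ,
    DifferentiableOn ℂ F (BB E) →
      (∫⁻ w, ‖F w‖ₑ * ENNReal.ofReal (dl w ^ b) ∂(tau μ)) ^ p ≤
        C * ∫⁻ w, (‖F w‖ₑ * ENNReal.ofReal (dl w ^ b)) ^ p ∂(tau μ) := by
  obtain ⟨C, hC, h⟩ := SMtau μ hp hp1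
  set C' := C * ENNReal.ofReal (9 ^ b) ^ p with hC'
  refine ⟨C' ^ (1 - p), ?_, fun F hF => ?_⟩
  · apply ENNReal.rpow_ne_top_of_nonneg (by linarith)
    exact ENNReal.mul_ne_top hC (ENNReal.rpow_ne_top_of_nonneg hp.le ENNReal.ofReal_ne_top)
  set φ : E → ℝ≥0∞ := fun w => ‖F w‖ₑ * ENNReal.ofReal (dl w ^ b) with hφ
  have φm : AEMeasurable φ (tau μ) :=
    (aem_tau μ hF.continuousOn).enorm.mul (measurable_dl_rpow b).aemeasurable
  change (∫⁻ w, φ w ∂(tau μ)) ^ p ≤ C' ^ (1 - p) * ∫⁻ w, φ w ^ p ∂(tau μ)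
  set J := ∫⁻ w, φ w ^ p ∂(tau μ) with hJ
  have sup : ∀ z, ‖z‖ < 1 → φ z ^ p ≤ C' * J := by
    intro z hz
    have h1 := h F hF z hz
    have d1 := dl_pos hz
    calc φ z ^ p = ENNReal.ofReal (dl z ^ b) ^ p * ‖F z‖ₑ ^ p := by
          rw [hφ]; simp only; rw [ENNReal.mul_rpow_of_nonneg _ _ hp.le, mul_comm]
      _ ≤ ENNReal.ofReal (dl z ^ b) ^ p * (C * ∫⁻ w, (if ‖mob z w‖ < 1/2 then ‖F w‖ₑ ^ p else 0) ∂(tau μ)) :=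
          mul_le_mul_right h1 _
      _ = C * (ENNReal.ofReal (dl z ^ b) ^ p * ∫⁻ w, (if ‖mob z w‖ < 1/2 then ‖F w‖ₑ ^ p else 0) ∂(tau μ)) := by
          ring
      _ ≤ C * (ENNReal.ofReal (9 ^ b) ^ p * J) := by
          refine mul_le_mul_right ?_ _
          rw [← lintegral_const_mul' _ _ (ENNReal.rpow_ne_top_of_nonneg hp.le ENNReal.ofReal_ne_top),
            hJ, ← lintegral_const_mul' _ _ (ENNReal.rpow_ne_top_of_nonneg hp.le ENNReal.ofReal_ne_top)]
          refine lintegral_mono_ae ?_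
          filter_upwards [ae_tau μ] with w hw
          split_ifs with hm
          · have d2 := dl_pos hw
            have := dl_comp' hz hw hm.le
            rw [hφ]; simp only
            rw [ENNReal.mul_rpow_of_nonneg _ _ hp.le, mul_comm (‖F w‖ₑ ^ p), ← mul_assoc,
              ← ENNReal.mul_rpow_of_nonneg (ENNReal.ofReal (9 ^ b)) _ hp.le, ← ENNReal.ofReal_mul (by positivity),
              ← Real.mul_rpow (by norm_num) d2.le]
            gcongr
          · simp
      _ = _ := by rw [hC']; ring
  have hle : ∫⁻ w, φ w ∂(tau μ) ≤ (C' * J) ^ ((1 - p) / p) * J := by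
    rw [hJ, ← lintegral_const_mul'' _ (φm.pow_const p), ← hJ]
    refine lintegral_mono_ae ?_
    filter_upwards [ae_tau μ] with w hw
    calc φ w = (φ w ^ p) ^ ((1 - p) / p) * φ w ^ p := by
          rw [← ENNReal.rpow_mul, ← ENNReal.rpow_add_of_nonneg _ _ _ hp.le]
          · rw [show p * ((1 - p) / p) + p = 1 by field_simp; ring, ENNReal.rpow_one]
          · rw [show p * ((1 - p) / p) = 1 - p by field_simp]; linarith
      _ ≤ _ := by
          have := div_nonneg (sub_nonneg.2 hp1) hp.le
          exact mul_le_mul_left (ENNReal.rpow_le_rpow (sup w hw) this) _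
  calc (∫⁻ w, φ w ∂(tau μ)) ^ p ≤ ((C' * J) ^ ((1 - p) / p) * J) ^ p := ENNReal.rpow_le_rpow hle hp.le
    _ = C' ^ (1 - p) * (J ^ (1 - p) * J ^ p) := by
        rw [ENNReal.mul_rpow_of_nonneg _ _ hp.le, ← ENNReal.rpow_mul,
          show (1 - p) / p * p = 1 - p by field_simp, ENNReal.mul_rpow_of_nonneg _ _ (by linarith)]
        ring
    _ = _ := by
        rw [← ENNReal.rpow_add_of_nonneg _ _ (by linarith) hp.le]; simp

end sm
end CR


namespace CR
section schur
variable {E : Type*} [NormedAddCommGroup E] [InnerProductSpace ℂ E] [FiniteDimensional ℂ E]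
  [MeasurableSpace E] [BorelSpace E] (μ : Measure E) [μ.IsAddHaarMeasure]

def TT (b : ℝ) (g : E → ℝ≥0∞) (z : E) : ℝ≥0∞ :=
  ∫⁻ w, ENNReal.ofReal (dl w ^ b * ‖kk z w‖ ^ (-b)) * g w ∂(tau μ)

lemma measurable_TT (b : ℝ) {g : E → ℝ≥0∞} (hg : Measurable g) : Measurable (TT μ b g) := by
  unfold TT
  exact Measurable.lintegral_prod_right' (f := fun q : E × E =>
    ENNReal.ofReal (dl q.2 ^ b * ‖kk q.1 q.2‖ ^ (-b)) * g q.2)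
    ((measurable_ker2 b b).mul (hg.comp measurable_snd))

lemma TT_congr (b : ℝ) {g h : E → ℝ≥0∞} (hgh : ∀ z, ‖z‖ < 1 → g z = h z) (z : E) :
    TT μ b g z = TT μ b h z := by
  unfold TT
  refine lintegral_congr_ae ?_
  filter_upwards [ae_tau μ] with w hw
  rw [hgh w hw]

lemma TT_mono (b : ℝ) {g h : E → ℝ≥0∞} (hgh : ∀ z, ‖z‖ < 1 → g z ≤ h z) (z : E) :
    TT μ b g z ≤ TT μ b h z := by
  unfold TT
  refine lintegral_mono_ae ?_
  filter_upwards [ae_tau μ] with w hw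
  gcongr
  exact hgh w hw

lemma swapFR [Nontrivial E] {t c : ℝ} (s : ℝ) (ht : (nn E : ℝ) < t) (hc : t < c) :
    ∃ C : ℝ≥0∞, C ≠ ∞ ∧ ∀ G : E → ℝ≥0∞, Measurable G →
    ∫⁻ z, ENNReal.ofReal (dl z ^ t) *
        (∫⁻ w, ENNReal.ofReal (dl w ^ s * ‖kk z w‖ ^ (-c)) * G w ∂(tau μ)) ∂(tau μ) ≤
      C * ∫⁻ w, ENNReal.ofReal (dl w ^ (s + t - c)) * G w ∂(tau μ) := by
  obtain ⟨C, hC, h⟩ := FR μ ht hc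
  refine ⟨ENNReal.ofReal C, ENNReal.ofReal_ne_top, fun G hG => ?_⟩
  have m1 : Measurable (fun q : E × E => ENNReal.ofReal (dl q.1 ^ t) *
      (ENNReal.ofReal (dl q.2 ^ s * ‖kk q.1 q.2‖ ^ (-c)) * G q.2)) :=
    ((measurable_dl_rpow t).comp measurable_fst).mul
      ((measurable_ker2 s c).mul (hG.comp measurable_snd))
  calc _ = ∫⁻ z, (∫⁻ w, ENNReal.ofReal (dl z ^ t) *
        (ENNReal.ofReal (dl w ^ s * ‖kk z w‖ ^ (-c)) * G w) ∂(tau μ)) ∂(tau μ) := by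
        refine lintegral_congr (fun z => ?_)
        rw [lintegral_const_mul]
        exact (measurable_ker s c z).mul hG
    _ = ∫⁻ w, (∫⁻ z, ENNReal.ofReal (dl z ^ t) *
        (ENNReal.ofReal (dl w ^ s * ‖kk z w‖ ^ (-c)) * G w) ∂(tau μ)) ∂(tau μ) :=
        lintegral_lintegral_swap m1.aemeasurable
    _ ≤ ∫⁻ w, ENNReal.ofReal C * (ENNReal.ofReal (dl w ^ (s + t - c)) * G w) ∂(tau μ) := by
        refine lintegral_mono_ae ?_
        filter_upwards [ae_tau μ] with w hw
        have d2 := dl_pos hw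
        have e : ∫⁻ z, ENNReal.ofReal (dl z ^ t) *
            (ENNReal.ofReal (dl w ^ s * ‖kk z w‖ ^ (-c)) * G w) ∂(tau μ)
            = (ENNReal.ofReal (dl w ^ s) * G w) * LL μ t c w := by
          unfold LL
          rw [← lintegral_const_mul _ (measurable_ker _ _ _)]
          refine lintegral_congr_ae ?_
          filter_upwards [ae_tau μ] with z hz
          have d1 := dl_pos hz
          rw [ENNReal.ofReal_mul (by positivity), ENNReal.ofReal_mul (by positivity),
            kk_norm_symm z w]
          ring
        rw [e]
        calc _ ≤ (ENNReal.ofReal (dl w ^ s) * G w) * ENNReal.ofReal (C * dl w ^ (t - c)) := by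
              gcongr; exact h w hw
          _ = _ := by
              rw [show s + t - c = s + (t - c) by ring, Real.rpow_add d2,
                ENNReal.ofReal_mul (by positivity), ENNReal.ofReal_mul (by positivity)]
              ring
    _ = _ := by
        rw [lintegral_const_mul]
        exact (measurable_dl_rpow _).mul hG

lemma schur [Nontrivial E] {p θ b : ℝ} (hp : 1 < p) (hθ : (nn E : ℝ) < θ)
    (hb : nn E + (θ - nn E) / p < b) : ∃ C : ℝ≥0∞, C ≠ ∞ ∧ ∀ g : E → ℝ≥0∞, Measurable g →
      ∫⁻ z, TT μ b g z ^ p ∂(tb μ θ) ≤ C * ∫⁻ z, g z ^ p ∂(tb μ θ) := by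
  have hp0 : 0 < p := by linarith
  have hbn : (nn E : ℝ) < b := by
    have : 0 < (θ - nn E) / p := div_pos (by linarith) hp0
    linarith
  set q := p / (p - 1) with hq
  have hpq : p.HolderConjugate q := Real.HolderConjugate.conjExponent hp
  have hq0 : 0 < q := hpq.symm.pos
  obtain ⟨σ, hσ1, hσ2⟩ : ∃ σ, max 0 ((θ - b) / p) < σ ∧ σ < min ((b - nn E) / q) ((θ - nn E) / p) := by
    apply exists_between
    rw [max_lt_iff, lt_min_iff, lt_min_iff]
    refine ⟨⟨div_pos (by linarith) hq0, div_pos (by linarith) hp0⟩, ?_, ?_⟩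
    · rw [hq, div_div_eq_mul_div]
      apply div_lt_div_of_pos_right _ hp0
      have : (nn E + (θ - nn E) / p) * p < b * p := by gcongr
      rw [add_mul, div_mul_cancel₀ _ hp0.ne'] at this
      nlinarith
    · apply div_lt_div_of_pos_right _ hp0
      linarith
  rw [max_lt_iff] at hσ1
  rw [lt_min_iff] at hσ2
  obtain ⟨s1, s2⟩ := hσ1
  obtain ⟨s3, s4⟩ := hσ2
  rw [div_lt_iff₀ hp0] at s2
  rw [lt_div_iff₀ hq0] at s3
  rw [lt_div_iff₀ hp0] at s4
  have hσq : 0 < σ * q := by positivity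
  obtain ⟨C1, hC1, h1⟩ := FR μ (t := b - σ * q) (c := b) (by linarith) (by linarith)
  obtain ⟨C2, hC2, h2⟩ := swapFR μ (t := θ - σ * p) (c := b) (b + σ * p) (by linarith) (by linarith)
  refine ⟨ENNReal.ofReal C1 ^ (p / q) * C2, ENNReal.mul_ne_top
    (ENNReal.rpow_ne_top_of_nonneg (by positivity) ENNReal.ofReal_ne_top) hC2, fun g hg => ?_⟩
  have pt : ∀ z : E, ‖z‖ < 1 → TT μ b g z ^ p ≤ ENNReal.ofReal C1 ^ (p / q) *
      (ENNReal.ofReal (dl z ^ (-(σ * p))) *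
      ∫⁻ w, ENNReal.ofReal (dl w ^ (b + σ * p) * ‖kk z w‖ ^ (-b)) * g w ^ p ∂(tau μ)) := by
    intro z hz
    have d1 := dl_pos hz
    set f2 : E → ℝ≥0∞ := fun w => ENNReal.ofReal ((dl w ^ b * ‖kk z w‖ ^ (-b)) ^ (1 / q) * dl w ^ (-σ))
    set f1 : E → ℝ≥0∞ := fun w => ENNReal.ofReal ((dl w ^ b * ‖kk z w‖ ^ (-b)) ^ (1 / p) * dl w ^ σ) * g w
    have mk : Measurable (fun w : E => dl w ^ b * ‖kk z w‖ ^ (-b)) :=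
      (continuous_dl.measurable.pow_const b).mul
        ((continuous_kk_right z).norm.measurable.pow_const _)
    have m2 : Measurable f2 :=
      ((mk.pow_const _).mul (continuous_dl.measurable.pow_const _)).ennreal_ofReal
    have m1 : Measurable f1 :=
      ((mk.pow_const _).mul (continuous_dl.measurable.pow_const _)).ennreal_ofReal.mul hg
    have e0 : TT μ b g z = ∫⁻ w, (f1 * f2) w ∂(tau μ) := by
      unfold TT
      refine lintegral_congr_ae ?_
      filter_upwards [ae_tau μ] with w hw
      have d2 := dl_pos hw
      have d3 := kk_norm_pos hz hw
      have dK : 0 < dl w ^ b * ‖kk z w‖ ^ (-b) := by positivity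
      have e : dl w ^ b * ‖kk z w‖ ^ (-b) = ((dl w ^ b * ‖kk z w‖ ^ (-b)) ^ (1 / p) * dl w ^ σ) *
          ((dl w ^ b * ‖kk z w‖ ^ (-b)) ^ (1 / q) * dl w ^ (-σ)) := by
        have a1 : (dl w ^ b * ‖kk z w‖ ^ (-b)) ^ (1 / p) * (dl w ^ b * ‖kk z w‖ ^ (-b)) ^ (1 / q) 
            = dl w ^ b * ‖kk z w‖ ^ (-b) := by
          rw [← Real.rpow_add dK, hpq.one_div_add_one_div, one_div_one, Real.rpow_one]
        have a2 : dl w ^ σ * dl w ^ (-σ) = 1 := by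
          rw [← Real.rpow_add d2]; simp
        calc _ = ((dl w ^ b * ‖kk z w‖ ^ (-b)) ^ (1 / p) * (dl w ^ b * ‖kk z w‖ ^ (-b)) ^ (1 / q)) *
              (dl w ^ σ * dl w ^ (-σ)) := by rw [a1, a2, mul_one]
          _ = _ := by ring
      simp only [f1, f2, Pi.mul_apply]
      rw [e, ENNReal.ofReal_mul (by positivity), ← e]
      ring
    have e1 : ∫⁻ w, f2 w ^ q ∂(tau μ) = LL μ (b - σ * q) b z := by
      unfold LL
      refine lintegral_congr_ae ?_
      filter_upwards [ae_tau μ] with w hw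
      have d2 := dl_pos hw
      have d3 := kk_norm_pos hz hw
      simp only [f2]
      rw [ENNReal.ofReal_rpow_of_nonneg (by positivity) hq0.le]
      congr 1
      rw [Real.mul_rpow (by positivity) (by positivity), ← Real.rpow_mul (by positivity),
        one_div_mul_cancel hq0.ne', Real.rpow_one, ← Real.rpow_mul d2.le,
        show b - σ * q = b + (-σ) * q by ring, Real.rpow_add d2]
      ring
    have e2 : ∫⁻ w, f1 w ^ p ∂(tau μ) =
        ∫⁻ w, ENNReal.ofReal (dl w ^ (b + σ * p) * ‖kk z w‖ ^ (-b)) * g w ^ p ∂(tau μ) := by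
      refine lintegral_congr_ae ?_
      filter_upwards [ae_tau μ] with w hw
      have d2 := dl_pos hw
      have d3 := kk_norm_pos hz hw
      simp only [f1]
      rw [ENNReal.mul_rpow_of_nonneg _ _ hp0.le, ENNReal.ofReal_rpow_of_nonneg (by positivity) hp0.le]
      congr 2
      rw [Real.mul_rpow (by positivity) (by positivity), ← Real.rpow_mul (by positivity),
        one_div_mul_cancel hp0.ne', Real.rpow_one, ← Real.rpow_mul d2.le, Real.rpow_add d2]
      ring
    have hol := ENNReal.lintegral_mul_le_Lp_mul_Lq (tau μ) hpq m1.aemeasurable m2.aemeasurable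
    rw [← e0, e1, e2] at hol
    set J := ∫⁻ w, ENNReal.ofReal (dl w ^ (b + σ * p) * ‖kk z w‖ ^ (-b)) * g w ^ p ∂(tau μ)
    have hL := h1 z hz
    calc TT μ b g z ^ p ≤ (J ^ (1 / p) * (ENNReal.ofReal (C1 * dl z ^ (b - σ * q - b))) ^ (1 / q)) ^ p := by
          gcongr
          refine hol.trans ?_
          gcongr
      _ = J * (ENNReal.ofReal C1 ^ (p / q) * ENNReal.ofReal (dl z ^ (-(σ * p)))) := by
          rw [ENNReal.mul_rpow_of_nonneg _ _ hp0.le, ← ENNReal.rpow_mul, one_div_mul_cancel hp0.ne',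
            ENNReal.rpow_one, ← ENNReal.rpow_mul, ENNReal.ofReal_mul hC1.le,
            ENNReal.mul_rpow_of_nonneg _ _ (by positivity),
            ENNReal.ofReal_rpow_of_nonneg (p := 1 / q * p) (by positivity : 0 ≤ dl z ^ (b - σ * q - b)) (by positivity),
            ← Real.rpow_mul d1.le]
          congr 3
          · ring
          · congr 1
            field_simp
            ring
      _ = _ := by ring
  rw [lintegral_tb, lintegral_tb]
  calc _ ≤ ∫⁻ z, ENNReal.ofReal C1 ^ (p / q) * (ENNReal.ofReal (dl z ^ (θ - σ * p)) *
      ∫⁻ w, ENNReal.ofReal (dl w ^ (b + σ * p) * ‖kk z w‖ ^ (-b)) * g w ^ p ∂(tau μ)) ∂(tau μ) := by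
        refine lintegral_mono_ae ?_
        filter_upwards [ae_tau μ] with z hz
        have d1 := dl_pos hz
        calc _ ≤ ENNReal.ofReal (dl z ^ θ) * _ := mul_le_mul_right (pt z hz) _
          _ = _ := by
            rw [sub_eq_add_neg, Real.rpow_add d1, ENNReal.ofReal_mul (by positivity)]
            ring
    _ = ENNReal.ofReal C1 ^ (p / q) * ∫⁻ z, (ENNReal.ofReal (dl z ^ (θ - σ * p)) *
      ∫⁻ w, ENNReal.ofReal (dl w ^ (b + σ * p) * ‖kk z w‖ ^ (-b)) * g w ^ p ∂(tau μ)) ∂(tau μ) := by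
        rw [lintegral_const_mul' _ _ (ENNReal.rpow_ne_top_of_nonneg (by positivity) ENNReal.ofReal_ne_top)]
    _ ≤ _ := by
        rw [mul_assoc]
        refine mul_le_mul_right ((h2 _ (hg.pow_const p)).trans (le_of_eq ?_)) _
        rw [show b + σ * p + (θ - σ * p) - b = θ by ring]

lemma norm_kkpow {z w : E} (hz : ‖z‖ < 1) (hw : ‖w‖ < 1) (b : ℝ) :
    ‖(kk z w) ^ ((b : ℝ) : ℂ)‖ = ‖kk z w‖ ^ b := Complex.norm_cpow_real _ _

lemma diff_kkpow {a : E} (ha : ‖a‖ < 1) (c : ℂ) :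
    DifferentiableOn ℂ (fun w : E => (kk w a) ^ c) (BB E) := by
  intro w hw
  rw [mem_ball] at hw
  refine (DifferentiableAt.cpow_const (hasFDerivAt_kk a w).differentiableAt ?_).differentiableWithinAt
  exact Or.inl (kk_re_pos hw ha)

lemma K1 [Nontrivial E] {p θ b : ℝ} (hp : 0 < p) (hθ : (nn E : ℝ) < θ)
    (hb : nn E * max 1 (1 / p) + (θ - nn E) / p < b) : ∃ C : ℝ≥0∞, C ≠ ∞ ∧ ∀ f : E → ℂ,
      DifferentiableOn ℂ f (BB E) → 
      ∫⁻ z, TT μ b (fun w => ‖f w‖ₑ) z ^ p ∂(tb μ θ) ≤ C * ∫⁻ z, ‖f z‖ₑ ^ p ∂(tb μ θ) := by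
  have h0 : (0:ℝ) ≤ nn E := Nat.cast_nonneg _
  have hind : ∀ f : E → ℂ, ∀ z, ‖z‖ < 1 → (BB E).indicator f z = f z :=
    fun f z hz => Set.indicator_of_mem (mem_ball.2 hz) _
  rcases lt_or_ge 1 p with hp1 | hp1
  · obtain ⟨C, hC, h⟩ := schur μ (p := p) (θ := θ) (b := b) hp1 hθ (by
      refine lt_of_le_of_lt ?_ hb
      gcongr
      nlinarith [le_max_left 1 (1 / p)])
    refine ⟨C, hC, fun f hf => ?_⟩
    have := h (fun z => ‖(BB E).indicator f z‖ₑ) (indicator_meas hf.continuousOn).enorm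
    calc _ = ∫⁻ z, TT μ b (fun w => ‖(BB E).indicator f w‖ₑ) z ^ p ∂(tb μ θ) := by
          refine lintegral_congr (fun z => ?_)
          rw [TT_congr μ b (h := fun w => ‖(BB E).indicator f w‖ₑ) (fun z hz => by rw [hind f z hz])]
      _ ≤ _ := this
      _ = _ := by
          congr 1
          refine lintegral_congr_ae ?_
          filter_upwards [ae_tb μ θ] with z hz
          rw [hind f z hz]
  · have hpb : θ < p * b := by
      have h1 : (1:ℝ) / p ≤ max 1 (1 / p) := le_max_right _ _
      have : nn E * (1 / p) + (θ - nn E) / p < b := lt_of_le_of_lt (by gcongr) hb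
      have h2 : p * (nn E * (1 / p) + (θ - nn E) / p) < p * b := by gcongr
      have h3 : p * (nn E * (1 / p) + (θ - nn E) / p) = θ := by field_simp; ring
      linarith
    have hb0 : 0 < b := by
      by_contra hneg
      nlinarith
    obtain ⟨C1, hC1, h1⟩ := EL μ hp hp1 hb0.le
    obtain ⟨C2, hC2, h2⟩ := swapFR μ (t := θ) (c := p * b) (p * b) hθ hpb
    refine ⟨C1 * C2, ENNReal.mul_ne_top hC1 hC2, fun f hf => ?_⟩
    rw [lintegral_tb, lintegral_tb]
    have m0 := (indicator_meas hf.continuousOn).enorm.pow_const p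
    have pt : ∀ z : E, ‖z‖ < 1 → TT μ b (fun w => ‖f w‖ₑ) z ^ p ≤ C1 *
        ∫⁻ w, ENNReal.ofReal (dl w ^ (p * b) * ‖kk z w‖ ^ (-(p * b))) * ‖(BB E).indicator f w‖ₑ ^ p ∂(tau μ) := by
      intro z hz
      have h3 := h1 (fun w => f w * (kk w z) ^ ((-b : ℝ) : ℂ)) (hf.mul (diff_kkpow hz _))
      have n1 : ∀ w : E, ‖w‖ < 1 → ‖f w * (kk w z) ^ ((-b : ℝ) : ℂ)‖ₑ =
          ‖f w‖ₑ * ENNReal.ofReal (‖kk z w‖ ^ (-b)) := by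
        intro w hw
        rw [enorm_mul]
        congr 1
        rw [← ofReal_norm_eq_enorm, norm_kkpow hw hz, kk_norm_symm]
      calc TT μ b (fun w => ‖f w‖ₑ) z ^ p = 
            (∫⁻ w, ‖f w * (kk w z) ^ ((-b : ℝ) : ℂ)‖ₑ * ENNReal.ofReal (dl w ^ b) ∂(tau μ)) ^ p := by
            congr 1
            refine lintegral_congr_ae ?_
            filter_upwards [ae_tau μ] with w hw
            have d2 := dl_pos hw
            rw [n1 w hw, ENNReal.ofReal_mul (by positivity)]
            ring
        _ ≤ _ := h3
        _ = _ := by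
            congr 1
            refine lintegral_congr_ae ?_
            filter_upwards [ae_tau μ] with w hw
            have d2 := dl_pos hw
            have d3 := kk_norm_pos hz hw
            rw [n1 w hw, hind f w hw, mul_assoc, ENNReal.mul_rpow_of_nonneg _ _ hp.le,
              ← ENNReal.ofReal_mul (by positivity), ENNReal.ofReal_rpow_of_nonneg (by positivity) hp.le,
              Real.mul_rpow (by positivity) (by positivity), ← Real.rpow_mul d2.le, ← Real.rpow_mul d3.le,
              mul_comm]
            congr 2
            rw [mul_comm]; congr 2 <;> ring
    calc _ ≤ ∫⁻ z, C1 * (ENNReal.ofReal (dl z ^ θ) *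
        ∫⁻ w, ENNReal.ofReal (dl w ^ (p * b) * ‖kk z w‖ ^ (-(p * b))) * ‖(BB E).indicator f w‖ₑ ^ p ∂(tau μ)) ∂(tau μ) := by
          refine lintegral_mono_ae ?_
          filter_upwards [ae_tau μ] with z hz
          calc _ ≤ ENNReal.ofReal (dl z ^ θ) * _ := mul_le_mul_right (pt z hz) _
            _ = _ := by ring
      _ = C1 * ∫⁻ z, (ENNReal.ofReal (dl z ^ θ) *
        ∫⁻ w, ENNReal.ofReal (dl w ^ (p * b) * ‖kk z w‖ ^ (-(p * b))) * ‖(BB E).indicator f w‖ₑ ^ p ∂(tau μ)) ∂(tau μ) := by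
          rw [lintegral_const_mul' _ _ hC1]
      _ ≤ _ := by
          rw [mul_assoc]
          refine mul_le_mul_right ((h2 _ m0).trans (le_of_eq ?_)) _
          congr 1
          refine lintegral_congr_ae ?_
          filter_upwards [ae_tau μ] with z hz
          rw [hind f z hz, show p * b + θ - p * b = θ by ring]

end schur
end CR


namespace CR
section lattice
variable {E : Type*} [NormedAddCommGroup E] [InnerProductSpace ℂ E] [FiniteDimensional ℂ E]
  [MeasurableSpace E] [BorelSpace E] (μ : Measure E) [μ.IsAddHaarMeasure]

def DD (a : E) (r : ℝ) : Set E := BB E ∩ mob a ⁻¹' (Metric.ball 0 r)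

lemma mem_DD {a w : E} {r : ℝ} : w ∈ DD a r ↔ ‖w‖ < 1 ∧ ‖mob a w‖ < r := by
  unfold DD; simp

lemma isOpen_DD {a : E} (ha : ‖a‖ < 1) (r : ℝ) : IsOpen (DD a r) := by
  unfold DD
  refine ContinuousOn.isOpen_inter_preimage ?_ Metric.isOpen_ball Metric.isOpen_ball
  intro w hw
  exact (hasFDerivAt_mob ha (mem_ball.1 hw)).continuousAt.continuousWithinAt

lemma mob_self {a : E} (ha : ‖a‖ < 1) : mob a a = 0 := by
  have := mob_mob ha (show ‖(0:E)‖ < 1 by simp)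
  rwa [mob_zero] at this

lemma self_mem_DD {a : E} (ha : ‖a‖ < 1) {r : ℝ} (hr : 0 < r) : a ∈ DD a r := by
  rw [mem_DD, mob_self ha]; simp [ha, hr]

lemma tau_DD {a : E} (ha : ‖a‖ < 1) (r : ℝ) : tau μ (DD a r) = tau μ (Metric.ball 0 r) := by
  rw [← (mp_mob μ ha).measure_preimage measurableSet_ball.nullMeasurableSet]
  apply measure_congr
  filter_upwards [ae_tau μ] with w hw
  apply propext
  show w ∈ DD a r ↔ w ∈ mob a ⁻¹' (Metric.ball 0 r)
  unfold DD
  simp [hw]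

lemma tau_ball_pos {r : ℝ} (hr : 0 < r) (hr1 : r ≤ 1) : 0 < tau μ (Metric.ball 0 r) := by
  refine lt_of_lt_of_le (Metric.measure_ball_pos μ 0 hr) ?_
  rw [← lintegral_indicator_one measurableSet_ball, ← lintegral_indicator_one measurableSet_ball,
    lintegral_tau, ← lintegral_indicator measurableSet_ball]
  refine lintegral_mono (fun w => ?_)
  by_cases hw : w ∈ Metric.ball (0:E) r
  · have hw1 : w ∈ BB E := Metric.ball_subset_ball hr1 hw
    rw [Set.indicator_of_mem hw, Set.indicator_of_mem hw1, Set.indicator_of_mem hw]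
    rw [mem_ball] at hw1
    have : (1:ℝ) ≤ dl w ^ (-((nn E : ℝ) + 1)) :=
      Real.one_le_rpow_of_pos_of_le_one_of_nonpos (dl_pos hw1) (dl_le_one w) (by linarith [Nat.cast_nonneg (α := ℝ) (nn E)])
    simpa using this
  · rw [Set.indicator_of_notMem hw]; exact zero_le

lemma tau_ball_lt {r : ℝ} (hr1 : r < 1) : tau μ (Metric.ball 0 r) < ∞ := by
  rcases le_or_gt r 0 with h | hr0
  · rw [Metric.ball_eq_empty.2 h]; simp
  rw [← lintegral_indicator_one measurableSet_ball, lintegral_tau, ← lintegral_indicator measurableSet_ball]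
  refine lt_of_le_of_lt (b := ∫⁻ w in Metric.ball (0:E) r, ENNReal.ofReal ((1 - r ^ 2) ^ (-((nn E : ℝ) + 1))) ∂μ) ?_ ?_
  · rw [← lintegral_indicator measurableSet_ball]
    refine lintegral_mono (fun w => ?_)
    by_cases hw : w ∈ Metric.ball (0:E) r
    · have hw1 : w ∈ BB E := Metric.ball_subset_ball hr1.le hw
      rw [Set.indicator_of_mem hw, Set.indicator_of_mem hw1, Set.indicator_of_mem hw]
      rw [mem_ball_zero_iff] at hw
      simp only [Pi.one_apply, mul_one]
      apply ENNReal.ofReal_le_ofReal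
      apply Real.rpow_le_rpow_of_nonpos (by nlinarith) _ (by linarith [Nat.cast_nonneg (α := ℝ) (nn E)])
      unfold dl
      nlinarith [norm_nonneg w]
    · rw [Set.indicator_of_notMem hw]
      by_cases hw1 : w ∈ BB E
      · rw [Set.indicator_of_mem hw1, Set.indicator_of_notMem hw]; simp
      · rw [Set.indicator_of_notMem hw1]
  · rw [setLIntegral_const]
    exact ENNReal.mul_lt_top ENNReal.ofReal_lt_top measure_ball_lt_top

/-- weak triangle inequality -/
lemma weak_tri {a a' w : E} {r : ℝ} (hr : 0 < r) (hr1 : r ≤ 1) (ha : ‖a‖ < 1) (ha' : ‖a'‖ < 1)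
    (hw : w ∈ DD a (r ^ 2 / 32)) (hw' : w ∈ DD a' (r ^ 2 / 32)) : ‖mob a a'‖ < r := by
  rw [mem_DD] at hw hw'
  obtain ⟨w1, h1⟩ := hw
  obtain ⟨-, h2⟩ := hw'
  set δ := r ^ 2 / 32 with hδ
  have hδ1 : δ ≤ 1/32 := by rw [hδ]; nlinarith
  have hδ0 : 0 < δ := by positivity
  rw [norm_mob_symm ha w1] at h1
  rw [norm_mob_symm ha' w1] at h2
  have hε : 2 * δ / (1 - δ) ≤ 3 * δ := by
    rw [div_le_iff₀ (by linarith)]; nlinarith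
  have aux : ∀ x y : E, ‖x‖ < 1 → ‖y‖ < 1 → ‖mob w x‖ < δ → 
      (1 - 3 * δ) * ‖kk y w‖ ≤ ‖kk y x‖ ∧ ‖kk y x‖ ≤ (1 + 3 * δ) * ‖kk y w‖ := by
    intro x y hx hy hm
    have hh := (ratio w1 hx hy (by linarith) hm.le).trans hε
    have p1 := kk_norm_pos hy w1
    have e : kk y x - kk y w = (kk y x / kk y w - 1) * kk y w := by
      have := kk_ne hy w1; field_simp
    have n1 : ‖kk y x - kk y w‖ ≤ 3 * δ * ‖kk y w‖ := by
      rw [e, norm_mul]; gcongr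
    have n2 := norm_sub_norm_le (kk y x) (kk y w)
    have n3 := norm_sub_norm_le (kk y w) (kk y x)
    rw [norm_sub_rev] at n3
    constructor <;> nlinarith
  have A1 := (aux a a ha ha h1).1
  have A2 := (aux a' a' ha' ha' h2).1
  have A3 := (aux a' a ha' ha h2).2
  have A4 := (aux a a' ha ha' h1).2
  rw [kk_self_norm ha] at A1
  rw [kk_self_norm ha'] at A2
  rw [kk_norm_symm a' a] at A4
  have p1 := kk_norm_pos ha w1
  have p2 := kk_norm_pos ha' w1
  have p3 := kk_norm_pos ha ha'
  set X := ‖kk a w‖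
  set Y := ‖kk a' w‖
  set K := ‖kk a a'‖
  have B1 : (1 - 3 * δ) ^ 2 * (X * Y) ≤ dl a * dl a' := by
    calc _ = ((1 - 3 * δ) * X) * ((1 - 3 * δ) * Y) := by ring
      _ ≤ _ := mul_le_mul A1 A2 (mul_nonneg (by linarith) p2.le) (dl_pos ha).le
  have B2 : K ^ 2 ≤ (1 + 3 * δ) ^ 2 * (X * Y) := by
    calc K ^ 2 = K * K := by ring
      _ ≤ ((1 + 3 * δ) * X) * ((1 + 3 * δ) * Y) := mul_le_mul A3 A4 p3.le (by positivity)
      _ = _ := by ring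
  have B3 : (1 - r ^ 2) * (1 + 3 * δ) ^ 2 < (1 - 3 * δ) ^ 2 := by
    have : r ^ 2 = 32 * δ := by rw [hδ]; ring
    rw [this]; nlinarith [sq_nonneg δ, mul_pos hδ0 hδ0, mul_pos (mul_pos hδ0 hδ0) hδ0]
  have hm := dl_mob ha ha'
  rw [kk_norm_symm a' a] at hm
  have B4 : 1 - r ^ 2 < dl (mob a a') := by
    rw [hm, lt_div_iff₀ (by positivity)]
    have hr2 : 0 ≤ 1 - r ^ 2 := by nlinarith
    have hXY : 0 < X * Y := by positivity
    calc (1 - r ^ 2) * K ^ 2 ≤ (1 - r ^ 2) * ((1 + 3 * δ) ^ 2 * (X * Y)) := by gcongr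
      _ = ((1 - r ^ 2) * (1 + 3 * δ) ^ 2) * (X * Y) := by ring
      _ < (1 - 3 * δ) ^ 2 * (X * Y) := by gcongr
      _ ≤ _ := B1
  unfold dl at B4
  nlinarith [norm_nonneg (mob a a')]

structure Lat (r : ℝ) (a : ℕ → E) (Ek : ℕ → Set E) (m M : ℝ≥0∞) : Prop where
  mem : ∀ k, ‖a k‖ < 1
  meas : ∀ k, MeasurableSet (Ek k)
  disj : Pairwise (fun i j => Disjoint (Ek i) (Ek j))
  sub : ∀ k, ∀ w ∈ Ek k, ‖w‖ < 1 ∧ ‖mob (a k) w‖ ≤ r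
  cover : ∀ w : E, ‖w‖ < 1 → ∃ k, w ∈ Ek k
  lower : ∀ k, m ≤ tau μ (Ek k)
  upper : ∀ k, tau μ (Ek k) ≤ M

lemma exists_lat [Nontrivial E] {r : ℝ} (hr : 0 < r) (hr1 : r ≤ 1/2) :
    ∃ (a : ℕ → E) (Ek : ℕ → Set E) (m M : ℝ≥0∞), Lat μ r a Ek m M ∧ m ≠ 0 ∧ M ≠ ∞ := by
  set δ := r ^ 2 / 32 with hδ
  have hδ0 : 0 < δ := by positivity
  have hδr : δ ≤ r := by rw [hδ]; nlinarith
  -- maximal separated set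
  obtain ⟨A, hA⟩ := zorn_subset {S : Set E | S ⊆ BB E ∧ S.Pairwise (fun x y => r ≤ ‖mob x y‖)} (by
    intro c hc hch
    refine ⟨⋃₀ c, ⟨Set.sUnion_subset (fun s hs => (hc hs).1), ?_⟩, fun s hs => Set.subset_sUnion_of_mem hs⟩
    rw [Set.pairwise_sUnion hch.directedOn]
    exact fun s hs => (hc hs).2)
  have hAB : ∀ x ∈ A, ‖x‖ < 1 := fun x hx => mem_ball.1 (hA.prop.1 hx)
  have hsep : A.Pairwise (fun x y => r ≤ ‖mob x y‖) := hA.prop.2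
  have hcov : ∀ w : E, ‖w‖ < 1 → ∃ x ∈ A, w ∈ DD x r := by
    intro w hw
    by_contra hno
    push Not at hno
    have hno' : ∀ x ∈ A, r ≤ ‖mob x w‖ := by
      intro x hx
      have := hno x hx
      rw [mem_DD] at this
      push Not at this
      exact this hw
    have hwA : w ∉ A := by
      intro h
      exact hno w h (self_mem_DD hw hr)
    have hins : insert w A ∈ {S : Set E | S ⊆ BB E ∧ S.Pairwise (fun x y => r ≤ ‖mob x y‖)} := by
      refine ⟨Set.insert_subset (mem_ball.2 hw) hA.prop.1, ?_⟩
      rw [Set.pairwise_insert]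
      refine ⟨hsep, fun x hx hne => ⟨?_, hno' x hx⟩⟩
      rw [norm_mob_symm hw (hAB x hx)]; exact hno' x hx
    exact hwA (hA.le_of_ge hins (Set.subset_insert _ _) (Set.mem_insert _ _))
  have hdis : A.PairwiseDisjoint (fun x => DD x δ) := by
    intro x hx y hy hne
    rw [Function.onFun, Set.disjoint_left]
    intro w hw hw'
    have := weak_tri hr (by linarith) (hAB x hx) (hAB y hy) hw hw'
    linarith [hsep hx hy hne]
  have hcount : A.Countable := hdis.countable_of_isOpen (fun x hx => isOpen_DD (hAB x hx) _)
    (fun x hx => ⟨x, self_mem_DD (hAB x hx) hδ0⟩)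
  have hinf : A.Infinite := by
    intro hfin
    have hne : A.Nonempty := by
      obtain ⟨x, hx, -⟩ := hcov 0 (by simp)
      exact ⟨x, hx⟩
    obtain ⟨x0, hx0, hmin⟩ := hfin.exists_minimalFor dl A hne
    have hmin' : ∀ y ∈ A, dl x0 ≤ dl y := fun y hy => by
      rcases le_total (dl y) (dl x0) with h | h
      · exact hmin hy h
      · exact h
    have d0 := dl_pos (hAB x0 hx0)
    have d1 := dl_le_one x0
    obtain ⟨e, he⟩ := exists_norm_eq E (show (0:ℝ) ≤ 1 - dl x0 / 20 by linarith)
    have he1 : ‖e‖ < 1 := by linarith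
    obtain ⟨y, hy, hey⟩ := hcov e he1
    rw [mem_DD] at hey
    have h1 := dl_comp' (hAB y hy) he1 (by linarith [hey.2])
    have h2 := hmin' y hy
    have h3 : dl e = 1 - (1 - dl x0 / 20) ^ 2 := by rw [← he]; rfl
    nlinarith
  haveI : Countable A := hcount.to_subtype
  haveI : Infinite A := hinf.to_subtype
  obtain ⟨hden⟩ := nonempty_denumerable A
  let en : ℕ ≃ A := (Denumerable.eqv A).symm
  set a : ℕ → E := fun k => (en k : E) with ha
  have haA : ∀ k, a k ∈ A := fun k => (en k).2
  have hinj : Function.Injective a := Subtype.val_injective.comp en.injective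
  have ha1 : ∀ k, ‖a k‖ < 1 := fun k => hAB _ (haA k)
  have hdis' : ∀ i j, i ≠ j → Disjoint (DD (a i) δ) (DD (a j) δ) :=
    fun i j hij => hdis (haA i) (haA j) (fun h => hij (hinj h))
  set F : ℕ → Set E := fun k => DD (a k) r \ ⋃ j, DD (a j) δ with hF
  have mD : ∀ k s, MeasurableSet (DD (a k) s) := fun k s => (isOpen_DD (ha1 k) s).measurableSet
  have mF : ∀ k, MeasurableSet (F k) := fun k => (mD k r).diff (MeasurableSet.iUnion (fun j => mD j δ))
  have hDsub : ∀ k, DD (a k) δ ⊆ DD (a k) r := by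
    intro k w hw
    rw [mem_DD] at *
    exact ⟨hw.1, by linarith [hw.2]⟩
  have hEsub : ∀ k, DD (a k) δ ∪ disjointed F k ⊆ DD (a k) r := by
    intro k
    refine Set.union_subset (hDsub k) ((disjointed_subset F k).trans Set.diff_subset)
  refine ⟨a, fun k => DD (a k) δ ∪ disjointed F k, tau μ (Metric.ball 0 δ), tau μ (Metric.ball 0 r),
    ⟨ha1, fun k => (mD k δ).union (MeasurableSet.disjointed mF k), ?_, ?_, ?_, ?_, ?_⟩, ?_, ?_⟩
  · intro i j hij
    have hFD : ∀ i j, Disjoint (DD (a i) δ) (disjointed F j) := by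
      intro i j
      rw [Set.disjoint_left]
      intro w hw hw'
      exact (disjointed_subset F j hw').2 (Set.mem_iUnion.2 ⟨i, hw⟩)
    simp only [Set.disjoint_union_left, Set.disjoint_union_right]
    exact ⟨⟨hdis' i j hij, (hFD j i).symm⟩, hFD i j, disjoint_disjointed F hij⟩
  · intro k w hw
    have := hEsub k hw
    rw [mem_DD] at this
    exact ⟨this.1, this.2.le⟩
  · intro w hw
    by_cases hw2 : w ∈ ⋃ j, DD (a j) δ
    · obtain ⟨j, hj⟩ := Set.mem_iUnion.1 hw2
      exact ⟨j, Or.inl hj⟩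
    · obtain ⟨x, hx, hwx⟩ := hcov w hw
      have : w ∈ ⋃ k, F k := by
        refine Set.mem_iUnion.2 ⟨en.symm ⟨x, hx⟩, ?_, hw2⟩
        simpa [ha] using hwx
      rw [← iUnion_disjointed] at this
      obtain ⟨k, hk⟩ := Set.mem_iUnion.1 this
      exact ⟨k, Or.inr hk⟩
  · intro k
    rw [← tau_DD μ (ha1 k)]
    exact measure_mono Set.subset_union_left
  · intro k
    rw [← tau_DD μ (ha1 k)]
    exact measure_mono (hEsub k)
  · exact (tau_ball_pos μ hδ0 (by linarith)).ne'
  · exact (tau_ball_lt μ (by linarith)).ne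

end lattice
end CR

namespace CR
section K23
variable {E : Type*} [NormedAddCommGroup E] [InnerProductSpace ℂ E] [FiniteDimensional ℂ E]
  [MeasurableSpace E] [BorelSpace E] (μ : Measure E) [μ.IsAddHaarMeasure]

lemma tsum_rpow_le {p : ℝ} (hp : 0 < p) (hp1 : p ≤ 1) (x : ℕ → ℝ≥0∞) :
    (∑' k, x k) ^ p ≤ ∑' k, x k ^ p := by
  have h1 := (ENNReal.continuous_rpow_const (y := p)).continuousAt.tendsto.comp
    (ENNReal.summable (f := x)).hasSum.tendsto_sum_nat
  have h2 := (ENNReal.summable (f := fun k => x k ^ p)).hasSum.tendsto_sum_nat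
  refine le_of_tendsto_of_tendsto' h1 h2 (fun N => ?_)
  simp only [Function.comp]
  induction N with
  | zero => simp [hp]
  | succ N ih =>
    rw [Finset.sum_range_succ, Finset.sum_range_succ]
    exact (ENNReal.rpow_add_le_add_rpow _ _ hp.le hp1).trans (add_le_add_left ih _)

def atN (s b : ℝ) (a z : E) : ℝ≥0∞ := ENNReal.ofReal (dl a ^ s * ‖kk z a‖ ^ (-b))

lemma measurable_atN (s b : ℝ) (a : E) : Measurable (atN s b a) := by
  unfold atN
  refine ENNReal.measurable_ofReal.comp ?_
  exact ((continuous_kk_left a).norm.measurable.pow_const _).const_mul _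

lemma int_cells {r : ℝ} {a : ℕ → E} {Ek : ℕ → Set E} {m M : ℝ≥0∞} (L : Lat μ r a Ek m M)
    (G : E → ℝ≥0∞) : ∫⁻ w, G w ∂(tau μ) = ∑' k, ∫⁻ w in Ek k, G w ∂(tau μ) := by
  rw [← lintegral_iUnion L.meas L.disj, Measure.restrict_eq_self_of_ae_mem]
  filter_upwards [ae_tau μ] with w hw
  exact Set.mem_iUnion.2 (L.cover w hw)

lemma hpb_of {p θ b : ℝ} (hp : 0 < p) (hθ : (nn E : ℝ) < θ)
    (hb : nn E * max 1 (1 / p) + (θ - nn E) / p < b) : θ < p * b ∧ 0 < b := by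
  have h0 : (0:ℝ) ≤ nn E := Nat.cast_nonneg _
  have hpb : θ < p * b := by
    have h1 : (1:ℝ) / p ≤ max 1 (1 / p) := le_max_right _ _
    have : nn E * (1 / p) + (θ - nn E) / p < b := lt_of_le_of_lt (by gcongr) hb
    have h2 : p * (nn E * (1 / p) + (θ - nn E) / p) < p * b := by gcongr
    have h3 : p * (nn E * (1 / p) + (θ - nn E) / p) = θ := by field_simp; ring
    linarith
  refine ⟨hpb, ?_⟩
  by_contra hneg
  nlinarith

lemma K3 [Nontrivial E] {p θ b : ℝ} (hp : 0 < p) (hθ : (nn E : ℝ) < θ)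
    (hb : nn E * max 1 (1 / p) + (θ - nn E) / p < b)
    {r : ℝ} (hr1 : r ≤ 1/2) {a : ℕ → E} {Ek : ℕ → Set E} {m M : ℝ≥0∞} (L : Lat μ r a Ek m M)
    (hm : m ≠ 0) (hM : M ≠ ∞) : ∃ C : ℝ≥0∞, C ≠ ∞ ∧ ∀ c : ℕ → ℝ≥0∞,
      ∫⁻ z, (∑' k, c k * atN (b - θ / p) b (a k) z) ^ p ∂(tb μ θ) ≤ C * ∑' k, c k ^ p := by
  have h0 : (0:ℝ) ≤ nn E := Nat.cast_nonneg _
  obtain ⟨hpb, hb0⟩ := hpb_of hp hθ hb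
  rcases lt_or_ge 1 p with hp1 | hp1
  · obtain ⟨C, hC, h⟩ := schur μ (p := p) (θ := θ) (b := b) hp1 hθ (by
      refine lt_of_le_of_lt ?_ hb
      gcongr
      nlinarith [le_max_left 1 (1 / p)])
    have hmt : m ≠ ∞ := fun hmt => hM (top_le_iff.1 (hmt ▸ (L.lower 0).trans (L.upper 0)))
    set D : ℝ≥0∞ := m⁻¹ * ENNReal.ofReal (27 ^ b) with hD
    have hDt : D ≠ ∞ := ENNReal.mul_ne_top (ENNReal.inv_ne_top.2 hm) ENNReal.ofReal_ne_top
    refine ⟨D ^ p * (C * (ENNReal.ofReal (9 ^ θ) * M)), ENNReal.mul_ne_top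
      (ENNReal.rpow_ne_top_of_nonneg hp.le hDt) (ENNReal.mul_ne_top hC
      (ENNReal.mul_ne_top ENNReal.ofReal_ne_top hM)), fun c => ?_⟩
    set d : ℕ → ℝ≥0∞ := fun k => ENNReal.ofReal (dl (a k) ^ (-(θ / p))) with hd
    set g : E → ℝ≥0∞ := fun w => ∑' k, (Ek k).indicator (fun _ => c k * d k) w with hg
    have gm : Measurable g := Measurable.ennreal_tsum (fun k => measurable_const.indicator (L.meas k))
    have ge : ∀ k, ∀ w ∈ Ek k, g w = c k * d k := by
      intro k w hw
      simp only [hg]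
      rw [tsum_eq_single k, Set.indicator_of_mem hw]
      intro j hj
      exact Set.indicator_of_notMem (fun hw' => (Set.disjoint_left.1 (L.disj hj) hw' hw)) _
    have I1 : ∀ z : E, ‖z‖ < 1 → ∑' k, c k * atN (b - θ / p) b (a k) z ≤ D * TT μ b g z := by
      intro z hz
      have : TT μ b g z = ∑' k, (c k * d k) *
          ∫⁻ w in Ek k, ENNReal.ofReal (dl w ^ b * ‖kk z w‖ ^ (-b)) ∂(tau μ) := by
        unfold TT
        rw [int_cells μ L]
        refine tsum_congr (fun k => ?_)
        rw [← lintegral_const_mul _ (measurable_ker b b z)]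
        refine setLIntegral_congr_fun (L.meas k) (fun w hw => ?_)
        rw [ge k w hw, mul_comm]
      rw [this, ← ENNReal.tsum_mul_left]
      refine ENNReal.tsum_le_tsum (fun k => ?_)
      have ha := L.mem k
      have da := dl_pos ha
      have dk := kk_norm_pos hz ha
      have key : ENNReal.ofReal (dl (a k) ^ b * ‖kk z (a k)‖ ^ (-b)) * m ≤ ENNReal.ofReal (27 ^ b) *
          ∫⁻ w in Ek k, ENNReal.ofReal (dl w ^ b * ‖kk z w‖ ^ (-b)) ∂(tau μ) := by
        calc _ ≤ ENNReal.ofReal (dl (a k) ^ b * ‖kk z (a k)‖ ^ (-b)) * tau μ (Ek k) := by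
              gcongr; exact L.lower k
          _ = ∫⁻ w in Ek k, ENNReal.ofReal (dl (a k) ^ b * ‖kk z (a k)‖ ^ (-b)) ∂(tau μ) := by
              rw [setLIntegral_const]
          _ ≤ ∫⁻ w in Ek k, ENNReal.ofReal (27 ^ b) * ENNReal.ofReal (dl w ^ b * ‖kk z w‖ ^ (-b)) ∂(tau μ) := by
              refine setLIntegral_mono' (L.meas k) (fun w hw => ?_)
              obtain ⟨hw1, hw2⟩ := L.sub k w hw
              have dw := dl_pos hw1
              have dkw := kk_norm_pos hz hw1
              rw [← ENNReal.ofReal_mul (by positivity)]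
              refine ENNReal.ofReal_le_ofReal ?_
              have e1 : dl (a k) ^ b ≤ 9 ^ b * dl w ^ b := by
                rw [← Real.mul_rpow (by norm_num) dw.le]
                exact Real.rpow_le_rpow da.le (dl_comp' ha hw1 (hw2.trans hr1)) hb0.le
              have e2 : ‖kk z (a k)‖ ^ (-b) ≤ 3 ^ b * ‖kk z w‖ ^ (-b) := by
                have := Real.rpow_le_rpow dkw.le (kk_comp ha hw1 hz (hw2.trans hr1)) hb0.le
                rw [Real.mul_rpow (by norm_num) dk.le] at this
                rw [Real.rpow_neg dk.le, Real.rpow_neg dkw.le, ← div_eq_mul_inv,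
                  le_div_iff₀ (by positivity), inv_mul_le_iff₀ (by positivity)]
                linarith
              calc _ ≤ (9 ^ b * dl w ^ b) * (3 ^ b * ‖kk z w‖ ^ (-b)) := by gcongr
                _ = (9 * 3) ^ b * (dl w ^ b * ‖kk z w‖ ^ (-b)) := by
                  rw [Real.mul_rpow (by norm_num) (by norm_num)]; ring
                _ = _ := by norm_num
          _ = _ := lintegral_const_mul _ (measurable_ker b b z)
      have at1 : atN (b - θ / p) b (a k) z = d k * ENNReal.ofReal (dl (a k) ^ b * ‖kk z (a k)‖ ^ (-b)) := by
        simp only [atN, hd]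
        rw [← ENNReal.ofReal_mul (by positivity), ← mul_assoc, ← Real.rpow_add da]
        congr 3; ring
      rw [at1, hD]
      calc _ = (c k * d k * m⁻¹) * (ENNReal.ofReal (dl (a k) ^ b * ‖kk z (a k)‖ ^ (-b)) * m) := by
            rw [show (c k * d k * m⁻¹) * (ENNReal.ofReal (dl (a k) ^ b * ‖kk z (a k)‖ ^ (-b)) * m)
              = (m⁻¹ * m) * (c k * (d k * ENNReal.ofReal (dl (a k) ^ b * ‖kk z (a k)‖ ^ (-b)))) by ring,
              ENNReal.inv_mul_cancel hm hmt, one_mul]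
        _ ≤ (c k * d k * m⁻¹) * _ := mul_le_mul_right key _
        _ = _ := by ring
    have I2 : ∫⁻ z, g z ^ p ∂(tb μ θ) ≤ (ENNReal.ofReal (9 ^ θ) * M) * ∑' k, c k ^ p := by
      rw [lintegral_tb, int_cells μ L, ← ENNReal.tsum_mul_left]
      refine ENNReal.tsum_le_tsum (fun k => ?_)
      have ha := L.mem k
      have da := dl_pos ha
      calc _ ≤ ∫⁻ w in Ek k, ENNReal.ofReal (9 ^ θ) * c k ^ p ∂(tau μ) := by
            refine setLIntegral_mono' (L.meas k) (fun w hw => ?_)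
            obtain ⟨hw1, hw2⟩ := L.sub k w hw
            have dw := dl_pos hw1
            rw [ge k w hw, ENNReal.mul_rpow_of_nonneg _ _ hp.le, hd]
            simp only []
            rw [ENNReal.ofReal_rpow_of_nonneg (by positivity) hp.le, ← Real.rpow_mul da.le]
            calc _ = (ENNReal.ofReal (dl w ^ θ) * ENNReal.ofReal (dl (a k) ^ (-(θ / p) * p))) * c k ^ p := by ring
              _ ≤ _ := by
                gcongr
                rw [← ENNReal.ofReal_mul (by positivity)]
                refine ENNReal.ofReal_le_ofReal ?_
                have e1 : dl w ^ θ ≤ 9 ^ θ * dl (a k) ^ θ := by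
                  rw [← Real.mul_rpow (by norm_num) da.le]
                  exact Real.rpow_le_rpow dw.le (dl_comp ha hw1 (hw2.trans hr1)) (by linarith)
                calc _ ≤ (9 ^ θ * dl (a k) ^ θ) * (dl (a k) ^ (-(θ / p) * p)) := by gcongr
                  _ = _ := by
                    rw [mul_assoc, ← Real.rpow_add da, show θ + -(θ / p) * p = 0 by field_simp; ring]
                    simp
        _ = ENNReal.ofReal (9 ^ θ) * c k ^ p * tau μ (Ek k) := by rw [setLIntegral_const]
        _ ≤ ENNReal.ofReal (9 ^ θ) * c k ^ p * M := by gcongr; exact L.upper k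
        _ = _ := by ring
    calc _ ≤ ∫⁻ z, D ^ p * (TT μ b g z) ^ p ∂(tb μ θ) := by
          refine lintegral_mono_ae ?_
          filter_upwards [ae_tb μ θ] with z hz
          rw [← ENNReal.mul_rpow_of_nonneg _ _ hp.le]
          exact ENNReal.rpow_le_rpow (I1 z hz) hp.le
      _ = D ^ p * ∫⁻ z, (TT μ b g z) ^ p ∂(tb μ θ) := by
          rw [lintegral_const_mul' _ _ (ENNReal.rpow_ne_top_of_nonneg hp.le hDt)]
      _ ≤ D ^ p * (C * ((ENNReal.ofReal (9 ^ θ) * M) * ∑' k, c k ^ p)) := by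
          gcongr
          exact (h g gm).trans (by gcongr)
      _ = _ := by ring
  · obtain ⟨C, hC, h⟩ := FR μ (t := θ) (c := p * b) hθ hpb
    refine ⟨ENNReal.ofReal C, ENNReal.ofReal_ne_top, fun c => ?_⟩
    calc _ ≤ ∫⁻ z, ∑' k, (c k * atN (b - θ / p) b (a k) z) ^ p ∂(tb μ θ) :=
          lintegral_mono (fun z => tsum_rpow_le hp hp1 _)
      _ = ∑' k, ∫⁻ z, (c k * atN (b - θ / p) b (a k) z) ^ p ∂(tb μ θ) :=
          lintegral_tsum (fun k => (((measurable_atN _ _ _).const_mul _).pow_const _).aemeasurable)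
      _ ≤ _ := by
        rw [← ENNReal.tsum_mul_left]
        refine ENNReal.tsum_le_tsum (fun k => ?_)
        have ha := L.mem k
        have da := dl_pos ha
        rw [lintegral_tb]
        calc _ = ∫⁻ z, (c k ^ p * ENNReal.ofReal (dl (a k) ^ (p * b - θ))) *
              ENNReal.ofReal (dl z ^ θ * ‖kk (a k) z‖ ^ (-(p * b))) ∂(tau μ) := by
              refine lintegral_congr_ae ?_
              filter_upwards [ae_tau μ] with z hz
              have dz := dl_pos hz
              have dk := kk_norm_pos hz ha
              rw [ENNReal.mul_rpow_of_nonneg _ _ hp.le, atN,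
                ENNReal.ofReal_rpow_of_nonneg (by positivity) hp.le,
                Real.mul_rpow (by positivity) (by positivity), ← Real.rpow_mul da.le, ← Real.rpow_mul dk.le,
                kk_norm_symm (a k) z, ENNReal.ofReal_mul (by positivity), ENNReal.ofReal_mul (by positivity),
                show (b - θ / p) * p = p * b - θ by field_simp, show -b * p = -(p * b) by ring]
              ring
          _ = (c k ^ p * ENNReal.ofReal (dl (a k) ^ (p * b - θ))) * LL μ θ (p * b) (a k) := by
              unfold LL
              rw [lintegral_const_mul _ (measurable_ker _ _ _)]
          _ ≤ (c k ^ p * ENNReal.ofReal (dl (a k) ^ (p * b - θ))) * ENNReal.ofReal (C * dl (a k) ^ (θ - p * b)) := by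
              gcongr
              exact h _ ha
          _ = _ := by
              rw [mul_assoc, ← ENNReal.ofReal_mul (by positivity), mul_comm]
              congr 2
              rw [mul_left_comm, ← Real.rpow_add da]
              simp

lemma K2 [Nontrivial E] {p θ b : ℝ} (hp : 0 < p) (hθ : (nn E : ℝ) < θ)
    (hb : nn E * max 1 (1 / p) + (θ - nn E) / p < b)
    {r : ℝ} (hr1 : r ≤ 1/2) {a : ℕ → E} {Ek : ℕ → Set E} {m M : ℝ≥0∞} (L : Lat μ r a Ek m M)
    (hm : m ≠ 0) (hM : M ≠ ∞) : ∃ C : ℝ≥0∞, C ≠ ∞ ∧ ∀ f : E → ℂ, DifferentiableOn ℂ f (BB E) →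
      ∑' k, (ENNReal.ofReal (dl (a k) ^ (-(b - θ / p))) *
        ∫⁻ w in Ek k, ENNReal.ofReal (dl w ^ b) * ‖f w‖ₑ ∂(tau μ)) ^ p
        ≤ C * ∫⁻ z, ‖f z‖ₑ ^ p ∂(tb μ θ) := by
  have h0 : (0:ℝ) ≤ nn E := Nat.cast_nonneg _
  obtain ⟨hpb, hb0⟩ := hpb_of hp hθ hb
  obtain ⟨C, hC, h⟩ := K1 μ hp hθ hb
  have hmt : m ≠ ∞ := fun hmt => hM (top_le_iff.1 (hmt ▸ (L.lower 0).trans (L.upper 0)))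
  set D : ℝ≥0∞ := ENNReal.ofReal (9 ^ (-(b * p) - θ)) * m with hD
  have hD0 : D ≠ 0 := mul_ne_zero (by simp; positivity) hm
  have hDt : D ≠ ∞ := ENNReal.mul_ne_top ENNReal.ofReal_ne_top hmt
  refine ⟨D⁻¹ * C, ENNReal.mul_ne_top (ENNReal.inv_ne_top.2 hD0) hC, fun f hf => ?_⟩
  rw [mul_assoc]
  refine le_trans ?_ (mul_le_mul_right (h f hf) _)
  rw [mul_comm D⁻¹, ← div_eq_mul_inv, ENNReal.le_div_iff_mul_le (Or.inl hD0) (Or.inl hDt), mul_comm _ D, lintegral_tb, int_cells μ L, ← ENNReal.tsum_mul_left]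
  refine ENNReal.tsum_le_tsum (fun k => ?_)
  have ha := L.mem k
  have da := dl_pos ha
  set A := ENNReal.ofReal (dl (a k) ^ (-(b - θ / p))) *
        ∫⁻ w in Ek k, ENNReal.ofReal (dl w ^ b) * ‖f w‖ₑ ∂(tau μ) with hA
  have P1 : ∀ y ∈ Ek k, ENNReal.ofReal (9 ^ (-b) * dl (a k) ^ (-(θ / p))) * A ≤
      TT μ b (fun w => ‖f w‖ₑ) y := by
    intro y hy
    obtain ⟨hy1, hy2⟩ := L.sub k y hy
    calc _ = ENNReal.ofReal (9 ^ (-b) * dl (a k) ^ (-b)) *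
          ∫⁻ w in Ek k, ENNReal.ofReal (dl w ^ b) * ‖f w‖ₑ ∂(tau μ) := by
          rw [hA, ← mul_assoc, ← ENNReal.ofReal_mul (by positivity), mul_assoc, ← Real.rpow_add da]
          congr 4; ring
      _ = ∫⁻ w in Ek k, ENNReal.ofReal (9 ^ (-b) * dl (a k) ^ (-b)) * 
            (ENNReal.ofReal (dl w ^ b) * ‖f w‖ₑ) ∂(tau μ) := by
          rw [lintegral_const_mul' _ _ ENNReal.ofReal_ne_top]
      _ ≤ ∫⁻ w in Ek k, ENNReal.ofReal (dl w ^ b * ‖kk y w‖ ^ (-b)) * ‖f w‖ₑ ∂(tau μ) := by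
          refine setLIntegral_mono' (L.meas k) (fun w hw => ?_)
          obtain ⟨hw1, hw2⟩ := L.sub k w hw
          have dw := dl_pos hw1
          have dkw := kk_norm_pos hy1 hw1
          rw [← mul_assoc]
          gcongr
          rw [← ENNReal.ofReal_mul (by positivity)]
          refine ENNReal.ofReal_le_ofReal ?_
          have e1 : ‖kk y w‖ ≤ 9 * dl (a k) := by
            have e2 := kk_comp ha hw1 hy1 (hw2.trans hr1)
            have e3 := kk_comp ha hy1 ha (hy2.trans hr1)
            rw [kk_self_norm ha] at e3
            rw [kk_norm_symm] at e3
            linarith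
          have e4 : (9 * dl (a k)) ^ (-b) ≤ ‖kk y w‖ ^ (-b) :=
            Real.rpow_le_rpow_of_nonpos dkw e1 (by linarith)
          rw [Real.mul_rpow (by norm_num) da.le] at e4
          rw [mul_comm]
          gcongr
      _ ≤ _ := by
          unfold TT
          exact setLIntegral_le_lintegral _ _
  clear_value A
  calc D * A ^ p ≤ ENNReal.ofReal (9 ^ (-(b * p) - θ)) * A ^ p * tau μ (Ek k) := by
        rw [hD]
        calc _ = ENNReal.ofReal (9 ^ (-(b * p) - θ)) * A ^ p * m := by ring
          _ ≤ _ := by gcongr; exact L.lower k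
    _ = ∫⁻ y in Ek k, ENNReal.ofReal (9 ^ (-(b * p) - θ)) * A ^ p ∂(tau μ) := by rw [setLIntegral_const]
    _ ≤ _ := by
      refine setLIntegral_mono' (L.meas k) (fun y hy => ?_)
      obtain ⟨hy1, hy2⟩ := L.sub k y hy
      have dy := dl_pos hy1
      have e1 : 9 ^ (-θ) * dl (a k) ^ θ ≤ dl y ^ θ := by
        have := Real.rpow_le_rpow da.le (dl_comp' ha hy1 (hy2.trans hr1)) (z := θ) (by linarith)
        rw [Real.mul_rpow (by norm_num) dy.le] at this
        rw [Real.rpow_neg (by norm_num), inv_mul_le_iff₀ (by positivity)]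
        exact this
      calc _ = ENNReal.ofReal (9 ^ (-θ) * dl (a k) ^ θ) *
            (ENNReal.ofReal (9 ^ (-b) * dl (a k) ^ (-(θ / p))) * A) ^ p := by
            rw [ENNReal.mul_rpow_of_nonneg _ _ hp.le, ENNReal.ofReal_rpow_of_nonneg (by positivity) hp.le,
              ← mul_assoc, ← ENNReal.ofReal_mul (by positivity), Real.mul_rpow (by positivity) (by positivity),
              ← Real.rpow_mul (by norm_num), ← Real.rpow_mul da.le]
            congr 2
            calc (9:ℝ) ^ (-(b * p) - θ) = 9 ^ (-θ + -b * p) * dl (a k) ^ (θ + -(θ / p) * p) := by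
                  rw [show θ + -(θ / p) * p = 0 by field_simp; ring, Real.rpow_zero, mul_one]
                  congr 1; ring
              _ = _ := by
                  rw [Real.rpow_add (by norm_num), Real.rpow_add da]; ring
        _ ≤ _ := by
            gcongr
            exact P1 y hy

end K23
end CR

namespace CR
section contr
variable {E : Type*} [NormedAddCommGroup E] [InnerProductSpace ℂ E] [FiniteDimensional ℂ E]
  [MeasurableSpace E] [BorelSpace E] (μ : Measure E) [μ.IsAddHaarMeasure]

lemma ker_bd {z z0 w : E} (hz : ‖z‖ < 1) (hz0 : ‖z0‖ < 1) (hw : ‖w‖ < 1) {b : ℝ} (hb : 0 ≤ b) :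
    ‖kk z w‖ ^ (-b) ≤ ((1 - ‖z‖) / 2) ^ (-b) * ‖kk z0 w‖ ^ (-b) := by
  have h1 := kk_norm_ge z w hw
  have h2 := kk_norm_le hz0 hw
  have h3 := kk_norm_pos hz0 hw
  have h4 : 0 < (1 - ‖z‖) / 2 := by linarith
  rw [← Real.mul_rpow h4.le h3.le]
  refine Real.rpow_le_rpow_of_nonpos (by positivity) ?_ (by linarith)
  nlinarith

lemma TT_bd {z z0 : E} (hz : ‖z‖ < 1) (hz0 : ‖z0‖ < 1) {b : ℝ} (hb : 0 ≤ b) (g : E → ℝ≥0∞) :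
    TT μ b g z ≤ ENNReal.ofReal (((1 - ‖z‖) / 2) ^ (-b)) * TT μ b g z0 := by
  unfold TT
  rw [← lintegral_const_mul' _ _ ENNReal.ofReal_ne_top]
  refine lintegral_mono_ae ?_
  filter_upwards [ae_tau μ] with w hw
  have dw := dl_pos hw
  have h4 : 0 < (1 - ‖z‖) / 2 := by linarith
  rw [← mul_assoc, ← ENNReal.ofReal_mul (by positivity)]
  refine mul_le_mul_left (ENNReal.ofReal_le_ofReal ?_) _
  have := ker_bd hz hz0 hw hb
  calc _ ≤ dl w ^ b * (((1 - ‖z‖) / 2) ^ (-b) * ‖kk z0 w‖ ^ (-b)) := by gcongr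
    _ = _ := by ring

lemma atN_bd {z z0 a : E} (hz : ‖z‖ < 1) (hz0 : ‖z0‖ < 1) (ha : ‖a‖ < 1) {b : ℝ} (hb : 0 ≤ b) (s : ℝ) :
    atN s b a z ≤ ENNReal.ofReal (((1 - ‖z‖) / 2) ^ (-b)) * atN s b a z0 := by
  unfold atN
  have dw := dl_pos ha
  have h4 : 0 < (1 - ‖z‖) / 2 := by linarith
  rw [← ENNReal.ofReal_mul (by positivity)]
  refine ENNReal.ofReal_le_ofReal ?_
  have := ker_bd hz hz0 ha hb
  calc _ ≤ dl a ^ s * (((1 - ‖z‖) / 2) ^ (-b) * ‖kk z0 a‖ ^ (-b)) := by gcongr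
    _ = _ := by ring

lemma tb_univ_ne (t : ℝ) : tb μ t Set.univ ≠ 0 := by
  intro h
  have h1 : tau μ ≪ tb μ t := by
    refine withDensity_absolutelyContinuous' (measurable_dl_rpow _).aemeasurable ?_
    filter_upwards [ae_tau μ] with w hw
    have := dl_pos hw
    simp only [ne_eq, ENNReal.ofReal_eq_zero, not_le]
    positivity
  have h2 := h1 h
  have h3 := tau_ball_pos μ (E := E) (r := 1) one_pos le_rfl
  exact absurd (measure_mono_null (Set.subset_univ _) h2) h3.ne'

lemma pt_bd {p : ℝ} (hp : 0 < p) (t : ℝ) {F : E → ℝ≥0∞} {C : ℝ≥0∞} (hC : C ≠ ∞) {z : E}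
    (h : ∀ z0, ‖z0‖ < 1 → F z ≤ C * F z0) :
    F z ^ p * tb μ t Set.univ ≤ C ^ p * ∫⁻ y, F y ^ p ∂(tb μ t) := by
  rw [← lintegral_const_mul' _ _ (ENNReal.rpow_ne_top_of_nonneg hp.le hC), ← lintegral_const]
  refine lintegral_mono_ae ?_
  filter_upwards [ae_tb μ t] with y hy
  rw [← ENNReal.mul_rpow_of_nonneg _ _ hp.le]
  exact ENNReal.rpow_le_rpow (h y hy) hp.le

lemma pt_fin {p : ℝ} (hp : 0 < p) (t : ℝ) {F : E → ℝ≥0∞} {C : ℝ≥0∞} (hC : C ≠ ∞) {z : E}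
    (h : ∀ z0, ‖z0‖ < 1 → F z ≤ C * F z0) (hF : ∫⁻ y, F y ^ p ∂(tb μ t) ≠ ∞) : F z ≠ ∞ := by
  intro hz
  have := pt_bd μ hp t hC h
  rw [hz, ENNReal.top_rpow_of_pos hp, ENNReal.top_mul (tb_univ_ne μ t), top_le_iff] at this
  exact ENNReal.mul_ne_top (ENNReal.rpow_ne_top_of_nonneg hp.le hC) hF this

lemma num_id {D d b : ℝ} (hD : 0 < D) (hd : 0 < d) {y : ℂ} (hy : 0 < y.re) :
    (((D * d / ‖y‖ ^ 2) ^ b : ℝ) : ℂ) * ((D : ℂ) / y) ^ ((-b : ℝ) : ℂ) =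
      ((d ^ b : ℝ) : ℂ) * (starRingEnd ℂ y) ^ ((-b : ℝ) : ℂ) := by
  have y0 : y ≠ 0 := by rintro rfl; simp at hy
  have ny : 0 < ‖y‖ := norm_pos_iff.2 y0
  have harg : y.arg ≠ Real.pi := by
    have := Complex.abs_arg_lt_pi_div_two_iff.2 (Or.inl hy)
    intro h
    rw [h, abs_of_pos Real.pi_pos] at this
    linarith [Real.pi_pos]
  have e1 : Complex.log ((D:ℂ) / y) = (Real.log D : ℂ) - Complex.log y := by
    rw [div_eq_mul_inv, Complex.log_ofReal_mul hD (inv_ne_zero y0), Complex.log_inv _ harg]; ring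
  have e2 : Complex.log (starRingEnd ℂ y) = starRingEnd ℂ (Complex.log y) := Complex.log_conj _ harg
  have e3 : Complex.log y = (Real.log ‖y‖ : ℂ) + (y.arg : ℂ) * Complex.I := rfl
  rw [Complex.cpow_def_of_ne_zero (div_ne_zero (by exact_mod_cast hD.ne') y0),
    Complex.cpow_def_of_ne_zero (by simpa using y0), e1, e2, Real.rpow_def_of_pos (by positivity),
    Real.rpow_def_of_pos hd, Complex.ofReal_exp, Complex.ofReal_exp, ← Complex.exp_add, ← Complex.exp_add,
    Real.log_div (by positivity) (by positivity), Real.log_mul hD.ne' hd.ne', Real.log_pow, e3]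
  congr 1
  simp only [map_add, map_mul, Complex.conj_ofReal, Complex.conj_I]
  push_cast
  ring

lemma repro [Nontrivial E] {b : ℝ} (hb : (nn E : ℝ) < b) {f : E → ℂ} (hf : DifferentiableOn ℂ f (BB E))
    {z : E} (hz : ‖z‖ < 1) (hT : TT μ b (fun w => ‖f w‖ₑ) z ≠ ∞) :
    Integrable (fun w => ((dl w ^ b : ℝ) : ℂ) * (f w * kk z w ^ ((-b : ℝ) : ℂ))) (tau μ) ∧
    ∫ w, ((dl w ^ b : ℝ) : ℂ) * (f w * kk z w ^ ((-b : ℝ) : ℂ)) ∂(tau μ) =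
      (((tb μ b).real Set.univ : ℝ) : ℂ) * f z := by
  haveI := isFinite_tb μ hb
  set G : E → ℂ := fun w => ((dl w ^ b : ℝ) : ℂ) * (f w * kk z w ^ ((-b : ℝ) : ℂ)) with hG
  have Gc : ContinuousOn G (BB E) := by
    intro w hw
    have hw1 := mem_ball.1 hw
    have dw := dl_pos hw1
    refine ContinuousWithinAt.mul ?_ ((hf.continuousOn w hw).mul ?_)
    · refine ContinuousAt.continuousWithinAt ?_
      refine Complex.continuous_ofReal.continuousAt.comp ?_
      exact continuous_dl.continuousAt.rpow_const (Or.inl dw.ne')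
    · refine ContinuousAt.continuousWithinAt ?_
      refine ContinuousAt.cpow (continuous_kk_right z).continuousAt continuousAt_const ?_
      exact Or.inl (kk_re_pos hz hw1)
  have Gm : AEStronglyMeasurable G (tau μ) := (aem_tau μ Gc).aestronglyMeasurable
  have Gi : Integrable G (tau μ) := by
    refine ⟨Gm, ?_⟩
    unfold HasFiniteIntegral
    refine lt_of_eq_of_lt ?_ hT.lt_top
    unfold TT
    refine lintegral_congr_ae ?_
    filter_upwards [ae_tau μ] with w hw
    have dw := dl_pos hw
    simp only [hG]
    rw [enorm_mul, enorm_mul, ENNReal.ofReal_mul (by positivity), ← ofReal_norm_eq_enorm,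
      ← ofReal_norm_eq_enorm (kk z w ^ _), norm_kkpow hz hw, Complex.norm_real, Real.norm_of_nonneg (by positivity)]
    ring
  refine ⟨Gi, ?_⟩
  set h : E → ℂ := fun u => f (mob z u) * kk u z ^ ((-b : ℝ) : ℂ) with hh
  have key : ∀ u : E, ‖u‖ < 1 → G (mob z u) = (ENNReal.ofReal (dl u ^ b)).toReal • h u := by
    intro u hu
    have du := dl_pos hu
    have dz := dl_pos hz
    have e1 : kk z (mob z u) = (dl z : ℂ) / kk z u := by
      rw [← kk_conj, kk_mob_a hz hu, map_div₀, Complex.conj_ofReal, kk_conj]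
    have := num_id (b := b) dz du (kk_re_pos hz hu)
    simp only [hG, hh]
    rw [ENNReal.toReal_ofReal (by positivity), e1, dl_mob hz hu, kk_norm_symm u z, ← kk_conj z u,
      Complex.real_smul]
    linear_combination (f (mob z u)) * this
  have hd : DifferentiableOn ℂ h (BB E) := by
    refine DifferentiableOn.mul ?_ (diff_kkpow hz _)
    intro u hu
    have hu1 := mem_ball.1 hu
    have h1 : DifferentiableAt ℂ f (mob z u) :=
      (hf _ (mem_ball.2 (mob_mem hz hu1))).differentiableAt (Metric.isOpen_ball.mem_nhds (mem_ball.2 (mob_mem hz hu1)))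
    exact (h1.comp u (hasFDerivAt_mob hz hu1).differentiableAt).differentiableWithinAt
  have Gi2 : Integrable (G ∘ mob z) (tau μ) := ((mp_mob μ hz).integrable_comp Gm).2 Gi
  have ae1 : (G ∘ mob z) =ᵐ[tau μ] (fun u => (ENNReal.ofReal (dl u ^ b)).toReal • h u) := by
    filter_upwards [ae_tau μ] with u hu
    exact key u hu
  have hi : Integrable h (tb μ b) := by
    unfold tb
    rw [integrable_withDensity_iff_integrable_smul' (measurable_dl_rpow _) (by simp)]
    exact Gi2.congr ae1
  have mv := mean_value (rotInv_tb μ b) (ae_tb μ b) hd hi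
  have h0 : h 0 = f z := by simp [hh, mob_zero, kk]
  rw [h0, Complex.real_smul] at mv
  rw [← mv]
  unfold tb
  rw [integral_withDensity_eq_integral_toReal_smul (measurable_dl_rpow _) (by simp),
    ← integral_congr_ae ae1]
  have := integral_map (μ := tau μ) (mp_mob μ hz).measurable.aemeasurable (f := G)
    (by rw [(mp_mob μ hz).map_eq]; exact Gm)
  rw [(mp_mob μ hz).map_eq] at this
  exact this

lemma cpow_close {b η : ℝ} (hη : 0 < η) : ∃ r : ℝ, 0 < r ∧ r ≤ 1/2 ∧ ∀ a w z : E, ‖a‖ < 1 → ‖w‖ < 1 →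
    ‖z‖ < 1 → ‖mob a w‖ ≤ r →
    ‖kk z w ^ ((-b : ℝ) : ℂ) - kk z a ^ ((-b : ℝ) : ℂ)‖ ≤ η * ‖kk z w‖ ^ (-b) := by
  have hc : ContinuousAt (fun v : ℂ => (v⁻¹) ^ ((-b : ℝ) : ℂ)) 1 := by
    refine ContinuousAt.cpow (continuousAt_inv₀ one_ne_zero) continuousAt_const ?_
    left; simp
  obtain ⟨δ, hδ, h⟩ := Metric.continuousAt_iff.1 hc η hη
  refine ⟨min (δ / 8) (1/8), by positivity, (min_le_right _ _).trans (by norm_num), ?_⟩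
  intro a w z ha hw hz haw
  set r := min (δ / 8) (1/8) with hr
  have hr0 : 0 < r := by positivity
  have hr1 : r ≤ 1/8 := min_le_right _ _
  have hr2 : r ≤ δ/8 := min_le_left _ _
  have h1 := ratio ha hw hz (by linarith) haw
  have h2 : 2 * r / (1 - r) ≤ 4 * r := by
    rw [div_le_iff₀ (by linarith)]; nlinarith
  set x := kk z w with hx
  set y := kk z a with hy
  have x0 : x ≠ 0 := kk_ne hz hw
  have y0 : y ≠ 0 := kk_ne hz ha
  have xr : 0 < x.re := kk_re_pos hz hw
  set v := x / y with hv
  have hv1 : ‖v - 1‖ ≤ 4 * r := h1.trans h2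
  have v0 : v ≠ 0 := div_ne_zero x0 y0
  have h3 := h (x := v) (by rw [dist_eq_norm]; linarith)
  rw [dist_eq_norm] at h3
  simp only [inv_one, Complex.one_cpow] at h3
  have vre : 0 < v.re := by
    have := (Complex.abs_re_le_norm (v - 1)).trans hv1
    rw [abs_le] at this
    simp only [Complex.sub_re, Complex.one_re] at this
    linarith
  have uim : 0 < (v⁻¹).re := by
    rw [Complex.inv_re]
    exact div_pos vre (Complex.normSq_pos.2 v0)
  have yx : y = x * v⁻¹ := by rw [hv]; field_simp
  have a1 := abs_lt.1 (Complex.abs_arg_lt_pi_div_two_iff.2 (Or.inl xr))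
  have a2 := abs_lt.1 (Complex.abs_arg_lt_pi_div_two_iff.2 (Or.inl uim))
  have e : y ^ ((-b : ℝ) : ℂ) = x ^ ((-b : ℝ) : ℂ) * (v⁻¹) ^ ((-b : ℝ) : ℂ) := by
    rw [yx, Complex.cpow_def_of_ne_zero (mul_ne_zero x0 (inv_ne_zero v0)), Complex.cpow_def_of_ne_zero x0,
      Complex.cpow_def_of_ne_zero (inv_ne_zero v0), Complex.log_mul x0 (inv_ne_zero v0), ← Complex.exp_add]
    · congr 1; ring
    · constructor <;> linarith
  rw [e, show x ^ ((-b : ℝ) : ℂ) - x ^ ((-b : ℝ) : ℂ) * (v⁻¹) ^ ((-b : ℝ) : ℂ)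
    = x ^ ((-b : ℝ) : ℂ) * (1 - (v⁻¹) ^ ((-b : ℝ) : ℂ)) by ring, norm_mul, norm_kkpow hz hw, mul_comm, norm_sub_rev]
  gcongr

def atom (s b : ℝ) (a z : E) : ℂ := ((dl a ^ s : ℝ) : ℂ) * kk z a ^ ((-b : ℝ) : ℂ)

lemma enorm_atom {a z : E} (ha : ‖a‖ < 1) (hz : ‖z‖ < 1) (s b : ℝ) : ‖atom s b a z‖ₑ = atN s b a z := by
  have := dl_pos ha
  unfold atom atN
  rw [← ofReal_norm_eq_enorm, norm_mul, norm_kkpow hz ha, Complex.norm_real, Real.norm_of_nonneg (by positivity)]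

lemma step [Nontrivial E] {b : ℝ} (hb : (nn E : ℝ) < b) (s : ℝ) {η r : ℝ} (hη : 0 < η)
    (hr : ∀ a w z : E, ‖a‖ < 1 → ‖w‖ < 1 → ‖z‖ < 1 → ‖mob a w‖ ≤ r →
      ‖kk z w ^ ((-b : ℝ) : ℂ) - kk z a ^ ((-b : ℝ) : ℂ)‖ ≤ η * ‖kk z w‖ ^ (-b))
    {a : ℕ → E} {Ek : ℕ → Set E} {m M : ℝ≥0∞} (L : Lat μ r a Ek m M)
    {f : E → ℂ} (hf : DifferentiableOn ℂ f (BB E))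
    (hT : ∀ z, ‖z‖ < 1 → TT μ b (fun w => ‖f w‖ₑ) z ≠ ∞) :
    ∃ c : ℕ → ℂ, (∀ k, ‖c k‖ₑ ≤ ENNReal.ofReal ((tb μ b).real Set.univ)⁻¹ *
        (ENNReal.ofReal (dl (a k) ^ (-s)) * ∫⁻ w in Ek k, ENNReal.ofReal (dl w ^ b) * ‖f w‖ₑ ∂(tau μ))) ∧
      ∀ z, ‖z‖ < 1 → Summable (fun k => c k * atom s b (a k) z) ∧
        ‖f z - ∑' k, c k * atom s b (a k) z‖ₑ ≤
          ENNReal.ofReal (((tb μ b).real Set.univ)⁻¹ * η) * TT μ b (fun w => ‖f w‖ₑ) z := by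
  haveI := isFinite_tb μ hb
  set κ := (tb μ b).real Set.univ with hκ
  have κ0 : 0 < κ := ENNReal.toReal_pos (tb_univ_ne μ b) (measure_ne_top _ _)
  have κc : (κ : ℂ) ≠ 0 := by exact_mod_cast κ0.ne'
  refine ⟨fun k => ((κ⁻¹ * dl (a k) ^ (-s) : ℝ) : ℂ) * ∫ w in Ek k, ((dl w ^ b : ℝ) : ℂ) * f w ∂(tau μ), ?_, ?_⟩
  · intro k
    have ha := L.mem k
    have da := dl_pos ha
    rw [enorm_mul, ← ofReal_norm_eq_enorm (((κ⁻¹ * dl (a k) ^ (-s) : ℝ) : ℂ)), Complex.norm_real,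
      Real.norm_of_nonneg (by positivity), ENNReal.ofReal_mul (by positivity), mul_assoc]
    gcongr
    refine (enorm_integral_le_lintegral_enorm _).trans (le_of_eq ?_)
    refine setLIntegral_congr_fun (L.meas k) (fun w hw => ?_)
    obtain ⟨hw1, hw2⟩ := L.sub k w hw
    have dw := dl_pos hw1
    rw [enorm_mul, ← ofReal_norm_eq_enorm (((dl w ^ b : ℝ) : ℂ)), Complex.norm_real,
      Real.norm_of_nonneg (by positivity)]
  · intro z hz
    obtain ⟨Gi, Ge⟩ := repro μ hb hf hz (hT z hz)
    obtain ⟨G0i, -⟩ := repro μ hb hf (z := 0) (by simp) (hT 0 (by simp))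
    have G0i' : Integrable (fun w => ((dl w ^ b : ℝ) : ℂ) * f w) (tau μ) := by
      refine G0i.congr (Eventually.of_forall (fun w => ?_))
      simp [kk]
    have hU : (tau μ).restrict (⋃ k, Ek k) = tau μ := by
      refine Measure.restrict_eq_self_of_ae_mem ?_
      filter_upwards [ae_tau μ] with w hw
      exact Set.mem_iUnion.2 (L.cover w hw)
    have S1 := hasSum_integral_iUnion L.meas L.disj (Gi.integrableOn (s := ⋃ k, Ek k))
    rw [hU, Ge] at S1
    set I : ℕ → ℂ := fun k => ∫ w in Ek k, ((dl w ^ b : ℝ) : ℂ) * (f w * kk z w ^ ((-b : ℝ) : ℂ)) ∂(tau μ) with hI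
    set J : ℕ → ℂ := fun k => ∫ w in Ek k, ((dl w ^ b : ℝ) : ℂ) * f w * kk z (a k) ^ ((-b : ℝ) : ℂ) ∂(tau μ) with hJ
    have D1 : ∀ k, ‖I k - J k‖ₑ ≤ ENNReal.ofReal η *
        ∫⁻ w in Ek k, ENNReal.ofReal (dl w ^ b * ‖kk z w‖ ^ (-b)) * ‖f w‖ₑ ∂(tau μ) := by
      intro k
      rw [hI, hJ]
      simp only []
      rw [← integral_sub Gi.integrableOn (G0i'.mul_const _).integrableOn,
        ← lintegral_const_mul' _ _ ENNReal.ofReal_ne_top]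
      refine (enorm_integral_le_lintegral_enorm _).trans ?_
      refine setLIntegral_mono' (L.meas k) (fun w hw => ?_)
      obtain ⟨hw1, hw2⟩ := L.sub k w hw
      have dw := dl_pos hw1
      rw [show ((dl w ^ b : ℝ) : ℂ) * (f w * kk z w ^ ((-b : ℝ) : ℂ)) - ((dl w ^ b : ℝ) : ℂ) * f w * kk z (a k) ^ ((-b : ℝ) : ℂ)
        = ((dl w ^ b : ℝ) : ℂ) * (kk z w ^ ((-b : ℝ) : ℂ) - kk z (a k) ^ ((-b : ℝ) : ℂ)) * f w by ring,
        enorm_mul, ← mul_assoc]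
      gcongr
      rw [← ofReal_norm_eq_enorm, ← ENNReal.ofReal_mul (by positivity), norm_mul, Complex.norm_real,
        Real.norm_of_nonneg (by positivity)]
      refine ENNReal.ofReal_le_ofReal ?_
      have := hr (a k) w z (L.mem k) hw1 hz hw2
      calc _ ≤ dl w ^ b * (η * ‖kk z w‖ ^ (-b)) := by gcongr
        _ = _ := by ring
    have D2 : ∑' k, ‖I k - J k‖ₑ ≤ ENNReal.ofReal η * TT μ b (fun w => ‖f w‖ₑ) z := by
      refine (ENNReal.tsum_le_tsum D1).trans ?_
      rw [ENNReal.tsum_mul_left]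
      unfold TT
      rw [int_cells μ L]
    have D3 : Summable (fun k => I k - J k) :=
      Summable.of_enorm (ne_top_of_le_ne_top (ENNReal.mul_ne_top ENNReal.ofReal_ne_top (hT z hz)) D2)
    have S2 : HasSum J (κ * f z - ∑' k, (I k - J k)) := by
      have := S1.sub D3.hasSum
      refine this.congr_fun ?_
      intro k; simp only [hI]; ring
    have S3 : HasSum (fun k => (((κ⁻¹ * dl (a k) ^ (-s) : ℝ) : ℂ) * ∫ w in Ek k, ((dl w ^ b : ℝ) : ℂ) * f w ∂(tau μ)) *
        atom s b (a k) z) ((κ : ℂ)⁻¹ * (κ * f z - ∑' k, (I k - J k))) := by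
      refine (S2.mul_left ((κ : ℂ)⁻¹)).congr_fun ?_
      intro k
      have da := dl_pos (L.mem k)
      simp only [hJ, atom]
      rw [integral_mul_const]
      have : ((dl (a k) ^ (-s) : ℝ) : ℂ) * ((dl (a k) ^ s : ℝ) : ℂ) = 1 := by
        rw [← Complex.ofReal_mul, ← Real.rpow_add da]; simp
      push_cast at this ⊢
      linear_combination ((κ : ℂ)⁻¹ * (∫ w in Ek k, ((dl w ^ b : ℝ) : ℂ) * f w ∂(tau μ)) * kk z (a k) ^ (-(b:ℂ))) * this
    refine ⟨S3.summable, ?_⟩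
    rw [S3.tsum_eq, mul_sub, ← mul_assoc, inv_mul_cancel₀ κc, one_mul, sub_sub_cancel, enorm_mul,
      ENNReal.ofReal_mul (by positivity), mul_assoc]
    refine mul_le_mul' (le_of_eq ?_) (enorm_tsum_le_tsum_enorm.trans D2)
    rw [← ofReal_norm_eq_enorm, norm_inv, Complex.norm_real, Real.norm_of_nonneg κ0.le]

lemma contraction [Nontrivial E] {p θ b : ℝ} (hp : 0 < p) (hθ : (nn E : ℝ) < θ)
    (hb : nn E * max 1 (1 / p) + (θ - nn E) / p < b) :
    ∃ a : ℕ → E, (∀ k, ‖a k‖ < 1) ∧ ∃ C : ℝ≥0∞, C ≠ ∞ ∧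
      (∀ c : ℕ → ℝ≥0∞, ∫⁻ z, (∑' k, c k * atN (b - θ / p) b (a k) z) ^ p ∂(tb μ θ) ≤ C * ∑' k, c k ^ p) ∧
      ∀ f : E → ℂ, DifferentiableOn ℂ f (BB E) → ∫⁻ z, ‖f z‖ₑ ^ p ∂(tb μ θ) ≠ ∞ →
        ∃ c : ℕ → ℂ, ∑' k, ‖c k‖ₑ ^ p ≤ C * ∫⁻ z, ‖f z‖ₑ ^ p ∂(tb μ θ) ∧
          (∀ z, ‖z‖ < 1 → Summable (fun k => c k * atom (b - θ / p) b (a k) z)) ∧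
          ∫⁻ z, ‖f z - ∑' k, c k * atom (b - θ / p) b (a k) z‖ₑ ^ p ∂(tb μ θ) ≤
            ENNReal.ofReal (4 ^ (-p)) * ∫⁻ z, ‖f z‖ₑ ^ p ∂(tb μ θ) := by
  have h0 : (0:ℝ) ≤ nn E := Nat.cast_nonneg _
  obtain ⟨hpb, hb0⟩ := hpb_of hp hθ hb
  have hbn : (nn E : ℝ) < b := by
    have : 0 < (θ - nn E) / p := div_pos (by linarith) hp
    nlinarith [le_max_left 1 (1 / p)]
  haveI := isFinite_tb μ hbn
  obtain ⟨C1, hC1, H1⟩ := K1 μ hp hθ hb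
  set κ := (tb μ b).real Set.univ with hκ
  have κ0 : 0 < κ := ENNReal.toReal_pos (tb_univ_ne μ b) (measure_ne_top _ _)
  set ε := (4 ^ (-p) / (C1.toReal + 1)) ^ (1 / p) with hε
  have hC10 : 0 ≤ C1.toReal := ENNReal.toReal_nonneg
  have ε0 : 0 < ε := by positivity
  obtain ⟨r, hr0, hr1, hr⟩ := cpow_close (E := E) (b := b) (η := κ * ε) (by positivity)
  obtain ⟨a, Ek, m, M, L, hm, hM⟩ := exists_lat μ hr0 hr1
  obtain ⟨C3, hC3, H3⟩ := K3 μ hp hθ hb hr1 L hm hM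
  obtain ⟨C2, hC2, H2⟩ := K2 μ hp hθ hb hr1 L hm hM
  set D := ENNReal.ofReal κ⁻¹ ^ p * C2 with hD
  have hDt : D ≠ ∞ := ENNReal.mul_ne_top (ENNReal.rpow_ne_top_of_nonneg hp.le ENNReal.ofReal_ne_top) hC2
  refine ⟨a, L.mem, max C3 D, by simp [hC3, hDt], fun c => (H3 c).trans (by gcongr; exact le_max_left _ _), ?_⟩
  intro f hf hfi
  have hT : ∀ z, ‖z‖ < 1 → TT μ b (fun w => ‖f w‖ₑ) z ≠ ∞ := by
    intro z hz
    refine pt_fin μ hp θ ENNReal.ofReal_ne_top (fun z0 hz0 => TT_bd μ hz hz0 hb0.le _) ?_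
    exact ne_top_of_le_ne_top (ENNReal.mul_ne_top hC1 hfi) (H1 f hf)
  obtain ⟨c, hc1, hc2⟩ := step μ hbn (b - θ / p) (by positivity) hr L hf hT
  refine ⟨c, ?_, fun z hz => (hc2 z hz).1, ?_⟩
  · calc _ ≤ ∑' k, ENNReal.ofReal κ⁻¹ ^ p * (ENNReal.ofReal (dl (a k) ^ (-(b - θ / p))) *
        ∫⁻ w in Ek k, ENNReal.ofReal (dl w ^ b) * ‖f w‖ₑ ∂(tau μ)) ^ p := by
          refine ENNReal.tsum_le_tsum (fun k => ?_)
          rw [← ENNReal.mul_rpow_of_nonneg _ _ hp.le]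
          exact ENNReal.rpow_le_rpow (hc1 k) hp.le
      _ ≤ ENNReal.ofReal κ⁻¹ ^ p * (C2 * ∫⁻ z, ‖f z‖ₑ ^ p ∂(tb μ θ)) := by
          rw [ENNReal.tsum_mul_left]
          gcongr
          exact H2 f hf
      _ ≤ _ := by
          rw [← mul_assoc]
          gcongr
          exact le_max_right _ _
  · calc _ ≤ ∫⁻ z, ENNReal.ofReal ε ^ p * TT μ b (fun w => ‖f w‖ₑ) z ^ p ∂(tb μ θ) := by
          refine lintegral_mono_ae ?_
          filter_upwards [ae_tb μ θ] with z hz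
          rw [← ENNReal.mul_rpow_of_nonneg _ _ hp.le]
          refine ENNReal.rpow_le_rpow ((hc2 z hz).2.trans (le_of_eq ?_)) hp.le
          congr 2
          rw [← hκ]
          field_simp
      _ = ENNReal.ofReal ε ^ p * ∫⁻ z, TT μ b (fun w => ‖f w‖ₑ) z ^ p ∂(tb μ θ) := by
          rw [lintegral_const_mul' _ _ (ENNReal.rpow_ne_top_of_nonneg hp.le ENNReal.ofReal_ne_top)]
      _ ≤ ENNReal.ofReal ε ^ p * (C1 * ∫⁻ z, ‖f z‖ₑ ^ p ∂(tb μ θ)) := by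
          gcongr
          exact H1 f hf
      _ ≤ _ := by
          rw [← mul_assoc]
          gcongr
          rw [ENNReal.ofReal_rpow_of_nonneg ε0.le hp.le, hε, ← Real.rpow_mul (by positivity),
            one_div_mul_cancel hp.ne', Real.rpow_one]
          refine le_trans (le_of_eq (congrArg _ (ENNReal.ofReal_toReal hC1).symm)) ?_
          rw [← ENNReal.ofReal_mul (by positivity)]
          refine ENNReal.ofReal_le_ofReal ?_
          rw [div_mul_eq_mul_div, div_le_iff₀ (by positivity)]
          have : (0:ℝ) < 4 ^ (-p) := by positivity
          nlinarith

end contr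
end CR

namespace CR
section iter
variable {E : Type*} [NormedAddCommGroup E] [InnerProductSpace ℂ E] [FiniteDimensional ℂ E]
  [MeasurableSpace E] [BorelSpace E] (μ : Measure E) [μ.IsAddHaarMeasure]

lemma hasFDerivAt_atom {s b : ℝ} {a z : E} (ha : ‖a‖ < 1) (hz : ‖z‖ < 1) :
    HasFDerivAt (atom s b a) (((dl a ^ s : ℝ) : ℂ) •
      ((((-b : ℝ) : ℂ) * kk z a ^ (((-b : ℝ) : ℂ) - 1)) • (-(innerSL ℂ a)))) z := by
  unfold atom
  refine HasFDerivAt.const_mul ?_ _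
  have h1 : HasDerivAt (fun x : ℂ => x ^ ((-b : ℝ) : ℂ)) (((-b : ℝ) : ℂ) * kk z a ^ (((-b : ℝ) : ℂ) - 1)) (kk z a) :=
    (Complex.hasStrictDerivAt_cpow_const (Or.inl (kk_re_pos hz ha))).hasDerivAt
  exact HasDerivAt.comp_hasFDerivAt (f := fun w => kk w a) z h1 (hasFDerivAt_kk a z)

lemma norm_Datom {s b : ℝ} (hb : 0 ≤ b) {a z : E} {R : ℝ} (hR : R < 1) (ha : ‖a‖ < 1) (hz : ‖z‖ < R) :
    ‖((dl a ^ s : ℝ) : ℂ) •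
      ((((-b : ℝ) : ℂ) * kk z a ^ (((-b : ℝ) : ℂ) - 1)) • (-(innerSL ℂ a)))‖ ≤
      (b * (1 - R) ^ (-b - 1)) * dl a ^ s := by
  have da := dl_pos ha
  have hz1 : ‖z‖ < 1 := hz.trans hR
  have h1 : ((-b : ℝ) : ℂ) - 1 = ((-b - 1 : ℝ) : ℂ) := by push_cast; ring
  rw [norm_smul, norm_smul, norm_neg, innerSL_apply_norm, norm_mul, h1, norm_kkpow hz1 ha, Complex.norm_real,
    Complex.norm_real, Real.norm_of_nonneg (by positivity), Real.norm_eq_abs, abs_neg, abs_of_nonneg hb]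
  have h2 := kk_norm_ge z a ha
  have h3 : ‖kk z a‖ ^ (-b - 1) ≤ (1 - R) ^ (-b - 1) :=
    Real.rpow_le_rpow_of_nonpos (by linarith) (by linarith) (by linarith)
  have h4 : 0 < (1 - R) ^ (-b - 1) := Real.rpow_pos_of_pos (by linarith) _
  calc _ ≤ dl a ^ s * ((b * (1 - R) ^ (-b - 1)) * 1) := by gcongr
    _ = _ := by ring

lemma diff_sum {s b : ℝ} (hb : 0 ≤ b) {a : ℕ → E} (ha : ∀ k, ‖a k‖ < 1) {c : ℕ → ℂ}
    (hc : Summable (fun k => c k * atom s b (a k) 0)) :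
    DifferentiableOn ℂ (fun z => ∑' k, c k * atom s b (a k) z) (BB E) := by
  intro z hz
  have hz1 := mem_ball.1 hz
  obtain ⟨R, hR1, hR2⟩ := exists_between hz1
  have hu : Summable (fun k => ‖c k‖ * ((b * (1 - R) ^ (-b - 1)) * dl (a k) ^ s)) := by
    have := (summable_norm_iff.2 hc).mul_left (b * (1 - R) ^ (-b - 1))
    refine this.congr (fun k => ?_)
    have da := dl_pos (ha k)
    rw [norm_mul, atom]
    simp only [kk, inner_zero_right, sub_zero, Complex.one_cpow, mul_one, Complex.norm_real]
    rw [Real.norm_of_nonneg (by positivity)]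
    ring
  have := hasFDerivAt_tsum_of_isPreconnected (𝕜 := ℂ) (f := fun k z => c k * atom s b (a k) z)
    (f' := fun k z => c k • (((dl (a k) ^ s : ℝ) : ℂ) •
      ((((-b : ℝ) : ℂ) * kk z (a k) ^ (((-b : ℝ) : ℂ) - 1)) • (-(innerSL ℂ (a k))))))
    (s := Metric.ball (0:E) R) (x₀ := 0) (x := z) hu Metric.isOpen_ball
    (convex_ball (0:E) R).isPreconnected ?_ ?_ ?_ hc ?_
  · exact this.differentiableAt.differentiableWithinAt
  · intro k x hx
    rw [mem_ball_zero_iff] at hx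
    exact (hasFDerivAt_atom (ha k) (hx.trans hR2)).const_mul _
  · intro k x hx
    rw [mem_ball_zero_iff] at hx
    rw [norm_smul]
    gcongr
    exact norm_Datom hb hR2 (ha k) hx
  · rw [mem_ball_zero_iff, norm_zero]; exact lt_of_le_of_lt (norm_nonneg z) hR1
  · rwa [mem_ball_zero_iff]

lemma pt_eval [Nontrivial E] {p θ b : ℝ} (hp : 0 < p) (hθ : (nn E : ℝ) < θ)
    (hb : nn E * max 1 (1 / p) + (θ - nn E) / p < b) {z : E} (hz : ‖z‖ < 1) :
    ∃ C : ℝ≥0∞, C ≠ ∞ ∧ ∀ f : E → ℂ, DifferentiableOn ℂ f (BB E) → ∫⁻ z, ‖f z‖ₑ ^ p ∂(tb μ θ) ≠ ∞ →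
      ‖f z‖ₑ ^ p ≤ C * ∫⁻ z, ‖f z‖ₑ ^ p ∂(tb μ θ) := by
  have h0 : (0:ℝ) ≤ nn E := Nat.cast_nonneg _
  obtain ⟨hpb, hb0⟩ := hpb_of hp hθ hb
  have hbn : (nn E : ℝ) < b := by
    have : 0 < (θ - nn E) / p := div_pos (by linarith) hp
    nlinarith [le_max_left 1 (1 / p)]
  haveI := isFinite_tb μ hbn
  haveI := isFinite_tb μ hθ
  obtain ⟨C1, hC1, H1⟩ := K1 μ hp hθ hb
  set κ := (tb μ b).real Set.univ with hκ
  have κ0 : 0 < κ := ENNReal.toReal_pos (tb_univ_ne μ b) (measure_ne_top _ _)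
  set K := ENNReal.ofReal (((1 - ‖z‖) / 2) ^ (-b)) with hK
  set U := ENNReal.ofReal κ ^ p * tb μ θ Set.univ with hU
  have U0 : U ≠ 0 := by
    refine mul_ne_zero ?_ (tb_univ_ne μ θ)
    simp [κ0, hp.le, hp]
  have Ut : U ≠ ∞ := ENNReal.mul_ne_top (ENNReal.rpow_ne_top_of_nonneg hp.le ENNReal.ofReal_ne_top) (measure_ne_top _ _)
  refine ⟨K ^ p * C1 / U, ENNReal.div_ne_top (ENNReal.mul_ne_top (ENNReal.rpow_ne_top_of_nonneg hp.le
    ENNReal.ofReal_ne_top) hC1) U0, fun f hf hfi => ?_⟩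
  have hT : TT μ b (fun w => ‖f w‖ₑ) z ≠ ∞ := by
    refine pt_fin μ hp θ ENNReal.ofReal_ne_top (fun z0 hz0 => TT_bd μ hz hz0 hb0.le _) ?_
    exact ne_top_of_le_ne_top (ENNReal.mul_ne_top hC1 hfi) (H1 f hf)
  have e1 : ENNReal.ofReal κ * ‖f z‖ₑ ≤ TT μ b (fun w => ‖f w‖ₑ) z := by
    obtain ⟨-, Ge⟩ := repro μ hbn hf hz hT
    have : ENNReal.ofReal κ * ‖f z‖ₑ = ‖(κ : ℂ) * f z‖ₑ := by
      rw [enorm_mul, ← ofReal_norm_eq_enorm (κ : ℂ), Complex.norm_real, Real.norm_of_nonneg κ0.le]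
    rw [this, ← Ge]
    refine (enorm_integral_le_lintegral_enorm _).trans (le_of_eq ?_)
    unfold TT
    refine lintegral_congr_ae ?_
    filter_upwards [ae_tau μ] with w hw
    have dw := dl_pos hw
    rw [enorm_mul, enorm_mul, ENNReal.ofReal_mul (by positivity), ← ofReal_norm_eq_enorm,
      ← ofReal_norm_eq_enorm (kk z w ^ _), norm_kkpow hz hw, Complex.norm_real, Real.norm_of_nonneg (by positivity)]
    ring
  have e2 := pt_bd μ hp θ (F := TT μ b (fun w => ‖f w‖ₑ)) (z := z) ENNReal.ofReal_ne_top
    (fun z0 hz0 => TT_bd μ hz hz0 hb0.le _)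
  rw [← ENNReal.mul_div_right_comm, ENNReal.le_div_iff_mul_le (Or.inl U0) (Or.inl Ut)]
  calc _ = (ENNReal.ofReal κ * ‖f z‖ₑ) ^ p * tb μ θ Set.univ := by
        rw [hU, ENNReal.mul_rpow_of_nonneg _ _ hp.le]; ring
    _ ≤ TT μ b (fun w => ‖f w‖ₑ) z ^ p * tb μ θ Set.univ := by gcongr
    _ ≤ _ := e2
    _ ≤ _ := by
      rw [mul_assoc]
      gcongr
      exact H1 f hf

lemma abs_sum {p θ s b : ℝ} (hp : 0 < p) (hb : 0 ≤ b) {a : ℕ → E} (ha : ∀ k, ‖a k‖ < 1) {C : ℝ≥0∞} (hC : C ≠ ∞)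
    (K : ∀ c : ℕ → ℝ≥0∞, ∫⁻ z, (∑' k, c k * atN s b (a k) z) ^ p ∂(tb μ θ) ≤ C * ∑' k, c k ^ p)
    {c : ℕ → ℝ≥0∞} (hc : ∑' k, c k ^ p ≠ ∞) {z : E} (hz : ‖z‖ < 1) :
    ∑' k, c k * atN s b (a k) z ≠ ∞ := by
  refine pt_fin μ hp θ (C := ENNReal.ofReal (((1 - ‖z‖) / 2) ^ (-b)))
    (F := fun z => ∑' k, c k * atN s b (a k) z) ENNReal.ofReal_ne_top ?_
    (ne_top_of_le_ne_top (ENNReal.mul_ne_top hC hc) (K c))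
  intro z0 hz0
  rw [← ENNReal.tsum_mul_left]
  refine ENNReal.tsum_le_tsum (fun k => ?_)
  calc _ ≤ c k * (ENNReal.ofReal (((1 - ‖z‖) / 2) ^ (-b)) * atN s b (a k) z0) := by
        gcongr; exact atN_bd hz hz0 (ha k) hb s
    _ = _ := by ring

lemma geo_sum {p : ℝ} (hp : 0 < p) (x : ℕ → ℝ≥0∞) :
    (∑' m, x m) ^ p ≤ 2 ^ p * ∑' m, ((2:ℝ≥0∞) ^ p) ^ m * x m ^ p := by
  set S := ∑' m, ((2:ℝ≥0∞) ^ p) ^ m * x m ^ p with hS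
  have h1 : ∀ m, x m ≤ (2⁻¹ : ℝ≥0∞) ^ m * S ^ (1 / p) := by
    intro m
    have h2 : ((2:ℝ≥0∞) ^ m * x m) ^ p ≤ S := by
      refine le_trans (le_of_eq ?_) (ENNReal.le_tsum m)
      rw [ENNReal.mul_rpow_of_nonneg _ _ hp.le, ← ENNReal.rpow_natCast, ← ENNReal.rpow_mul, ← ENNReal.rpow_natCast,
        ← ENNReal.rpow_mul, mul_comm p]
    have h3 : (2:ℝ≥0∞) ^ m * x m ≤ S ^ (1 / p) := by
      rw [one_div]; exact (ENNReal.le_rpow_inv_iff hp).2 h2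
    calc x m = (2⁻¹ : ℝ≥0∞) ^ m * (2 ^ m * x m) := by
          rw [← mul_assoc, ← mul_pow, ENNReal.inv_mul_cancel (by simp) (by simp), one_pow, one_mul]
      _ ≤ _ := by gcongr
  calc _ ≤ (∑' m, (2⁻¹ : ℝ≥0∞) ^ m * S ^ (1 / p)) ^ p :=
        ENNReal.rpow_le_rpow (ENNReal.tsum_le_tsum h1) hp.le
    _ = _ := by
        rw [ENNReal.tsum_mul_right, ENNReal.tsum_geometric, ENNReal.one_sub_inv_two, inv_inv,
          ENNReal.mul_rpow_of_nonneg _ _ hp.le, ← ENNReal.rpow_mul, one_div_mul_cancel hp.ne', ENNReal.rpow_one]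

lemma summ_of {s b : ℝ} {a : ℕ → E} (ha : ∀ k, ‖a k‖ < 1) {c : ℕ → ℂ} {z : E} (hz : ‖z‖ < 1)
    (h : ∑' k, ‖c k‖ₑ * atN s b (a k) z ≠ ∞) : Summable (fun k => c k * atom s b (a k) z) := by
  refine Summable.of_enorm ?_
  simpa only [enorm_mul, enorm_atom (ha _) hz] using h

lemma decomp [Nontrivial E] {p θ b : ℝ} (hp : 0 < p) (hθ : (nn E : ℝ) < θ)
    (hb : nn E * max 1 (1 / p) + (θ - nn E) / p < b) :
    ∃ a : ℕ → E, (∀ k, ‖a k‖ < 1) ∧ ∃ C : ℝ≥0∞, C ≠ ∞ ∧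
      (∀ c : ℕ → ℝ≥0∞, ∫⁻ z, (∑' k, c k * atN (b - θ / p) b (a k) z) ^ p ∂(tb μ θ) ≤ C * ∑' k, c k ^ p) ∧
      ∀ f : E → ℂ, DifferentiableOn ℂ f (BB E) → ∫⁻ z, ‖f z‖ₑ ^ p ∂(tb μ θ) ≠ ∞ →
        ∃ c : ℕ → ℂ, ∑' k, ‖c k‖ₑ ^ p ≤ C * ∫⁻ z, ‖f z‖ₑ ^ p ∂(tb μ θ) ∧
          (∀ z, ‖z‖ < 1 → HasSum (fun k => c k * atom (b - θ / p) b (a k) z) (f z)) := by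
  obtain ⟨hpb, hb0⟩ := hpb_of hp hθ hb
  obtain ⟨a, ha, C, hC, K, H⟩ := contraction μ hp hθ hb
  set s := b - θ / p with hs
  set q : ℝ≥0∞ := ENNReal.ofReal (4 ^ (-p)) with hq
  set Q : ℝ≥0∞ := ∑' m : ℕ, ((2:ℝ≥0∞) ^ p * q) ^ m with hQ
  have hQt : Q ≠ ∞ := by
    rw [hQ, ENNReal.tsum_geometric]
    refine ENNReal.inv_ne_top.2 ?_
    rw [ne_eq, tsub_eq_zero_iff_le, not_le]
    have : (2:ℝ≥0∞) ^ p * q = ENNReal.ofReal (2 ^ p * 4 ^ (-p)) := by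
      rw [hq, ENNReal.ofReal_mul (by positivity), ← ENNReal.ofReal_rpow_of_pos (show (0:ℝ) < 2 by norm_num)]
      simp
    rw [this, ENNReal.ofReal_lt_one, Real.rpow_neg (by norm_num), ← div_eq_mul_inv, div_lt_one (by positivity)]
    exact Real.rpow_lt_rpow (by norm_num) (by norm_num) hp
  set C' : ℝ≥0∞ := 2 ^ p * C * Q with hC'
  have hCt : C' ≠ ∞ := ENNReal.mul_ne_top (ENNReal.mul_ne_top (by simp [hp.le]) hC) hQt
  refine ⟨a, ha, max C C', by simp [hC, hCt], fun c => (K c).trans (by gcongr; exact le_max_left _ _), ?_⟩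
  intro f hf hfi
  choose cf h1 h2 h3 using H
  -- the invariant
  let P : Type _ := {g : E → ℂ // DifferentiableOn ℂ g (BB E) ∧ ∫⁻ z, ‖g z‖ₑ ^ p ∂(tb μ θ) ≠ ∞}
  have qt : q ≠ ∞ := ENNReal.ofReal_ne_top
  let nxt : P → P := fun g => ⟨fun z => g.1 z - ∑' k, cf g.1 g.2.1 g.2.2 k * atom s b (a k) z,
    g.2.1.sub (diff_sum hb0.le ha (h2 g.1 g.2.1 g.2.2 0 (by simp))),
    ne_top_of_le_ne_top (ENNReal.mul_ne_top qt g.2.2) (h3 g.1 g.2.1 g.2.2)⟩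
  let F : ℕ → P := fun m => nxt^[m] ⟨f, hf, hfi⟩
  have F0 : (F 0).1 = f := rfl
  have FS : ∀ m z, (F (m + 1)).1 z = (F m).1 z - ∑' k, cf (F m).1 (F m).2.1 (F m).2.2 k * atom s b (a k) z := by
    intro m z
    simp only [F]
    rw [Function.iterate_succ_apply']
  set I := ∫⁻ z, ‖f z‖ₑ ^ p ∂(tb μ θ) with hI
  have Fq : ∀ m, ∫⁻ z, ‖(F m).1 z‖ₑ ^ p ∂(tb μ θ) ≤ q ^ m * I := by
    intro m
    induction m with
    | zero => simp [F0, hI]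
    | succ m ih =>
      have := h3 (F m).1 (F m).2.1 (F m).2.2
      simp only [← FS] at this
      calc _ ≤ _ := this
        _ ≤ q * (q ^ m * I) := by gcongr
        _ = _ := by ring
  set x : ℕ → ℕ → ℂ := fun m k => cf (F m).1 (F m).2.1 (F m).2.2 k with hx
  set d : ℕ → ℝ≥0∞ := fun k => ∑' m, ‖x m k‖ₑ with hd
  have dsum : ∑' k, d k ^ p ≤ C' * I := by
    calc _ ≤ ∑' k, 2 ^ p * ∑' m, ((2:ℝ≥0∞) ^ p) ^ m * ‖x m k‖ₑ ^ p :=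
          ENNReal.tsum_le_tsum (fun k => geo_sum hp _)
      _ = 2 ^ p * ∑' m, ((2:ℝ≥0∞) ^ p) ^ m * ∑' k, ‖x m k‖ₑ ^ p := by
          rw [ENNReal.tsum_mul_left, ENNReal.tsum_comm]
          simp only [ENNReal.tsum_mul_left]
      _ ≤ 2 ^ p * ∑' m, ((2:ℝ≥0∞) ^ p) ^ m * (C * (q ^ m * I)) := by
          gcongr with m
          exact (h1 (F m).1 (F m).2.1 (F m).2.2).trans (by gcongr; exact Fq m)
      _ = 2 ^ p * ∑' m, ((2:ℝ≥0∞) ^ p * q) ^ m * (C * I) := by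
          congr 1
          refine tsum_congr (fun m => ?_)
          rw [mul_pow]; ring
      _ = _ := by
          rw [ENNReal.tsum_mul_right, hC']; ring
  have dfin : ∑' k, d k ^ p ≠ ∞ := ne_top_of_le_ne_top (ENNReal.mul_ne_top hCt hfi) dsum
  have dk : ∀ k, d k ≠ ∞ := by
    intro k hk
    have := ENNReal.le_tsum (f := fun k => d k ^ p) k
    simp only [hk, ENNReal.top_rpow_of_pos hp, top_le_iff] at this
    exact dfin this
  refine ⟨fun k => ∑' m, x m k, ?_, ?_⟩
  · calc _ ≤ ∑' k, d k ^ p := by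
          refine ENNReal.tsum_le_tsum (fun k => ENNReal.rpow_le_rpow enorm_tsum_le_tsum_enorm hp.le)
      _ ≤ _ := dsum.trans (by gcongr; exact le_max_right _ _)
  · intro z hz
    have as := abs_sum μ hp hb0.le ha hC K dfin hz
    have S0 : Summable (Function.uncurry (fun m k => x m k * atom s b (a k) z)) := by
      refine Summable.of_enorm ?_
      have : ∑' q : ℕ × ℕ, ‖Function.uncurry (fun m k => x m k * atom s b (a k) z) q‖ₑ =
          ∑' m, ∑' k, ‖x m k * atom s b (a k) z‖ₑ :=
        ENNReal.tsum_prod (f := fun m k => ‖x m k * atom s b (a k) z‖ₑ)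
      rw [this, ENNReal.tsum_comm]
      refine ne_of_eq_of_ne ?_ as
      refine tsum_congr (fun k => ?_)
      simp only [enorm_mul, enorm_atom (ha _) hz, hd]
      rw [ENNReal.tsum_mul_right]
    have S1 : Summable (fun k => (∑' m, x m k) * atom s b (a k) z) := by
      refine summ_of ha hz (ne_top_of_le_ne_top as ?_)
      refine ENNReal.tsum_le_tsum (fun k => ?_)
      gcongr
      exact enorm_tsum_le_tsum_enorm
    have S2 := S0.tsum_comm
    have S3 : HasSum (fun m => ∑' k, x m k * atom s b (a k) z) (∑' m, ∑' k, x m k * atom s b (a k) z) :=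
      S0.prod.hasSum
    have T1 : ∀ M, ∑ m ∈ Finset.range M, ∑' k, x m k * atom s b (a k) z = f z - (F M).1 z := by
      intro M
      induction M with
      | zero => simp [F0]
      | succ M ih => rw [Finset.sum_range_succ, ih, FS M z]; ring
    obtain ⟨Cz, hCz, hev⟩ := pt_eval μ hp hθ hb hz
    have T2 : Tendsto (fun M => (F M).1 z) atTop (𝓝 0) := by
      rw [tendsto_zero_iff_enorm_tendsto_zero]
      have q1 : q < 1 := by
        rw [hq, ENNReal.ofReal_lt_one]
        exact Real.rpow_lt_one_of_one_lt_of_neg (by norm_num) (by linarith)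
      have t1 : Tendsto (fun M => Cz * (q ^ M * I)) atTop (𝓝 0) := by
        have t2 := ENNReal.tendsto_pow_atTop_nhds_zero_of_lt_one q1
        have t3 := ENNReal.Tendsto.mul_const t2 (Or.inr hfi)
        have t4 := ENNReal.Tendsto.const_mul t3 (a := Cz) (Or.inr hCz)
        simpa using t4
      have t5 : Tendsto (fun M => ‖(F M).1 z‖ₑ ^ p) atTop (𝓝 0) := by
        refine tendsto_of_tendsto_of_tendsto_of_le_of_le tendsto_const_nhds t1 (fun M => zero_le) (fun M => ?_)
        exact (hev (F M).1 (F M).2.1 (F M).2.2).trans (by gcongr; exact Fq M)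
      have t6 := (ENNReal.continuous_rpow_const (y := 1 / p)).continuousAt.tendsto.comp t5
      rw [ENNReal.zero_rpow_of_pos (by positivity)] at t6
      refine t6.congr (fun M => ?_)
      simp only [Function.comp]
      rw [← ENNReal.rpow_mul, mul_one_div_cancel hp.ne', ENNReal.rpow_one]
    have T3 : ∑' m, ∑' k, x m k * atom s b (a k) z = f z := by
      have t := S3.tendsto_sum_nat
      simp only [T1] at t
      have t' := (tendsto_const_nhds (x := f z)).sub T2
      rw [sub_zero] at t'
      exact tendsto_nhds_unique t t'
    have := S1.hasSum
    convert this using 1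
    rw [← T3, ← S2]
    refine tsum_congr (fun k => ?_)
    rw [tsum_mul_right]

lemma tails {p θ s b : ℝ} (hp : 0 < p) (hb : 0 ≤ b) {a : ℕ → E} (ha : ∀ k, ‖a k‖ < 1) {C : ℝ≥0∞} (hC : C ≠ ∞)
    (K : ∀ c : ℕ → ℝ≥0∞, ∫⁻ z, (∑' k, c k * atN s b (a k) z) ^ p ∂(tb μ θ) ≤ C * ∑' k, c k ^ p)
    {c : ℕ → ℂ} (hc : ∑' k, ‖c k‖ₑ ^ p ≠ ∞) {f : E → ℂ}
    (hf : ∀ z, ‖z‖ < 1 → Tendsto (fun N => ∑ k ∈ Finset.range N, c k * atom s b (a k) z) atTop (𝓝 (f z))) (N : ℕ) :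
    ∫⁻ z, ‖f z - ∑ k ∈ Finset.range N, c k * atom s b (a k) z‖ₑ ^ p ∂(tb μ θ) ≤
      C * ∑' k, ‖c (k + N)‖ₑ ^ p := by
  set e : ℕ → ℝ≥0∞ := fun k => if k < N then 0 else ‖c k‖ₑ with he
  have e1 : ∀ k, e (k + N) = ‖c (k + N)‖ₑ := by intro k; simp [he]
  have e2 : ∑' k, e k ^ p = ∑' k, ‖c (k + N)‖ₑ ^ p := by
    rw [← Summable.sum_add_tsum_nat_add' (f := fun k => e k ^ p) (k := N) ENNReal.summable]
    simp only [e1]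
    rw [Finset.sum_eq_zero, zero_add]
    intro i hi
    simp [he, Finset.mem_range.1 hi, hp]
  rw [← e2]
  refine le_trans (lintegral_mono_ae ?_) (K e)
  filter_upwards [ae_tb μ θ] with z hz
  refine ENNReal.rpow_le_rpow ?_ hp.le
  have S := summ_of (s := s) (b := b) ha hz (abs_sum μ hp hb ha hC K hc hz)
  have : f z = ∑' k, c k * atom s b (a k) z := tendsto_nhds_unique (hf z hz) S.hasSum.tendsto_sum_nat
  rw [this, ← S.sum_add_tsum_nat_add N, add_sub_cancel_left]
  refine enorm_tsum_le_tsum_enorm.trans ?_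
  refine le_trans (le_of_eq ?_) (ENNReal.tsum_comp_le_tsum_of_injective (add_left_injective N)
    (fun k => e k * atN s b (a k) z))
  refine tsum_congr (fun k => ?_)
  simp only [e1, enorm_mul, enorm_atom (ha _) hz]

end iter
end CR

namespace CR

section final

instance volHaar (n : ℕ) : (vol n).IsAddHaarMeasure := by unfold vol; infer_instance

lemma kk_herm {n : ℕ} (z w : En n) : 1 - herm z w = kk z w := by
  unfold kk herm
  rw [PiLp.inner_apply]
  simp [mul_comm]

lemma nn_En (n : ℕ) : nn (En n) = n := by simp [nn]

lemma crAtom_eq {n : ℕ} {p α b : ℝ} (hp : 0 < p) (a : ℕ → En n) (k : ℕ) (z : En n) :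
    crAtom p α b a k z = atom (b - (n + 1 + α) / p) b (a k) z := by
  unfold crAtom atom
  rw [kk_herm, div_eq_mul_inv, Complex.ofReal_neg, Complex.cpow_neg]
  have : (p * b - n - 1 - α) / p = b - (n + 1 + α) / p := by field_simp; ring
  rw [this]
  rfl

lemma cnorm_pos {n : ℕ} {α : ℝ} (hα : -1 < α) : 0 < cnorm n α := by
  unfold cnorm
  rw [if_pos hα]
  have h1 : 0 < Real.Gamma (n + α + 1) := Real.Gamma_pos_of_pos (by
    have : (0:ℝ) ≤ n := n.cast_nonneg
    linarith)
  have h2 : 0 < Real.Gamma (α + 1) := Real.Gamma_pos_of_pos (by linarith)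
  have h3 : (0:ℝ) < n.factorial := by exact_mod_cast n.factorial_pos
  positivity

lemma lintegral_measA {n : ℕ} {α : ℝ} (hα : -1 < α) (g : En n → ℝ≥0∞) :
    ∫⁻ z, g z ∂(measA n α) =
      ENNReal.ofReal (cnorm n α) * ∫⁻ z, g z ∂(tb (vol n) (n + 1 + α)) := by
  have hc := cnorm_pos (n := n) hα
  rw [lintegral_tb, lintegral_tau, ← lintegral_const_mul' _ _ ENNReal.ofReal_ne_top]
  unfold measA
  rw [lintegral_withDensity_eq_lintegral_mul_non_measurable]
  · change ∫⁻ z in BB (En n), _ ∂_ = _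
    refine setLIntegral_congr_fun measurableSet_ball ?_
    intro z hz
    have hz' : 0 < dl z := dl_pos (mem_ball.1 hz)
    simp only [Pi.mul_apply]
    rw [nn_En, ← mul_assoc, ← mul_assoc, mul_assoc (ENNReal.ofReal (cnorm n α)), ← ENNReal.ofReal_mul (by positivity), ← Real.rpow_add hz',
      ← ENNReal.ofReal_mul hc.le]
    have : -((n:ℝ) + 1) + (n + 1 + α) = α := by ring
    rw [this]
    rfl
  · exact (((continuous_dl (E := En n)).measurable.pow_const α).const_mul (cnorm n α)).ennreal_ofReal
  · exact Eventually.of_forall (fun x => ENNReal.ofReal_lt_top)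

lemma ofReal_norm_rpow {p : ℝ} (hp : 0 < p) (x : ℂ) : ENNReal.ofReal (‖x‖ ^ p) = ‖x‖ₑ ^ p := by
  rw [← ENNReal.ofReal_rpow_of_nonneg (norm_nonneg _) hp.le, ofReal_norm]

end final
end CR

/-- Atomic decomposition of Bergman spaces (Coifman–Rochberg). -/
theorem stmt3 (n : ℕ) (hn : 1 ≤ n) (p α b : ℝ) (hp : 0 < p) (hα : -1 < α)
    (hb : b > n * max 1 (1 / p) + (α + 1) / p) :
    ∃ a : ℕ → En n, (∀ k, a k ∈ uball n) ∧ ∃ C : ℝ≥0∞, 0 < C ∧ C < ⊤ ∧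
      ∀ f : En n → ℂ, DifferentiableOn ℂ f (uball n) →
        ((apnorm n p α f < ⊤ ↔
            ∃ c : ℕ → ℂ, (∑' k, ENNReal.ofReal (‖c k‖ ^ p)) < ⊤ ∧ crRep n p α b a f c) ∧
         (apnorm n p α f < ⊤ →
            C⁻¹ * sInf (crRepSums n p α b a f) ≤
                ∫⁻ z, ENNReal.ofReal (‖f z‖ ^ p) ∂measA n α ∧
              (∫⁻ z, ENNReal.ofReal (‖f z‖ ^ p) ∂measA n α) ≤
                C * sInf (crRepSums n p α b a f))) := by
  haveI : Nonempty (Fin n) := ⟨⟨0, hn⟩⟩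
  haveI : Nontrivial (En n) := by
    haveI : Nontrivial (Fin n → ℂ) := inferInstance
    exact (WithLp.equiv 2 (Fin n → ℂ)).nontrivial
  have hnn : ((CR.nn (En n) : ℕ) : ℝ) = n := by rw [CR.nn_En]
  have hθ : ((CR.nn (En n) : ℕ) : ℝ) < n + 1 + α := by rw [hnn]; linarith
  have hb' : (CR.nn (En n) : ℝ) * max 1 (1 / p) + ((n + 1 + α) - CR.nn (En n)) / p < b := by
    rw [hnn]
    have : (n + 1 + α) - (n:ℝ) = α + 1 := by ring
    rw [this]
    exact hb
  obtain ⟨-, hb0⟩ := CR.hpb_of hp hθ hb'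
  obtain ⟨a, ha, C, hC, K, H⟩ := CR.decomp (vol n) hp hθ hb'
  have hcn := CR.cnorm_pos (n := n) hα
  set κ := ENNReal.ofReal (cnorm n α) with hκ
  have hκ0 : κ ≠ 0 := by simpa [hκ] using hcn
  have hκt : κ ≠ ∞ := ENNReal.ofReal_ne_top
  have hI : ∀ g : En n → ℂ, ∫⁻ z, ENNReal.ofReal (‖g z‖ ^ p) ∂measA n α =
      κ * ∫⁻ z, ‖g z‖ₑ ^ p ∂(CR.tb (vol n) (n + 1 + α)) := by
    intro g
    rw [CR.lintegral_measA hα]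
    simp only [CR.ofReal_norm_rpow hp]
    rfl
  set D : ℝ≥0∞ := κ * C + C * κ⁻¹ + 1 with hD
  have hD0 : 0 < D := by simp [hD]
  have hDt : D < ⊤ := by
    have h1 : κ * C < ⊤ := (ENNReal.mul_ne_top hκt hC).lt_top
    have h2 : C * κ⁻¹ < ⊤ := (ENNReal.mul_ne_top hC (ENNReal.inv_ne_top.2 hκ0)).lt_top
    rw [hD]
    exact ENNReal.add_lt_top.2 ⟨ENNReal.add_lt_top.2 ⟨h1, h2⟩, ENNReal.one_lt_top⟩
  have T : ∀ (f : En n → ℂ) (c : ℕ → ℂ), ∑' k, ENNReal.ofReal (‖c k‖ ^ p) < ⊤ →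
      (∀ z ∈ uball n, Tendsto (fun N => ∑ k ∈ Finset.range N, c k * crAtom p α b a k z) atTop (𝓝 (f z))) →
      ∀ N, ∫⁻ z, ENNReal.ofReal (‖f z - ∑ k ∈ Finset.range N, c k * crAtom p α b a k z‖ ^ p) ∂measA n α ≤
        κ * C * ∑' k, ENNReal.ofReal (‖c (k + N)‖ ^ p) := by
    intro f c hc hf N
    simp only [CR.crAtom_eq hp] at hf ⊢
    simp only [CR.ofReal_norm_rpow hp] at hc
    rw [hI (fun z => f z - ∑ k ∈ Finset.range N, c k * CR.atom (b - (n + 1 + α) / p) b (a k) z)]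
    simp only [CR.ofReal_norm_rpow hp]
    rw [mul_assoc]
    have := CR.tails (vol n) hp hb0.le ha hC K hc.ne (fun z hz => hf z (CR.mem_ball.2 hz)) N
    gcongr
  have U : ∀ (f : En n → ℂ) (c : ℕ → ℂ), ∑' k, ENNReal.ofReal (‖c k‖ ^ p) < ⊤ →
      crRep n p α b a f c → ∫⁻ z, ENNReal.ofReal (‖f z‖ ^ p) ∂measA n α ≤
        κ * C * ∑' k, ENNReal.ofReal (‖c k‖ ^ p) := by
    intro f c hc hf
    simpa using T f c hc hf.1 0
  have A : ∀ f : En n → ℂ, apnorm n p α f < ⊤ ↔ ∫⁻ z, ENNReal.ofReal (‖f z‖ ^ p) ∂measA n α < ⊤ := by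
    intro f
    unfold apnorm
    exact ENNReal.rpow_lt_top_iff_of_pos (by positivity)
  have L : ∀ f : En n → ℂ, DifferentiableOn ℂ f (uball n) → apnorm n p α f < ⊤ →
      ∃ c : ℕ → ℂ, ∑' k, ENNReal.ofReal (‖c k‖ ^ p) ≤
        C * κ⁻¹ * ∫⁻ z, ENNReal.ofReal (‖f z‖ ^ p) ∂measA n α ∧
        ∑' k, ENNReal.ofReal (‖c k‖ ^ p) < ⊤ ∧ crRep n p α b a f c := by
    intro f hf hfi
    rw [A, hI] at hfi
    have hfi' : ∫⁻ z, ‖f z‖ₑ ^ p ∂(CR.tb (vol n) (n + 1 + α)) ≠ ∞ := by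
      intro h
      rw [h, ENNReal.mul_top hκ0] at hfi
      exact lt_irrefl _ hfi
    obtain ⟨c, h1, h2⟩ := H f hf hfi'
    have hct : ∑' k, ENNReal.ofReal (‖c k‖ ^ p) < ⊤ := by
      simp only [CR.ofReal_norm_rpow hp]
      exact lt_of_le_of_lt h1 (ENNReal.mul_ne_top hC hfi').lt_top
    have hpt : ∀ z ∈ uball n, Tendsto (fun N => ∑ k ∈ Finset.range N, c k * crAtom p α b a k z) atTop (𝓝 (f z)) := by
      intro z hz
      simp only [CR.crAtom_eq hp]
      exact (h2 z (CR.mem_ball.1 hz)).tendsto_sum_nat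
    refine ⟨c, ?_, hct, hpt, ?_⟩
    · rw [hI]
      simp only [CR.ofReal_norm_rpow hp]
      rw [mul_assoc, ← mul_assoc κ⁻¹, ENNReal.inv_mul_cancel hκ0 hκt, one_mul]
      exact h1
    · have ht := ENNReal.tendsto_sum_nat_add (fun k => ENNReal.ofReal (‖c k‖ ^ p)) hct.ne
      have ht2 := ENNReal.Tendsto.const_mul ht (a := κ * C) (Or.inr (ENNReal.mul_ne_top hκt hC))
      rw [mul_zero] at ht2
      exact tendsto_of_tendsto_of_tendsto_of_le_of_le tendsto_const_nhds ht2 (fun _ => zero_le) (T f c hct hpt)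
  refine ⟨a, fun k => CR.mem_ball.2 (ha k), D, hD0, hDt, ?_⟩
  intro f hf
  refine ⟨⟨fun h => ?_, ?_⟩, fun h => ⟨?_, ?_⟩⟩
  · obtain ⟨c, -, h2, h3⟩ := L f hf h
    exact ⟨c, h2, h3⟩
  · rintro ⟨c, hc, hr⟩
    rw [A]
    exact lt_of_le_of_lt (U f c hc hr) (ENNReal.mul_ne_top (ENNReal.mul_ne_top hκt hC) hc.ne).lt_top
  · obtain ⟨c, h1, h2, h3⟩ := L f hf h
    rw [mul_comm, ← div_eq_mul_inv]
    refine ENNReal.div_le_of_le_mul' ?_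
    refine (sInf_le (show _ ∈ crRepSums n p α b a f from ⟨c, h3, rfl⟩)).trans (h1.trans ?_)
    gcongr
    rw [hD]
    exact le_add_right le_add_self
  · rw [mul_comm, ← ENNReal.div_le_iff_le_mul (Or.inl hD0.ne') (Or.inl hDt.ne)]
    refine le_sInf ?_
    rintro t ⟨c, hr, rfl⟩
    refine ENNReal.div_le_of_le_mul' ?_
    by_cases hc : ∑' k, ENNReal.ofReal (‖c k‖ ^ p) < ⊤
    · refine (U f c hc hr).trans ?_
      gcongr
      rw [hD, add_assoc]
      exact le_self_add
    · rw [not_lt, top_le_iff] at hc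
      rw [hc, ENNReal.mul_top hD0.ne']
      exact le_top
end
end
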